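/- arXiv:2203.02137 — 3 statements merged into one kernel-verified Lean document; each statement's English description precedes it below -/
import Mathlib

section
/- Let m, n : ℕ and let f : (Fin m → ℝ) → (Fin n → ℝ) → ℝ be a function. Assume: (i) f is continuous as a function on the subspace {(x, y) : ∀ i, 0 < x i and ∀ j, 0 ≤ y j} of (Fin m → ℝ) × (Fin n → ℝ), with f x y ≥ 0 there; (ii) there exist F, G : MvPolynomial (Fin m ⊕ Fin n) ℕ with G ≠ 0 such that for all x, y with all coordinates strictly positive, f x y = (eval of F at (x,y)) / (eval of G at (x,y)). Then there exist F', G' : MvPolynomial (Fin m) ℕ with G' ≠ 0 such that for all x with all coordinates strictly positive, f x 0 = (eval of F' at x) / (eval of G' at x). (Here 'eval of F at z' means MvPolynomial.eval z applied to the image of F under the coefficient map ℕ → ℝ.) -/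
open MvPolynomial

open Filter Topology

theorem MvPolynomial.eval_map_natCast_pos {σ : Type*} {G : MvPolynomial σ ℕ} (hG : G ≠ 0)
    {z : σ → ℝ} (hz : ∀ i, 0 < z i) :
    0 < MvPolynomial.eval z (MvPolynomial.map (Nat.castRingHom ℝ) G) := by
  rw [MvPolynomial.eval_map, MvPolynomial.eval₂_eq]
  refine Finset.sum_pos (fun d hd => mul_pos ?_ (Finset.prod_pos fun i _ => pow_pos (hz i) _)) ?_
  · exact Nat.cast_pos.2 (Nat.pos_of_ne_zero (MvPolynomial.mem_support_iff.1 hd))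
  · exact MvPolynomial.support_nonempty.2 hG

/-- If `p = h * q` to the right of `0`, where `h` tends to `L` at `0` and `q` vanishes to order at
least `a`, then the coefficients of degree `a` satisfy the same relation with `h` replaced
by `L`. -/
theorem Polynomial.coeff_eq_mul_coeff_of_tendsto {h : ℝ → ℝ} {L : ℝ}
    (hL : Tendsto h (𝓝[>] 0) (𝓝 L)) (a : ℕ) (p q : Polynomial ℝ)
    (hpq : ∀ t, 0 < t → p.eval t = h t * q.eval t) (hq : ∀ k < a, q.coeff k = 0) :
    p.coeff a = L * q.coeff a := by
  have key (p q : Polynomial ℝ) (hpq : ∀ t, 0 < t → p.eval t = h t * q.eval t) :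
      p.coeff 0 = L * q.coeff 0 := by
    have hp : Tendsto (fun t => p.eval t) (𝓝[>] 0) (𝓝 (p.eval 0)) :=
      p.continuous.continuousAt.tendsto.mono_left nhdsWithin_le_nhds
    have hq : Tendsto (fun t => q.eval t) (𝓝[>] 0) (𝓝 (q.eval 0)) :=
      q.continuous.continuousAt.tendsto.mono_left nhdsWithin_le_nhds
    rw [Polynomial.coeff_zero_eq_eval_zero, Polynomial.coeff_zero_eq_eval_zero]
    refine tendsto_nhds_unique (hp.congr' ?_) (hL.mul hq)
    filter_upwards [self_mem_nhdsWithin] with t ht using hpq t ht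
  induction a generalizing p q with
  | zero => exact key p q hpq
  | succ a ih =>
    have hq0 : q.coeff 0 = 0 := hq 0 a.succ_pos
    have hp0 : p.coeff 0 = 0 := by rw [key p q hpq, hq0, mul_zero]
    have hdiv : ∀ t, 0 < t → p.divX.eval t = h t * q.divX.eval t := by
      intro t ht
      have e := hpq t ht
      rw [← p.divX_mul_X_add, ← q.divX_mul_X_add, hp0, hq0] at e
      simp only [map_zero, add_zero, Polynomial.eval_mul, Polynomial.eval_X] at e
      exact mul_right_cancel₀ ht.ne' (by rw [e, mul_assoc])
    have hk : ∀ k < a, q.divX.coeff k = 0 := fun k hk => by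
      rw [Polynomial.coeff_divX]
      exact hq _ (Nat.succ_lt_succ hk)
    have := ih p.divX q.divX hdiv hk
    simp only [Polynomial.coeff_divX] at this
    exact this

/-- Replace all variables in the second family by a single variable. -/
noncomputable def MvPolynomial.diagonalSnd (σ τ : Type*) :
    MvPolynomial (σ ⊕ τ) ℕ →+* Polynomial (MvPolynomial σ ℕ) :=
  MvPolynomial.eval₂Hom (Polynomial.C.comp MvPolynomial.C)
    (Sum.elim (fun i => Polynomial.C (MvPolynomial.X i)) fun _ => Polynomial.X)

theorem MvPolynomial.eval_map_diagonalSnd {σ τ : Type*} (F : MvPolynomial (σ ⊕ τ) ℕ)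
    (x : σ → ℝ) (t : ℝ) :
    ((diagonalSnd σ τ F).map
        ((MvPolynomial.eval x).comp (MvPolynomial.map (Nat.castRingHom ℝ)))).eval t =
      MvPolynomial.eval (Sum.elim x fun _ => t) (MvPolynomial.map (Nat.castRingHom ℝ) F) := by
  induction F using MvPolynomial.induction_on with
  | C a => simp [diagonalSnd]
  | add p q hp hq => simp only [map_add, Polynomial.map_add, Polynomial.eval_add, hp, hq]
  | mul_X p i hp =>
    simp only [map_mul, Polynomial.map_mul, Polynomial.eval_mul, hp]
    cases i <;> simp [diagonalSnd]

theorem MvPolynomial.diagonalSnd_ne_zero {σ τ : Type*} {G : MvPolynomial (σ ⊕ τ) ℕ}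
    (hG : G ≠ 0) : diagonalSnd σ τ G ≠ 0 := by
  intro h0
  have hpos : 0 < MvPolynomial.eval (Sum.elim (fun _ => 1) fun _ => 1)
      (MvPolynomial.map (Nat.castRingHom ℝ) G) :=
    eval_map_natCast_pos hG (by rintro (i | i) <;> simp)
  rw [← eval_map_diagonalSnd, h0] at hpos
  simp at hpos

/-- (Galashin–Karp–Lam) If a nonnegative function, continuous on `ℝ_{>0}^m × ℝ_{≥0}^n`,
restricts to an admissible function on `ℝ_{>0}^{m+n}`, then its restriction to
`ℝ_{>0}^m × {0}` is admissible. -/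
theorem admissible_of_continuous_restriction (m n : ℕ)
    (f : (Fin m → ℝ) → (Fin n → ℝ) → ℝ)
    (hcont : ContinuousOn (fun p : (Fin m → ℝ) × (Fin n → ℝ) => f p.1 p.2)
      {p : (Fin m → ℝ) × (Fin n → ℝ) | (∀ i, 0 < p.1 i) ∧ (∀ j, 0 ≤ p.2 j)})
    (hnonneg : ∀ x y, (∀ i, 0 < x i) → (∀ j, 0 ≤ y j) → 0 ≤ f x y)
    (F G : MvPolynomial (Fin m ⊕ Fin n) ℕ) (hG : G ≠ 0)
    (hFG : ∀ x y, (∀ i, 0 < x i) → (∀ j, 0 < y j) →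
      f x y =
        MvPolynomial.eval (Sum.elim x y) (MvPolynomial.map (Nat.castRingHom ℝ) F) /
          MvPolynomial.eval (Sum.elim x y) (MvPolynomial.map (Nat.castRingHom ℝ) G)) :
    ∃ F' G' : MvPolynomial (Fin m) ℕ, G' ≠ 0 ∧
      ∀ x : Fin m → ℝ, (∀ i, 0 < x i) →
        f x 0 =
          MvPolynomial.eval x (MvPolynomial.map (Nat.castRingHom ℝ) F') /
            MvPolynomial.eval x (MvPolynomial.map (Nat.castRingHom ℝ) G') := by
  refine ⟨(diagonalSnd _ _ F).coeff (diagonalSnd _ _ G).natTrailingDegree,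
    (diagonalSnd _ _ G).coeff (diagonalSnd _ _ G).natTrailingDegree, ?_, fun x hx => ?_⟩
  · exact Polynomial.trailingCoeff_nonzero_iff_nonzero.2 (diagonalSnd_ne_zero hG)
  have hG' : (diagonalSnd _ _ G).coeff (diagonalSnd _ _ G).natTrailingDegree ≠ 0 :=
    Polynomial.trailingCoeff_nonzero_iff_nonzero.2 (diagonalSnd_ne_zero hG)
  rw [eq_div_iff (eval_map_natCast_pos hG' hx).ne']
  have hL : Tendsto (fun t : ℝ => f x fun _ => t) (𝓝[>] 0) (𝓝 (f x 0)) := by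
    have hc := hcont (x, 0) ⟨hx, fun _ => le_rfl⟩
    refine Tendsto.comp (f := fun t : ℝ => (x, fun _ : Fin n => t)) hc ?_
    refine tendsto_nhdsWithin_iff.2 ⟨?_, ?_⟩
    · have : Continuous fun t : ℝ => (x, fun _ : Fin n => t) := by fun_prop
      exact (this.tendsto 0).mono_left nhdsWithin_le_nhds
    · filter_upwards [self_mem_nhdsWithin] with t ht using ⟨hx, fun _ => le_of_lt ht⟩
  have key := Polynomial.coeff_eq_mul_coeff_of_tendsto hL (diagonalSnd _ _ G).natTrailingDegree
    ((diagonalSnd _ _ F).map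
      ((MvPolynomial.eval x).comp (MvPolynomial.map (Nat.castRingHom ℝ))))
    ((diagonalSnd _ _ G).map
      ((MvPolynomial.eval x).comp (MvPolynomial.map (Nat.castRingHom ℝ)))) ?_ ?_
  · simpa only [Polynomial.coeff_map, RingHom.comp_apply] using key.symm
  · intro t ht
    rw [eval_map_diagonalSnd, eval_map_diagonalSnd, hFG x _ hx fun _ => ht, div_mul_cancel₀]
    exact (eval_map_natCast_pos hG (by rintro (i | i) <;> simp [hx, ht])).ne'
  · intro k hk
    rw [Polynomial.coeff_map, Polynomial.coeff_eq_zero_of_lt_natTrailingDegree hk, map_zero]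
end

section
/- Let d : ℕ and let X be a compact Hausdorff topological space such that every point p ∈ X satisfies one of the following: (type 1) p has an open neighborhood homeomorphic to EuclideanSpace ℝ (Fin (d+1)); or (type 2) there is an open neighborhood U of p and a homeomorphism φ from U (with the subspace topology) onto {t : ℝ // 0 ≤ t} × EuclideanSpace ℝ (Fin d) with (φ p).1 = 0. Let ∂X denote the set of points of type 2. If ∂X (with the subspace topology) is homeomorphic to the unit sphere Metric.sphere (0 : EuclideanSpace ℝ (Fin (d+1))) 1 and X \ ∂X (with the subspace topology) is homeomorphic to EuclideanSpace ℝ (Fin (d+1)), then X is homeomorphic to the closed unit ball Metric.closedBall (0 : EuclideanSpace ℝ (Fin (d+1))) 1. -/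
/-- A point `p` of `X` has an open neighborhood homeomorphic to `ℝ^{d+1}`
(an interior-type chart). -/
def IsInteriorPoint (d : ℕ) {X : Type*} [TopologicalSpace X] (p : X) : Prop :=
  ∃ U : Set X, IsOpen U ∧ p ∈ U ∧ Nonempty (U ≃ₜ EuclideanSpace ℝ (Fin (d + 1)))

/-- A point `p` of `X` has an open neighborhood homeomorphic to `ℝ_{≥0} × ℝ^d`
with `p` mapping into `{0} × ℝ^d` (a boundary-type chart). -/
def IsBoundaryPoint (d : ℕ) {X : Type*} [TopologicalSpace X] (p : X) : Prop :=
  ∃ U : Set X, IsOpen U ∧ ∃ hp : p ∈ U,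
    ∃ φ : U ≃ₜ ({t : ℝ // 0 ≤ t} × EuclideanSpace ℝ (Fin d)),
      ((φ ⟨p, hp⟩).1 : ℝ) = 0

open Set Filter Topology Metric Function

section RadialPower

variable {E : Type*} [NormedAddCommGroup E] [NormedSpace ℝ E]

/-- The radial map `v ↦ ‖v‖ ^ m • v` on the closed unit ball, extended by the identity. -/
def radialPow (m : ℕ) (v : E) : E := (min ‖v‖ 1) ^ m • v

theorem continuous_radialPow (m : ℕ) : Continuous (radialPow m : E → E) := by
  unfold radialPow
  fun_prop

theorem norm_radialPow (m : ℕ) (v : E) : ‖radialPow m v‖ = (min ‖v‖ 1) ^ m * ‖v‖ := by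
  have h : 0 ≤ min ‖v‖ 1 := by positivity
  rw [radialPow, norm_smul, norm_pow, Real.norm_eq_abs, abs_of_nonneg h]

theorem norm_radialPow_le (m : ℕ) (v : E) : ‖radialPow m v‖ ≤ ‖v‖ := by
  rw [norm_radialPow]
  exact mul_le_of_le_one_left (norm_nonneg v) (pow_le_one₀ (by positivity) (min_le_right _ _))

theorem radialPow_of_one_le (m : ℕ) {v : E} (hv : 1 ≤ ‖v‖) : radialPow m v = v := by
  simp [radialPow, min_eq_right hv]

theorem norm_radialPow_of_le (m : ℕ) {v : E} (hv : ‖v‖ ≤ 1) :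
    ‖radialPow m v‖ = ‖v‖ ^ (m + 1) := by
  rw [norm_radialPow, min_eq_left hv, pow_succ]

@[simp] theorem radialPow_zero (m : ℕ) : radialPow m (0 : E) = 0 := by simp [radialPow]

theorem norm_le_one_of_norm_radialPow_le_one {m : ℕ} {v : E} (h : ‖radialPow m v‖ ≤ 1) :
    ‖v‖ ≤ 1 := by
  by_contra! hv
  rw [radialPow_of_one_le m hv.le] at h
  exact absurd h (not_le.2 hv)

theorem radialPow_injective (m : ℕ) : Injective (radialPow m : E → E) := by
  intro v w h
  have key : ∀ a b : ℝ, 0 ≤ a → a < b → (min a 1) ^ m * a < (min b 1) ^ m * b := by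
    intro a b ha hab
    have hb : 0 < b := ha.trans_lt hab
    calc (min a 1) ^ m * a ≤ (min b 1) ^ m * a := by gcongr
      _ < (min b 1) ^ m * b := by gcongr
  have hn : ‖v‖ = ‖w‖ := by
    have h' := congrArg norm h
    rw [norm_radialPow, norm_radialPow] at h'
    rcases lt_trichotomy ‖v‖ ‖w‖ with hlt | heq | hgt
    · exact absurd h' (key _ _ (norm_nonneg _) hlt).ne
    · exact heq
    · exact absurd h' (key _ _ (norm_nonneg _) hgt).ne'
  by_cases hv : v = 0
  · rw [hv, norm_zero] at hn
    rw [hv, norm_eq_zero.1 hn.symm]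
  · have hpos : 0 < min ‖v‖ 1 := lt_min (norm_pos_iff.2 hv) one_pos
    unfold radialPow at h
    rw [← hn] at h
    exact smul_right_injective E (pow_pos hpos m).ne' h

theorem radialPow_surjective (m : ℕ) : Surjective (radialPow m : E → E) := by
  intro v
  by_cases hv : 1 ≤ ‖v‖
  · exact ⟨v, radialPow_of_one_le m hv⟩
  by_cases h0 : v = 0
  · exact ⟨0, by simp [h0]⟩
  have hpos : 0 < ‖v‖ := norm_pos_iff.2 h0
  set u : ℝ := ‖v‖ ^ ((m + 1 : ℕ) : ℝ)⁻¹ with hu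
  have hu0 : 0 < u := Real.rpow_pos_of_pos hpos _
  have hum : u ^ (m + 1) = ‖v‖ := Real.rpow_inv_natCast_pow hpos.le (Nat.succ_ne_zero m)
  have hu1 : u ≤ 1 := Real.rpow_le_one hpos.le (not_le.1 hv).le (by positivity)
  refine ⟨(u / ‖v‖) • v, ?_⟩
  have hnorm : ‖(u / ‖v‖) • v‖ = u := by
    rw [norm_smul, Real.norm_eq_abs, abs_of_pos (by positivity), div_mul_cancel₀ _ hpos.ne']
  rw [radialPow, hnorm, min_eq_left hu1, smul_smul, ← mul_div_assoc, ← pow_succ, hum,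
    div_self hpos.ne', one_smul]

theorem norm_iterate_radialPow_le {m : ℕ} (hm : m ≠ 0) {c : ℝ} (hc : c ≤ 1) (i : ℕ) {v : E}
    (hv : ‖v‖ ≤ c) : ‖(radialPow m)^[i] v‖ ≤ c ^ i * c := by
  have hc0 : 0 ≤ c := (norm_nonneg v).trans hv
  induction i with
  | zero => simpa using hv
  | succ i ih =>
    rw [iterate_succ_apply']
    set w := (radialPow m)^[i] v
    have hw : ‖w‖ ≤ c := ih.trans (mul_le_of_le_one_left hc0 (pow_le_one₀ hc0 hc))
    rw [norm_radialPow, pow_succ', mul_assoc]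
    refine mul_le_mul ?_ ih (norm_nonneg _) hc0
    calc (min ‖w‖ 1) ^ m ≤ min ‖w‖ 1 :=
          pow_le_of_le_one (by positivity) (min_le_right _ _) hm
      _ ≤ c := (min_le_left _ _).trans hw

theorem norm_iterate_radialPow_le_one {m i : ℕ} {v : E} :
    ‖(radialPow m)^[i] v‖ ≤ 1 ↔ ‖v‖ ≤ 1 := by
  induction i with
  | zero => simp
  | succ i ih =>
    rw [iterate_succ_apply', ← ih]
    exact ⟨norm_le_one_of_norm_radialPow_le_one, (norm_radialPow_le m _).trans⟩

end RadialPower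

section Limit

variable {X E : Type*} [TopologicalSpace X] [NormedAddCommGroup E] [NormedSpace ℝ E]

/-- If `q` maps `X` onto the closed unit ball, fails to be injective only over a set `K` which a
self-map `ω` expands from a single fixed point, and semiconjugates `ω` to the inverse of a radial
contraction away from `K`, then `X` is itself a closed ball. -/
theorem nonempty_homeomorph_closedBall_of_expanding [CompactSpace X] {q : X → E}
    (hq : Continuous q) (hrange : range q = closedBall 0 1)
    {ω : X → X} (hω : Continuous ω) (hωinj : Injective ω) (hωsurj : Surjective ω) {K : Set X}
    (hKc : IsClosed K) {c : ℝ} (hc : c < 1) (hqK : ∀ y ∈ K, ‖q y‖ ≤ c)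
    (hinj : InjOn q Kᶜ) (hq0 : ∀ y ∉ K, q y ≠ 0) {m : ℕ} (hm : m ≠ 0)
    (hsemi : ∀ y, ω y ∉ K → radialPow m (q (ω y)) = q y)
    (hnest : ∀ y, ω y ∈ K → y ∈ K) {p : X} (hp : K ∈ 𝓝 p) (hωp : ω p = p)
    (hexp : ∀ x, x ≠ p → ∃ i : ℕ, ω^[i] x ∉ K) :
    Nonempty (X ≃ₜ closedBall (0 : E) 1) := by
  classical
  have hpK : p ∈ K := mem_of_mem_nhds hp
  have hc0 : 0 ≤ c := (norm_nonneg _).trans (hqK p hpK)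
  have hout : ∀ (i : ℕ) x, ω^[i] x ∉ K → ∀ j, i ≤ j →
      ω^[j] x ∉ K ∧ (radialPow m)^[j] (q (ω^[j] x)) = (radialPow m)^[i] (q (ω^[i] x)) := by
    intro i x hx j hij
    induction j, hij using Nat.le_induction with
    | base => exact ⟨hx, rfl⟩
    | succ j _ ih =>
      have h1 : ω^[j + 1] x ∉ K := by
        rw [iterate_succ_apply']
        exact fun h => ih.1 (hnest _ h)
      refine ⟨h1, ?_⟩
      rw [iterate_succ_apply'] at h1
      rw [iterate_succ_apply, iterate_succ_apply', hsemi _ h1, ih.2]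
  let Φ : X → E := fun x => if h : ∃ i : ℕ, ω^[i] x ∉ K then
    (radialPow m)^[Nat.find h] (q (ω^[Nat.find h] x)) else 0
  have hΦ : ∀ (i : ℕ) x, ω^[i] x ∉ K → Φ x = (radialPow m)^[i] (q (ω^[i] x)) := by
    intro i x hx
    have h : ∃ i : ℕ, ω^[i] x ∉ K := ⟨i, hx⟩
    simp only [Φ, dif_pos h]
    exact ((hout _ x (Nat.find_spec h) i (Nat.find_min' h hx)).2).symm
  have hiterp : ∀ i : ℕ, ω^[i] p = p := fun i => iterate_fixed hωp i
  have hΦp : Φ p = 0 := by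
    have h : ¬ ∃ i : ℕ, ω^[i] p ∉ K := by
      rintro ⟨i, hi⟩
      exact hi (by rwa [hiterp i])
    simp only [Φ, dif_neg h]
  have hsmall : ∀ (i : ℕ) x, ω^[i] x ∈ K → ‖Φ x‖ ≤ c ^ i := by
    intro i x hx
    by_cases hxp : x = p
    · rw [hxp, hΦp, norm_zero]
      positivity
    have h := hexp x hxp
    obtain ⟨k, hk⟩ : ∃ k, Nat.find h = k + 1 := by
      refine Nat.exists_eq_succ_of_ne_zero fun h0 => ?_
      have := Nat.find_spec h
      rw [h0] at this
      exact (hout 0 x this i (Nat.zero_le _)).1 hx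
    have hkK : ω^[k] x ∈ K := not_not.1 (Nat.find_min h (by omega))
    have hk1 : ω^[k + 1] x ∉ K := hk ▸ Nat.find_spec h
    have hik : i ≤ k := by
      by_contra! hlt
      exact (hout _ x hk1 i hlt).1 hx
    have hk1' := hk1
    rw [iterate_succ_apply'] at hk1'
    rw [hΦ _ x hk1, iterate_succ_apply, iterate_succ_apply', hsemi _ hk1']
    calc _ ≤ c ^ k * c := norm_iterate_radialPow_le hm hc.le k (hqK _ hkK)
      _ ≤ c ^ k := mul_le_of_le_one_right (by positivity) hc.le
      _ ≤ c ^ i := pow_le_pow_of_le_one hc0 hc.le hik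
  have hcont : Continuous Φ := by
    rw [continuous_iff_continuousAt]
    intro x
    by_cases hxp : x = p
    · subst hxp
      rw [ContinuousAt, hΦp, tendsto_zero_iff_norm_tendsto_zero, Metric.tendsto_nhds]
      intro ε hε
      obtain ⟨i, hi⟩ := exists_pow_lt_of_lt_one hε hc
      have : ω^[i] ⁻¹' K ∈ 𝓝 x :=
        (hω.iterate i).continuousAt.preimage_mem_nhds (by rwa [hiterp i])
      filter_upwards [this] with y hy
      rw [Real.dist_eq, sub_zero, abs_of_nonneg (norm_nonneg _)]
      exact (hsmall i y hy).trans_lt hi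
    · obtain ⟨i, hi⟩ := hexp x hxp
      have : (ω^[i] ⁻¹' K)ᶜ ∈ 𝓝 x := (hKc.preimage (hω.iterate i)).isOpen_compl.mem_nhds hi
      have hcts : Continuous fun x => (radialPow m)^[i] (q (ω^[i] x)) :=
        ((continuous_radialPow m).iterate i).comp (hq.comp (hω.iterate i))
      refine hcts.continuousAt.congr ?_
      filter_upwards [this] with y hy
      exact (hΦ i y hy).symm
  have hne : ∀ x, x ≠ p → Φ x ≠ 0 := by
    intro x hx h0
    obtain ⟨i, hi⟩ := hexp x hx
    rw [hΦ i x hi] at h0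
    refine hq0 _ hi (((radialPow_injective m).iterate i) (h0.trans ?_))
    exact (iterate_fixed (radialPow_zero m) i).symm
  have hΦinj : Injective Φ := by
    intro x y hxy
    by_cases hx : x = p
    · by_contra hne'
      refine hne y (fun h => hne' (hx.trans h.symm)) ?_
      rw [← hxy, hx, hΦp]
    by_cases hy : y = p
    · exact absurd (by rw [hxy, hy, hΦp]) (hne x hx)
    obtain ⟨i, hi⟩ := hexp x hx
    obtain ⟨j, hj⟩ := hexp y hy
    have hi' := (hout i x hi (max i j) (le_max_left _ _)).1
    have hj' := (hout j y hj (max i j) (le_max_right _ _)).1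
    rw [hΦ _ x hi', hΦ _ y hj'] at hxy
    exact (hωinj.iterate _) (hinj hi' hj' (((radialPow_injective m).iterate _) hxy))
  have hqle : ∀ x, ‖q x‖ ≤ 1 := fun x => by
    have : q x ∈ closedBall (0 : E) 1 := hrange ▸ mem_range_self x
    simpa using this
  have hmem : ∀ x, Φ x ∈ closedBall (0 : E) 1 := by
    intro x
    rw [mem_closedBall_zero_iff]
    by_cases hx : x = p
    · simp [hx, hΦp]
    obtain ⟨i, hi⟩ := hexp x hx
    rw [hΦ i x hi, norm_iterate_radialPow_le_one]
    exact hqle _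
  have hΦsurj : ∀ v ∈ closedBall (0 : E) 1, ∃ x, Φ x = v := by
    intro v hv
    rw [mem_closedBall_zero_iff] at hv
    by_cases hv0 : v = 0
    · exact ⟨p, by rw [hΦp, hv0]⟩
    obtain ⟨i, hi⟩ := exists_pow_lt_of_lt_one (norm_pos_iff.2 hv0) hc
    obtain ⟨w, rfl⟩ := ((radialPow_surjective (E := E) m).iterate i) v
    rw [norm_iterate_radialPow_le_one] at hv
    obtain ⟨z, rfl⟩ : w ∈ range q := by rw [hrange]; simpa using hv
    obtain ⟨x, rfl⟩ := (hωsurj.iterate i) z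
    refine ⟨x, hΦ i x fun hx => hi.not_ge ?_⟩
    exact (norm_iterate_radialPow_le hm hc.le i (hqK _ hx)).trans
      (mul_le_of_le_one_right (by positivity) hc.le)
  let e : X ≃ closedBall (0 : E) 1 := Equiv.ofBijective (fun x => ⟨Φ x, hmem x⟩)
    ⟨fun x y h => hΦinj (congrArg Subtype.val h), fun v => by
      obtain ⟨x, hx⟩ := hΦsurj v v.2
      exact ⟨x, Subtype.ext hx⟩⟩
  exact ⟨Continuous.homeoOfEquivCompactToT2 (f := e) (hcont.subtype_mk _)⟩

end Limit

section Collapse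

variable {X E : Type*} [NormedAddCommGroup E] [NormedSpace ℝ E]

open Classical in
/-- The self-map of `X` acting as `radialPow m` in the chart `j` and as the identity elsewhere. -/
noncomputable def chartRadialPow (j : E → X) (m : ℕ) (x : X) : X :=
  if x ∈ range j then j (radialPow m (invFun j x)) else x

theorem chartRadialPow_apply {j : E → X} (hj : Injective j) (m : ℕ) (v : E) :
    chartRadialPow j m (j v) = j (radialPow m v) := by
  rw [chartRadialPow, if_pos (mem_range_self v), leftInverse_invFun hj]

theorem chartRadialPow_of_notMem {j : E → X} (hj : Injective j) (m : ℕ) {x : X}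
    (hx : x ∉ j '' closedBall 0 1) : chartRadialPow j m x = x := by
  by_cases h : x ∈ range j
  · obtain ⟨v, rfl⟩ := h
    rw [chartRadialPow_apply hj, radialPow_of_one_le]
    by_contra! hv
    exact hx (mem_image_of_mem _ (by simpa using hv.le))
  · rw [chartRadialPow, if_neg h]

theorem chartRadialPow_bijective {j : E → X} (hj : Injective j) (m : ℕ) :
    Bijective (chartRadialPow j m) := by
  constructor
  · have aux : ∀ v x, chartRadialPow j m (j v) = chartRadialPow j m x → j v = x := by
      intro v x h
      rw [chartRadialPow_apply hj] at h
      by_cases hx : x ∈ range j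
      · obtain ⟨w, rfl⟩ := hx
        rw [chartRadialPow_apply hj] at h
        rw [radialPow_injective m (hj h)]
      · rw [chartRadialPow, if_neg hx] at h
        exact absurd ⟨_, h⟩ hx
    intro x y h
    by_cases hx : x ∈ range j
    · obtain ⟨v, rfl⟩ := hx
      exact aux v y h
    · by_cases hy : y ∈ range j
      · obtain ⟨w, rfl⟩ := hy
        exact (aux w x h.symm).symm
      · rwa [chartRadialPow, chartRadialPow, if_neg hx, if_neg hy] at h
  · intro x
    by_cases hx : x ∈ range j
    · obtain ⟨v, rfl⟩ := hx
      obtain ⟨w, rfl⟩ := radialPow_surjective m v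
      exact ⟨j w, chartRadialPow_apply hj m w⟩
    · exact ⟨x, by rw [chartRadialPow, if_neg hx]⟩

variable [TopologicalSpace X]

theorem continuous_chartRadialPow [T2Space X] [ProperSpace E] {j : E → X}
    (hj : IsOpenEmbedding j) (m : ℕ) : Continuous (chartRadialPow j m) := by
  rw [continuous_iff_continuousAt]
  intro x
  by_cases hx : x ∈ range j
  · obtain ⟨v, rfl⟩ := hx
    rw [← hj.continuousAt_iff]
    have : chartRadialPow j m ∘ j = j ∘ radialPow m :=
      funext fun v => chartRadialPow_apply hj.injective m v
    rw [this]
    exact (hj.continuous.comp (continuous_radialPow m)).continuousAt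
  · have hK : IsClosed (j '' closedBall (0 : E) 1) :=
      ((isCompact_closedBall _ _).image hj.continuous).isClosed
    have hxK : x ∉ j '' closedBall (0 : E) 1 := fun h => hx (image_subset_range _ _ h)
    refine continuousAt_id.congr ?_
    filter_upwards [hK.isOpen_compl.mem_nhds hxK] with y hy
    exact (chartRadialPow_of_notMem hj.injective m hy).symm

/-- A space `X` that admits a map `q` onto the closed unit ball whose only nondegenerate fibre is
over the origin, together with lifts of the radial contractions and a chart of the preimage of the
open ball centred at an interior point of that fibre, is a closed ball. -/
theorem nonempty_homeomorph_closedBall_of_chart [CompactSpace X] [T2Space X] [ProperSpace E]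
    {q : X → E} (hq : Continuous q) (hrange : range q = closedBall 0 1)
    (hinj : ∀ x y, q x = q y → q x ≠ 0 → x = y)
    (hlift : ∀ m : ℕ, ∃ g : X → X, Continuous g ∧ Bijective g ∧
      (∀ x, q (g x) = radialPow m (q x)) ∧ ∀ x, q x = 0 → g x = x)
    {j : E → X} (hj : IsOpenEmbedding j) (hjrange : range j = {x | ‖q x‖ < 1})
    (hjfib : ∀ v, q (j v) = 0 → ‖v‖ < 1 / 2) {ε : ℝ} (hε : 0 < ε)
    (hjε : ∀ v, ‖v‖ < ε → q (j v) = 0) :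
    Nonempty (X ≃ₜ closedBall (0 : E) 1) := by
  set K : Set X := j '' closedBall 0 1 with hKdef
  have hKcpt : IsCompact K := (isCompact_closedBall _ _).image hj.continuous
  have hKne : K.Nonempty := ⟨j 0, mem_image_of_mem _ (by simp)⟩
  obtain ⟨c, hc, hqK⟩ : ∃ c < 1, ∀ y ∈ K, ‖q y‖ ≤ c := by
    obtain ⟨y, hy, hmax⟩ := hKcpt.exists_isMaxOn hKne hq.norm.continuousOn
    refine ⟨‖q y‖, ?_, fun z hz => hmax hz⟩
    have : y ∈ range j := image_subset_range _ _ hy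
    rwa [hjrange] at this
  have hc0 : 0 ≤ c := (norm_nonneg _).trans (hqK _ hKne.some_mem)
  have hzero : ∀ x, q x = 0 → x ∈ j '' ball 0 (1 / 2) := by
    intro x hx
    obtain ⟨v, rfl⟩ : x ∈ range j := by rw [hjrange]; simp [hx]
    exact mem_image_of_mem _ (by simpa using hjfib v hx)
  obtain ⟨δ, hδ, hqδ⟩ : ∃ δ > 0, ∀ x, ‖q x‖ < δ → x ∈ j '' ball 0 (1 / 2) := by
    have hC : IsCompact (j '' ball 0 (1 / 2))ᶜ :=
      (hj.isOpenMap _ isOpen_ball).isClosed_compl.isCompact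
    rcases (j '' ball 0 (1 / 2))ᶜ.eq_empty_or_nonempty with h | h
    · exact ⟨1, one_pos, fun x _ => by rw [compl_empty_iff.1 h]; trivial⟩
    · obtain ⟨y, hy, hmin⟩ := hC.exists_isMinOn h hq.norm.continuousOn
      refine ⟨‖q y‖, norm_pos_iff.2 fun h0 => hy (hzero y h0), fun x hx => ?_⟩
      by_contra hxU
      exact absurd hx (not_lt.2 (hmin hxU))
  obtain ⟨m, hm0, hm⟩ : ∃ m : ℕ, m ≠ 0 ∧ c ^ (m + 1) < δ := by
    obtain ⟨i, hi⟩ := exists_pow_lt_of_lt_one hδ hc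
    exact ⟨i + 1, by omega, (pow_le_pow_of_le_one hc0 hc.le (by omega)).trans_lt hi⟩
  obtain ⟨M, hM0, hM⟩ : ∃ M : ℕ, M ≠ 0 ∧ (1 / 2 : ℝ) ^ (M + 1) < ε := by
    obtain ⟨i, hi⟩ := exists_pow_lt_of_lt_one hε (by norm_num : (1 / 2 : ℝ) < 1)
    exact ⟨i + 1, by omega,
      (pow_le_pow_of_le_one (by norm_num) (by norm_num) (by omega)).trans_lt hi⟩
  obtain ⟨g, hg, hgbij, hqg, hgfix⟩ := hlift m
  have hgK : ∀ x ∈ K, g x ∈ j '' ball 0 (1 / 2) := by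
    intro x hx
    refine hqδ _ ?_
    rw [hqg, norm_radialPow_of_le _ ((hqK x hx).trans hc.le)]
    exact (pow_le_pow_left₀ (norm_nonneg _) (hqK x hx) _).trans_lt hm
  have hsub : j '' ball 0 (1 / 2) ⊆ K :=
    image_mono (ball_subset_closedBall.trans (closedBall_subset_closedBall (by norm_num)))
  set τ := chartRadialPow j M with hτ
  have hτK : ∀ x ∈ K, τ x ∈ K := by
    rintro _ ⟨v, hv, rfl⟩
    rw [mem_closedBall_zero_iff] at hv
    rw [hτ, chartRadialPow_apply hj.injective]
    exact mem_image_of_mem _ (by simpa using (norm_radialPow_le M v).trans hv)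
  let σ : X ≃ₜ X := Continuous.homeoOfEquivCompactToT2
    (f := Equiv.ofBijective (g ∘ τ) (hgbij.comp (chartRadialPow_bijective hj.injective M)))
    (hg.comp (continuous_chartRadialPow hj M))
  have hσ : ∀ x, σ x = g (τ x) := fun x => rfl
  have hσK : ∀ x ∈ K, σ x ∈ j '' ball 0 (1 / 2) := fun x hx => hgK _ (hτK x hx)
  have hσj : ∀ v, ‖v‖ ≤ 1 / 2 → σ (j v) = j (radialPow M v) := by
    intro v hv
    rw [hσ, hτ, chartRadialPow_apply hj.injective, hgfix]
    refine hjε _ ?_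
    rw [norm_radialPow_of_le _ (by linarith)]
    exact (pow_le_pow_left₀ (norm_nonneg _) hv _).trans_lt hM
  have hsmall : ∀ (i : ℕ) x, σ.symm^[i + 1] x ∈ K → ∃ v, j v = x ∧ ‖v‖ ≤ (1 / 2 : ℝ) ^ (i + 1) := by
    intro i
    induction i with
    | zero =>
      intro x hx
      obtain ⟨v, hv, hvx⟩ := hσK _ hx
      refine ⟨v, by simpa using hvx, ?_⟩
      simpa using (mem_ball_zero_iff.1 hv).le
    | succ i ih =>
      intro x hx
      rw [iterate_succ_apply] at hx
      obtain ⟨v, hv, hvn⟩ := ih _ hx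
      have hv2 : ‖v‖ ≤ 1 / 2 :=
        hvn.trans (pow_le_of_le_one (by norm_num) (by norm_num) (Nat.succ_ne_zero i))
      refine ⟨radialPow M v, ?_, ?_⟩
      · rw [← hσj v hv2, hv, σ.apply_symm_apply]
      · rw [norm_radialPow_of_le _ (by linarith), pow_succ, pow_succ _ (i + 1), mul_comm]
        refine (mul_le_mul hvn ?_ (by positivity) (by positivity))
        calc ‖v‖ ^ M ≤ ‖v‖ := pow_le_of_le_one (norm_nonneg _) (by linarith) hM0
          _ ≤ 1 / 2 := hv2
  refine nonempty_homeomorph_closedBall_of_expanding hq hrange σ.symm.continuous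
    σ.symm.injective σ.symm.surjective hKcpt.isClosed hc hqK ?_ ?_ hm0 ?_ ?_
    (p := j 0) ?_ ?_ ?_
  · intro x hx y _ hxy
    exact hinj x y hxy fun h => hx (hsub (hzero x h))
  · exact fun y hy h => hy (hsub (hzero y h))
  · intro y hy
    have h : σ (σ.symm y) = g (σ.symm y) := by
      rw [hσ, hτ, chartRadialPow_of_notMem hj.injective M hy]
    rw [← hqg, ← h, σ.apply_symm_apply]
  · intro y hy
    have := hσK _ hy
    rw [σ.apply_symm_apply] at this
    exact hsub this
  · exact hj.isOpenMap.image_mem_nhds (closedBall_mem_nhds _ one_pos)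
  · rw [σ.symm_apply_eq, hσj 0 (by simp), radialPow_zero]
  · intro x hx
    by_contra! h
    obtain ⟨v, rfl, -⟩ := hsmall 0 x (h 1)
    refine hx (congrArg j ?_)
    rw [← norm_eq_zero]
    refine le_antisymm (ge_of_tendsto' (((tendsto_pow_atTop_nhds_zero_of_lt_one
      (by norm_num : (0 : ℝ) ≤ 1 / 2) (by norm_num)).comp (tendsto_add_atTop_nat 1)))
      fun i => ?_) (norm_nonneg _)
    obtain ⟨w, hw, hwn⟩ := hsmall i _ (h (i + 1))
    rwa [hj.injective hw] at hwn

/-- Variant of `nonempty_homeomorph_closedBall_of_chart` with an arbitrary chart of the preimage of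
the open ball. -/
theorem nonempty_homeomorph_closedBall_of_collapse [CompactSpace X] [T2Space X] [ProperSpace E]
    {q : X → E} (hq : Continuous q) (hrange : range q = closedBall 0 1)
    (hinj : ∀ x y, q x = q y → q x ≠ 0 → x = y)
    (hlift : ∀ m : ℕ, ∃ g : X → X, Continuous g ∧ Bijective g ∧
      (∀ x, q (g x) = radialPow m (q x)) ∧ ∀ x, q x = 0 → g x = x)
    {j : E → X} (hj : IsOpenEmbedding j) (hjrange : range j = {x | ‖q x‖ < 1})
    {p : X} (hp : ∀ᶠ x in 𝓝 p, q x = 0) :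
    Nonempty (X ≃ₜ closedBall (0 : E) 1) := by
  obtain ⟨w, rfl⟩ : p ∈ range j := by rw [hjrange]; simp [hp.self_of_nhds]
  have hfib : IsCompact {v | q (j v) = 0} := by
    have : IsCompact {x | q x = 0} := (isClosed_eq hq continuous_const).isCompact
    refine hj.isInducing.isCompact_preimage_iff ?_ |>.2 this
    intro x hx
    rw [hjrange]
    simp [show q x = 0 from hx]
  obtain ⟨R, hR0, hR⟩ : ∃ R > 0, ∀ v, q (j v) = 0 → ‖v - w‖ < R := by
    obtain ⟨R, hR⟩ := hfib.isBounded.subset_ball w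
    refine ⟨max R 1, by positivity, fun v hv => ?_⟩
    have := hR hv
    rw [mem_ball, dist_eq_norm] at this
    exact this.trans_le (le_max_left _ _)
  have hR2 : (2 * R) ≠ 0 := by positivity
  let e : E ≃ₜ E := (Homeomorph.smulOfNeZero (2 * R) hR2).trans (Homeomorph.addRight w)
  have he : ∀ v, e v = (2 * R) • v + w := fun v => rfl
  have hnear : ∀ᶠ v in 𝓝 (0 : E), q ((j ∘ e) v) = 0 := by
    have hcts : ContinuousAt (j ∘ e) 0 := (hj.continuous.comp e.continuous).continuousAt
    rw [ContinuousAt, comp_apply, he, smul_zero, zero_add] at hcts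
    exact hcts.eventually hp
  obtain ⟨ε, hε, hball⟩ := Metric.eventually_nhds_iff_ball.1 hnear
  refine nonempty_homeomorph_closedBall_of_chart hq hrange hinj hlift
    (hj.comp e.isOpenEmbedding) ?_ ?_ hε fun v hv => hball v (by simpa using hv)
  · rw [← hjrange, e.surjective.range_comp]
  · intro v hv
    have h := hR _ hv
    rw [he, add_sub_cancel_right, norm_smul, Real.norm_eq_abs, abs_of_pos (by positivity)] at h
    nlinarith [norm_nonneg v]

end Collapse

section Collar

open scoped NNReal

variable {X F : Type*}

/-- The subset of `X × ℝ` obtained from `X × {0}` by attaching the region below the graph of `f`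
over `B`. -/
def collarSet (B : Set X) (f : X → ℝ) : Set (X × ℝ) :=
  {z | 0 ≤ z.2 ∧ z.2 ≤ f z.1 ∧ (z.2 = 0 ∨ z.1 ∈ B)}

/-- The increasing bijection of `ℝ` that is the identity below `-1` and maps `[-1, a]` affinely
onto `[-1, b]`. -/
noncomputable def stretch (a b r : ℝ) : ℝ := min r (-1) + max (r + 1) 0 * ((b + 1) / (a + 1))

theorem stretch_of_le {a b r : ℝ} (hr : r ≤ -1) : stretch a b r = r := by
  rw [stretch, min_eq_left hr, max_eq_right (by linarith), zero_mul, add_zero]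

theorem stretch_of_ge {a b r : ℝ} (hr : -1 ≤ r) :
    stretch a b r = (r + 1) * ((b + 1) / (a + 1)) - 1 := by
  rw [stretch, min_eq_right hr, max_eq_left (by linarith)]
  ring

theorem stretch_self {a : ℝ} (ha : 0 ≤ a) (r : ℝ) : stretch a a r = r := by
  rcases le_total r (-1) with h | h
  · exact stretch_of_le h
  · rw [stretch_of_ge h, div_self (by positivity)]
    ring

theorem stretch_left {a b : ℝ} (ha : 0 ≤ a) : stretch a b a = b := by
  rw [stretch_of_ge (by linarith), mul_div_cancel₀ _ (by positivity)]
  ring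

theorem stretch_stretch {a b : ℝ} (ha : 0 ≤ a) (hb : 0 ≤ b) (r : ℝ) :
    stretch b a (stretch a b r) = r := by
  rcases le_total r (-1) with h | h
  · rw [stretch_of_le h, stretch_of_le h]
  · have h1 : 0 ≤ (r + 1) * ((b + 1) / (a + 1)) := mul_nonneg (by linarith) (by positivity)
    rw [stretch_of_ge h, stretch_of_ge (by linarith)]
    field_simp
    ring

theorem stretch_le {a b r : ℝ} (ha : 0 ≤ a) (hb : 0 ≤ b) (hr : r ≤ a) : stretch a b r ≤ b := by
  rcases le_total r (-1) with h | h
  · rw [stretch_of_le h]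
    linarith
  · rw [stretch_of_ge h, sub_le_iff_le_add, ← mul_div_assoc, div_le_iff₀ (by positivity)]
    nlinarith

/-- The coordinates on a collared neighbourhood with an outer collar attached, where the second
variable is the signed height above the boundary. -/
noncomputable def collarChart (κ : ℝ≥0 × F → X) (r : ℝ) (y : F) : X × ℝ :=
  (κ (Real.toNNReal (-r), y), max r 0)

open Classical in
/-- The map from `collarSet B α` to `collarSet B β` that stretches the chart `κ` vertically. -/
noncomputable def collarStretch (κ : ℝ≥0 × F → X) (κinv : X → ℝ≥0 × F) (α β : X → ℝ)
    (z : X × ℝ) : X × ℝ :=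
  if z.1 ∈ range κ then
    collarChart κ (stretch (α (κ (0, (κinv z.1).2))) (β (κ (0, (κinv z.1).2)))
      (z.2 - (κinv z.1).1)) (κinv z.1).2
  else z

variable {κ : ℝ≥0 × F → X} {κinv : X → ℝ≥0 × F} {B : Set X} {α β : X → ℝ}

theorem collarStretch_collarChart (hκinv : LeftInverse κinv κ) (r : ℝ) (y : F) :
    collarStretch κ κinv α β (collarChart κ r y) =
      collarChart κ (stretch (α (κ (0, y))) (β (κ (0, y))) r) y := by
  have h : max r 0 - max (-r) 0 = r := by
    rcases le_total r 0 with h | h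
    · rw [max_eq_right h, max_eq_left (by linarith)]; ring
    · rw [max_eq_left h, max_eq_right (by linarith)]; ring
  have hmem : (collarChart κ r y).1 ∈ range κ := mem_range_self _
  rw [collarStretch, if_pos hmem]
  simp only [collarChart, hκinv _, Real.coe_toNNReal', h]

theorem collarStretch_of_notMem {z : X × ℝ} (hz : z.1 ∉ range κ) :
    collarStretch κ κinv α β z = z := if_neg hz

theorem collarChart_mem_collarSet (hκB : ∀ y, κ (0, y) ∈ B) (hα : ∀ x, 0 ≤ α x) {r : ℝ} {y : F}
    (hr : r ≤ α (κ (0, y))) : collarChart κ r y ∈ collarSet B α := by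
  rcases le_total r 0 with h | h
  · simp [collarChart, collarSet, max_eq_right h, hα]
  · simp [collarChart, collarSet, h, Real.toNNReal_of_nonpos (neg_nonpos.2 h), hr,
      hκB]

theorem exists_collarChart_eq (hκB : ∀ z, κ z ∈ B → z.1 = 0) (hα : ∀ x, 0 ≤ α x)
    {z : X × ℝ} (hz : z ∈ collarSet B α) (hzκ : z.1 ∈ range κ) :
    ∃ r y, r ≤ α (κ (0, y)) ∧ collarChart κ r y = z := by
  obtain ⟨x, t⟩ := z
  obtain ⟨⟨b, y⟩, rfl⟩ := hzκ
  obtain ⟨h0, h1, h2⟩ := hz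
  simp only at h0 h1 h2
  rcases h2 with rfl | h2
  · refine ⟨-b, y, (neg_nonpos.2 b.2).trans (hα _), ?_⟩
    simp [collarChart]
  · obtain rfl : b = 0 := hκB _ h2
    exact ⟨t, y, h1, by simp [collarChart, h0, Real.toNNReal_of_nonpos]⟩

theorem collarStretch_mem (hκinv : LeftInverse κinv κ) (hκB : ∀ z, κ z ∈ B ↔ z.1 = 0)
    (hα : ∀ x, 0 ≤ α x) (hβ : ∀ x, 0 ≤ β x) (hαβ : ∀ x ∈ B, x ∉ range κ → α x = β x)
    {z : X × ℝ} (hz : z ∈ collarSet B α) :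
    collarStretch κ κinv α β z ∈ collarSet B β := by
  by_cases hzκ : z.1 ∈ range κ
  · obtain ⟨r, y, hr, rfl⟩ := exists_collarChart_eq (fun z => (hκB z).1) hα hz hzκ
    rw [collarStretch_collarChart hκinv]
    exact collarChart_mem_collarSet (fun y => (hκB _).2 rfl) hβ (stretch_le (hα _) (hβ _) hr)
  · rw [collarStretch_of_notMem hzκ]
    obtain ⟨h0, h1, h2⟩ := hz
    refine ⟨h0, ?_, h2⟩
    rcases h2 with h2 | h2
    · rw [h2]
      exact hβ _
    · rwa [← hαβ _ h2 hzκ]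

theorem collarStretch_collarStretch (hκinv : LeftInverse κinv κ) (hκB : ∀ z, κ z ∈ B → z.1 = 0)
    (hα : ∀ x, 0 ≤ α x) (hβ : ∀ x, 0 ≤ β x) {z : X × ℝ} (hz : z ∈ collarSet B α) :
    collarStretch κ κinv β α (collarStretch κ κinv α β z) = z := by
  by_cases hzκ : z.1 ∈ range κ
  · obtain ⟨r, y, hr, rfl⟩ := exists_collarChart_eq hκB hα hz hzκ
    rw [collarStretch_collarChart hκinv, collarStretch_collarChart hκinv,
      stretch_stretch (hα _) (hβ _)]
  · rw [collarStretch_of_notMem hzκ, collarStretch_of_notMem hzκ]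

theorem collarStretch_graph (hκinv : LeftInverse κinv κ) (hκB : ∀ z, κ z ∈ B → z.1 = 0)
    (hα : ∀ x, 0 ≤ α x) (hβ : ∀ x, 0 ≤ β x) (hαβ : ∀ x ∈ B, x ∉ range κ → α x = β x)
    {x : X} (hx : x ∈ B) : collarStretch κ κinv α β (x, α x) = (x, β x) := by
  have aux : ∀ (f : X → ℝ), (∀ x, 0 ≤ f x) → ∀ y,
      collarChart κ (f (κ (0, y))) y = (κ (0, y), f (κ (0, y))) := by
    intro f hf y
    simp [collarChart, hf, Real.toNNReal_of_nonpos]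
  by_cases hxκ : x ∈ range κ
  · obtain ⟨⟨b, y⟩, rfl⟩ := hxκ
    obtain rfl : b = 0 := hκB _ hx
    rw [← aux α hα, collarStretch_collarChart hκinv, stretch_left (hα _), aux β hβ]
  · rw [collarStretch_of_notMem hxκ, hαβ x hx hxκ]

variable [TopologicalSpace X] [NormedAddCommGroup F]

theorem continuousOn_collarStretch [T2Space X] [ProperSpace F]
    (hκ : IsOpenEmbedding κ) (hκinv : LeftInverse κinv κ)
    (hκcts : ∀ x ∈ range κ, ContinuousAt κinv x) (hκB : ∀ z, κ z ∈ B ↔ z.1 = 0)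
    (hαc : Continuous α) (hβc : Continuous β)
    (hα : ∀ x, 0 ≤ α x) (hβ : ∀ x, 0 ≤ β x)
    (hαβ : ∀ x ∈ B, x ∉ κ '' (Icc 0 1 ×ˢ closedBall 0 1) → α x = β x) :
    ContinuousOn (collarStretch κ κinv α β) (collarSet B α) := by
  intro z hz
  by_cases hzκ : z.1 ∈ range κ
  · refine ContinuousAt.continuousWithinAt ?_
    have hinv : ContinuousAt (fun z : X × ℝ => κinv z.1) z :=
      (hκcts _ hzκ).comp continuousAt_fst
    have hy : ContinuousAt (fun z : X × ℝ => κ (0, (κinv z.1).2)) z :=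
      hκ.continuous.continuousAt.comp (continuousAt_const.prodMk hinv.snd)
    have ha : ContinuousAt (fun z : X × ℝ => α (κ (0, (κinv z.1).2))) z :=
      ContinuousAt.comp (g := α) hαc.continuousAt hy
    have hb : ContinuousAt (fun z : X × ℝ => β (κ (0, (κinv z.1).2))) z :=
      ContinuousAt.comp (g := β) hβc.continuousAt hy
    have hr : ContinuousAt (fun z : X × ℝ => z.2 - ((κinv z.1).1 : ℝ)) z :=
      continuousAt_snd.sub (NNReal.continuous_coe.continuousAt.comp hinv.fst)
    have hs : ContinuousAt (fun z : X × ℝ => stretch (α (κ (0, (κinv z.1).2)))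
        (β (κ (0, (κinv z.1).2))) (z.2 - (κinv z.1).1)) z := by
      unfold stretch
      have hne : α (κ (0, (κinv z.1).2)) + 1 ≠ 0 := by
        have := hα (κ (0, (κinv z.1).2))
        positivity
      exact (hr.min continuousAt_const).add (((hr.add continuousAt_const).max
        continuousAt_const).mul ((hb.add continuousAt_const).div (ha.add continuousAt_const) hne))
    have hmain : ContinuousAt (fun z : X × ℝ => collarChart κ (stretch (α (κ (0, (κinv z.1).2)))
        (β (κ (0, (κinv z.1).2))) (z.2 - (κinv z.1).1)) (κinv z.1).2) z := by
      unfold collarChart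
      refine ContinuousAt.prodMk (hκ.continuous.continuousAt.comp (ContinuousAt.prodMk ?_ hinv.snd))
        (hs.max continuousAt_const)
      exact continuous_real_toNNReal.continuousAt.comp hs.neg
    refine hmain.congr ?_
    filter_upwards [continuousAt_fst.preimage_mem_nhds (hκ.isOpen_range.mem_nhds hzκ)] with w hw
    exact (if_pos hw).symm
  · have hC : IsClosed (κ '' (Icc 0 1 ×ˢ closedBall 0 1)) :=
      ((isCompact_Icc.prod (isCompact_closedBall _ _)).image hκ.continuous).isClosed
    have hzC : z.1 ∉ κ '' (Icc 0 1 ×ˢ closedBall 0 1) := fun h => hzκ (image_subset_range _ _ h)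
    have hid : ∀ w ∈ collarSet B α, w.1 ∉ κ '' (Icc 0 1 ×ˢ closedBall 0 1) →
        collarStretch κ κinv α β w = w := by
      intro w hw hwC
      by_cases hwκ : w.1 ∈ range κ
      · obtain ⟨r, y, hr, rfl⟩ := exists_collarChart_eq (fun z => (hκB z).1) hα hw hwκ
        rw [collarStretch_collarChart hκinv]
        rcases le_total r (-1) with h | h
        · rw [stretch_of_le h]
        · have hy : y ∉ closedBall (0 : F) 1 := fun hy => hwC <| mem_image_of_mem _
            ⟨⟨zero_le, by simpa [neg_le] using h⟩, hy⟩
          rw [hαβ _ ((hκB (0, y)).2 rfl), stretch_self (hβ _)]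
          rintro ⟨v, hv, hvy⟩
          rw [hκ.injective hvy] at hv
          exact hy hv.2
      · exact collarStretch_of_notMem hwκ
    refine continuousWithinAt_id.congr_of_eventuallyEq ?_ (collarStretch_of_notMem hzκ)
    filter_upwards [self_mem_nhdsWithin, mem_nhdsWithin_of_mem_nhds
      (continuousAt_fst.preimage_mem_nhds (hC.isOpen_compl.mem_nhds hzC))] with w hw hwC
    exact hid w hw hwC

/-- `X` is homeomorphic to `collarSet B f`, with `B` going to the graph of `f` over `B`. -/
def IsCollared (B : Set X) (f : X → ℝ) : Prop :=
  ∃ H : X → X × ℝ, Continuous H ∧ Injective H ∧ range H = collarSet B f ∧ ∀ x ∈ B, H x = (x, f x)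

theorem isCollared_zero (B : Set X) : IsCollared B fun _ => 0 := by
  refine ⟨fun x => (x, 0), by fun_prop, fun x y h => congrArg Prod.fst h, ?_, fun x _ => rfl⟩
  ext ⟨x, t⟩
  simp only [mem_range, Prod.mk.injEq, exists_eq_left, collarSet, mem_ofPred_eq]
  exact ⟨fun h => by simp [← h], fun h => le_antisymm h.1 h.2.1⟩

theorem IsCollared.of_eqOn [T2Space X] [ProperSpace F] (h : IsCollared B α)
    (hκ : IsOpenEmbedding κ) (hκB : ∀ z, κ z ∈ B ↔ z.1 = 0)
    (hαc : Continuous α) (hβc : Continuous β) (hα : ∀ x, 0 ≤ α x) (hβ : ∀ x, 0 ≤ β x)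
    (hαβ : ∀ x ∈ B, x ∉ κ '' (Icc 0 1 ×ˢ closedBall 0 1) → α x = β x) : IsCollared B β := by
  obtain ⟨H, hH, hHinj, hHrange, hHB⟩ := h
  let e := hκ.toOpenPartialHomeomorph
  have hinv : LeftInverse e.symm κ := fun z => e.left_inv (mem_univ z)
  have hcts : ∀ x ∈ range κ, ContinuousAt e.symm x := by
    rintro _ ⟨z, rfl⟩
    exact e.continuousAt_symm (e.map_source (mem_univ z))
  have hαβ' : ∀ x ∈ B, x ∉ range κ → α x = β x := fun x hx hxκ =>
    hαβ x hx fun h => hxκ (image_subset_range _ _ h)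
  have hHmem : ∀ x, H x ∈ collarSet B α := fun x => hHrange ▸ mem_range_self x
  have hleft := fun z (hz : z ∈ collarSet B α) =>
    collarStretch_collarStretch hinv (fun z => (hκB z).1) hα hβ hz
  refine ⟨fun x => collarStretch κ e.symm α β (H x), ?_, ?_, ?_, ?_⟩
  · exact (continuousOn_collarStretch hκ hinv hcts hκB hαc hβc hα hβ hαβ).comp_continuous hH hHmem
  · intro x y hxy
    refine hHinj ?_
    rw [← hleft _ (hHmem x), ← hleft _ (hHmem y)]
    exact congrArg _ hxy
  · refine Subset.antisymm ?_ fun z hz => ?_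
    · rintro _ ⟨x, rfl⟩
      exact collarStretch_mem hinv hκB hα hβ hαβ' (hHmem x)
    · have hz' : collarStretch κ e.symm β α z ∈ collarSet B α :=
        collarStretch_mem hinv hκB hβ hα (fun x hx hxκ => (hαβ' x hx hxκ).symm) hz
      rw [← hHrange] at hz'
      obtain ⟨x, hx⟩ := hz'
      refine ⟨x, ?_⟩
      simp only [hx]
      exact collarStretch_collarStretch hinv (fun z => (hκB z).1) hβ hα hz
  · intro x hx
    simp only [hHB x hx]
    exact collarStretch_graph hinv (fun z => (hκB z).1) hα hβ hαβ' hx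

/-- Brown's collar theorem, for a compact set `B` all of whose points have half-space charts. -/
theorem exists_isCollared [T2Space X] [CompactSpace X] [ProperSpace F] (hB : IsClosed B)
    (hchart : ∀ p ∈ B, ∃ κ : ℝ≥0 × F → X, IsOpenEmbedding κ ∧ κ 0 = p ∧ ∀ z, κ z ∈ B ↔ z.1 = 0) :
    ∃ f : X → ℝ, Continuous f ∧ (∀ x, 0 ≤ f x) ∧ (∀ x ∈ B, 0 < f x) ∧ IsCollared B f := by
  have hbump : ∀ p ∈ B, ∃ a : X → ℝ, Continuous a ∧ (∀ x, 0 ≤ a x) ∧ 0 < a p ∧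
      ∀ f : X → ℝ, Continuous f → (∀ x, 0 ≤ f x) → IsCollared B f →
        IsCollared B fun x => a x + f x := by
    intro p hp
    obtain ⟨κ, hκ, rfl, hκB⟩ := hchart p hp
    have hopen : IsOpen (κ '' (Iio 1 ×ˢ ball 0 1)) :=
      hκ.isOpenMap _ (isOpen_Iio.prod isOpen_ball)
    have hsub : κ '' (Iio 1 ×ˢ ball 0 1) ⊆ κ '' (Icc 0 1 ×ˢ closedBall 0 1) := by
      refine image_mono (prod_mono (fun b hb => ⟨zero_le, le_of_lt hb⟩) ball_subset_closedBall)
    obtain ⟨a, ha0, ha1, ha⟩ := exists_continuous_zero_one_of_isClosed hopen.isClosed_compl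
      (isClosed_singleton (x := κ 0)) (by
        rw [disjoint_singleton_right, notMem_compl_iff]
        exact mem_image_of_mem _ ⟨by simp, by simp⟩)
    refine ⟨a, a.continuous, fun x => (ha x).1, by simp [ha1 (mem_singleton _)], ?_⟩
    intro f hfc hf hcol
    refine hcol.of_eqOn hκ hκB hfc (a.continuous.add hfc) hf
      (fun x => add_nonneg (ha x).1 (hf x)) fun x _ hx => ?_
    have : a x = 0 := ha0 fun h => hx (hsub h)
    rw [this, zero_add]
  choose! a hac ha hap hcol using hbump
  have hcover := hB.isCompact.elim_nhds_subcover (fun p => {x | 0 < a p x})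
    fun p hp => (isOpen_lt continuous_const (hac p hp)).mem_nhds (hap p hp)
  obtain ⟨t, htB, ht⟩ := hcover
  have hsum : ∀ s : Finset X, s ⊆ t → IsCollared B fun x => ∑ p ∈ s, a p x := by
    classical
    intro s
    induction s using Finset.induction_on with
    | empty => intro _; simpa using isCollared_zero B
    | insert p s hps ih =>
      intro hst
      simp only [Finset.sum_insert hps]
      have hsB : ∀ q ∈ s, q ∈ B := fun q hq => htB q (hst (Finset.mem_insert_of_mem hq))
      exact hcol p (htB p (hst (Finset.mem_insert_self _ _))) _
        (continuous_finsetSum _ fun q hq => hac q (hsB q hq))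
        (fun x => Finset.sum_nonneg fun q hq => ha q (hsB q hq) x)
        (ih ((Finset.subset_insert _ _).trans hst))
  refine ⟨fun x => ∑ p ∈ t, a p x, continuous_finsetSum _ fun q hq => hac q (htB q hq),
    fun x => Finset.sum_nonneg fun q hq => ha q (htB q hq) x, ?_, hsum t subset_rfl⟩
  intro x hx
  obtain ⟨p, hp, hpx⟩ := mem_iUnion₂.1 (ht hx)
  exact Finset.sum_pos' (fun q hq => ha q (htB q hq) x) ⟨p, hp, hpx⟩

theorem isCompact_collarSet [CompactSpace X] (hB : IsClosed B) {f : X → ℝ} (hf : Continuous f) :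
    IsCompact (collarSet B f) := by
  obtain ⟨M, hM⟩ := (isCompact_range hf).bddAbove
  refine (isCompact_univ.prod (isCompact_Icc (a := (0 : ℝ)) (b := M))).of_isClosed_subset ?_ ?_
  · exact (isClosed_le continuous_const continuous_snd).inter
      ((isClosed_le continuous_snd (hf.comp continuous_fst)).inter
        ((isClosed_eq continuous_snd continuous_const).union (hB.preimage continuous_fst)))
  · exact fun z hz => ⟨trivial, hz.1, hz.2.1.trans (hM (mem_range_self _))⟩

/-- A compact space is homeomorphic to itself with a unit collar attached to its boundary. -/
theorem exists_homeomorph_collarSet_one [T2Space X] [CompactSpace X] [ProperSpace F]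
    (hB : IsClosed B)
    (hchart : ∀ p ∈ B, ∃ κ : ℝ≥0 × F → X, IsOpenEmbedding κ ∧ κ 0 = p ∧ ∀ z, κ z ∈ B ↔ z.1 = 0) :
    ∃ L : collarSet B (fun _ => 1) ≃ₜ X, ∀ z, z.1.2 = 1 ↔ L z ∈ B := by
  obtain ⟨f, hf, hf0, hfpos, H, hH, hHinj, hHrange, hHB⟩ := exists_isCollared hB hchart
  have hcpt : CompactSpace (collarSet B fun _ => 1) :=
    isCompact_iff_compactSpace.1 (isCompact_collarSet hB continuous_const)
  have hmem : ∀ z : collarSet B (fun _ => 1), (z.1.1, z.1.2 * f z.1.1) ∈ range H := by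
    rintro ⟨⟨x, t⟩, h0, h1, h2⟩
    rw [hHrange]
    rcases h2 with h2 | h2
    · obtain rfl : t = 0 := h2
      simp [collarSet, hf0]
    · exact ⟨mul_nonneg h0 (hf0 _), mul_le_of_le_one_left (hf0 _) h1, Or.inr h2⟩
  let H' : X ≃ₜ range H := (hH.isClosedEmbedding hHinj).isEmbedding.toHomeomorph
  let l : collarSet B (fun _ => 1) → X := fun z => H'.symm ⟨_, hmem z⟩
  have hl : ∀ z, H (l z) = (z.1.1, z.1.2 * f z.1.1) := fun z =>
    congrArg Subtype.val (H'.apply_symm_apply ⟨_, hmem z⟩)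
  have hlc : Continuous l := H'.symm.continuous.comp <| Continuous.subtype_mk (by fun_prop) _
  have hlinj : Injective l := by
    rintro ⟨⟨x, t⟩, h0, h1, h2⟩ ⟨⟨x', t'⟩, h0', h1', h2'⟩ hxy
    have h := congrArg H hxy
    rw [hl, hl, Prod.mk.injEq] at h
    obtain ⟨hx, ht⟩ := h
    obtain rfl : x = x' := hx
    by_cases hxB : x ∈ B
    · obtain rfl : t = t' := mul_right_cancel₀ (hfpos x hxB).ne' ht
      rfl
    · obtain rfl : t = 0 := h2.resolve_right hxB
      obtain rfl : t' = 0 := h2'.resolve_right hxB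
      rfl
  have hlsurj : Surjective l := by
    intro x
    have hx : H x ∈ collarSet B f := hHrange ▸ mem_range_self x
    obtain ⟨h0, h1, h2⟩ := hx
    by_cases hxB : (H x).1 ∈ B
    · have hpos := hfpos _ hxB
      refine ⟨⟨((H x).1, (H x).2 / f (H x).1), div_nonneg h0 hpos.le,
        div_le_one_of_le₀ h1 hpos.le, Or.inr hxB⟩, hHinj ?_⟩
      rw [hl, div_mul_cancel₀ _ hpos.ne']
    · have hx0 := h2.resolve_right hxB
      refine ⟨⟨((H x).1, 0), le_rfl, zero_le_one, Or.inl rfl⟩, hHinj ?_⟩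
      rw [hl, zero_mul]
      exact Prod.ext rfl hx0.symm
  refine ⟨Continuous.homeoOfEquivCompactToT2 (f := Equiv.ofBijective l ⟨hlinj, hlsurj⟩) hlc, ?_⟩
  intro z
  change _ ↔ l z ∈ B
  constructor
  · intro hz
    have hzB : z.1.1 ∈ B := z.2.2.2.resolve_left (by rw [hz]; exact one_ne_zero)
    have : l z = z.1.1 := hHinj (by rw [hl, hHB _ hzB, hz, one_mul])
    rwa [this]
  · intro hz
    have h := hl z
    rw [hHB _ hz, Prod.mk.injEq] at h
    rw [← h.1] at h
    exact (mul_eq_right₀ (hfpos _ hz).ne').1 h.2.symm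

end Collar

section Assembly

open scoped NNReal

variable {X E F : Type*} [TopologicalSpace X] [NormedAddCommGroup E] [NormedSpace ℝ E]
  [NormedAddCommGroup F]

/-- A compact Hausdorff space with a collared boundary sphere `B` and interior homeomorphic to a
finite-dimensional normed space is a closed ball. -/
theorem nonempty_homeomorph_closedBall_of_collarChart [T2Space X] [CompactSpace X] [ProperSpace F]
    [FiniteDimensional ℝ E] {B : Set X}
    (hchart : ∀ p ∈ B, ∃ κ : ℝ≥0 × F → X, IsOpenEmbedding κ ∧ κ 0 = p ∧ ∀ z, κ z ∈ B ↔ z.1 = 0)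
    (s : B ≃ₜ sphere (0 : E) 1) (ψ : ↥(Bᶜ) ≃ₜ E) :
    Nonempty (X ≃ₜ closedBall (0 : E) 1) := by
  have : ProperSpace E := FiniteDimensional.proper_real E
  have hB : IsClosed B := by
    have : CompactSpace B := s.symm.compactSpace
    exact (isCompact_iff_compactSpace.2 this).isClosed
  obtain ⟨L, hL⟩ := exists_homeomorph_collarSet_one hB hchart
  obtain ⟨S, hS⟩ : ∃ S : C(X, E), ∀ x : B, S x = s x := by
    obtain ⟨S, hS⟩ := ContinuousMap.exists_restrict_eq hB
      (⟨fun x => (s x : E), by fun_prop⟩ : C(B, E))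
    exact ⟨S, fun x => congrArg (fun f : C(B, E) => f x) hS⟩
  have hS1 : ∀ x ∈ B, ‖S x‖ = 1 := fun x hx => by
    rw [hS ⟨x, hx⟩]
    simp
  let q : collarSet B (fun _ => 1) → E := fun z => z.1.2 • S z.1.1
  have hq : Continuous q := by fun_prop
  have hqn : ∀ z, ‖q z‖ = z.1.2 := by
    rintro ⟨⟨x, t⟩, h0, h1, h2⟩
    change ‖t • S x‖ = t
    rcases h2 with h2 | h2
    · obtain rfl : t = 0 := h2
      simp
    · rw [norm_smul, hS1 x h2, mul_one, Real.norm_eq_abs, abs_of_nonneg h0]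
  have hq0 : ∀ z, q z = 0 ↔ z.1.2 = 0 := fun z => by rw [← norm_eq_zero, hqn]
  obtain ⟨x₀, hx₀⟩ : ∃ x₀, x₀ ∉ B := ⟨_, (ψ.symm 0).2⟩
  have hbase : ∀ x, (x, (0 : ℝ)) ∈ collarSet B (fun _ => 1) := fun x =>
    ⟨le_rfl, zero_le_one, Or.inl rfl⟩
  refine nonempty_homeomorph_closedBall_of_collapse (q := q ∘ L.symm)
    (hq.comp L.symm.continuous) ?_ ?_ ?_ (j := Subtype.val ∘ ψ.symm)
    (hB.isOpen_compl.isOpenEmbedding_subtypeVal.comp ψ.symm.isOpenEmbedding) ?_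
    (p := L ⟨(x₀, 0), hbase x₀⟩) ?_
  · rw [L.symm.surjective.range_comp]
    refine Subset.antisymm ?_ fun v hv => ?_
    · rintro _ ⟨z, rfl⟩
      rw [mem_closedBall_zero_iff, hqn]
      exact z.2.2.1
    · rw [mem_closedBall_zero_iff] at hv
      by_cases hv0 : v = 0
      · exact ⟨⟨(x₀, 0), hbase x₀⟩, by rw [hv0, hq0]⟩
      · have hpos : ‖v‖ ≠ 0 := norm_ne_zero_iff.2 hv0
        let u : sphere (0 : E) 1 := ⟨‖v‖⁻¹ • v, by
          rw [mem_sphere_zero_iff_norm, norm_smul, norm_inv, norm_norm, inv_mul_cancel₀ hpos]⟩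
        refine ⟨⟨(s.symm u, ‖v‖), norm_nonneg v, hv, Or.inr (s.symm u).2⟩, ?_⟩
        change ‖v‖ • S (s.symm u) = v
        rw [hS, s.apply_symm_apply, smul_smul, mul_inv_cancel₀ hpos, one_smul]
  · suffices h : ∀ z w, q z = q w → q z ≠ 0 → z = w from
      fun x y hxy hx => L.symm.injective (h _ _ hxy hx)
    intro z w hzw hz
    have ht : z.1.2 = w.1.2 := by rw [← hqn, ← hqn, hzw]
    have hz0 : z.1.2 ≠ 0 := fun h => hz ((hq0 z).2 h)
    have hzB : z.1.1 ∈ B := z.2.2.2.resolve_left hz0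
    have hwB : w.1.1 ∈ B := w.2.2.2.resolve_left (ht ▸ hz0)
    have h : z.1.2 • S z.1.1 = w.1.2 • S w.1.1 := hzw
    rw [← ht] at h
    have hSS := smul_right_injective E hz0 h
    rw [hS ⟨_, hzB⟩, hS ⟨_, hwB⟩] at hSS
    have := congrArg Subtype.val (s.injective (Subtype.ext hSS))
    exact Subtype.ext (Prod.ext this ht)
  · intro m
    let g : collarSet B (fun _ => 1) → collarSet B (fun _ => 1) := fun z =>
      ⟨(z.1.1, z.1.2 ^ (m + 1)), pow_nonneg z.2.1 _, pow_le_one₀ z.2.1 z.2.2.1,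
        z.2.2.2.imp_left fun h => by rw [h, zero_pow (Nat.succ_ne_zero m)]⟩
    have hg : Continuous g := Continuous.subtype_mk (by fun_prop) _
    have hginj : Injective g := by
      intro z w h
      have hfst : z.1.1 = w.1.1 := congrArg (fun y => y.1.1) h
      have hsnd : z.1.2 ^ (m + 1) = w.1.2 ^ (m + 1) := congrArg (fun y => y.1.2) h
      exact Subtype.ext (Prod.ext hfst
        ((pow_left_inj₀ z.2.1 w.2.1 (Nat.succ_ne_zero m)).1 hsnd))
    have hgsurj : Surjective g := by
      rintro ⟨⟨x, t⟩, h0, h1, h2⟩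
      simp only at h0 h1 h2
      refine ⟨⟨(x, t ^ ((m + 1 : ℕ) : ℝ)⁻¹), Real.rpow_nonneg h0 _,
        Real.rpow_le_one h0 h1 (by positivity), h2.imp_left fun h => ?_⟩, ?_⟩
      · simp only [h]
        exact Real.zero_rpow (by positivity)
      · exact Subtype.ext (Prod.ext rfl (Real.rpow_inv_natCast_pow h0 (Nat.succ_ne_zero m)))
    refine ⟨L ∘ g ∘ L.symm, L.continuous.comp (hg.comp L.symm.continuous),
      L.bijective.comp (Bijective.comp ⟨hginj, hgsurj⟩ L.symm.bijective), ?_, ?_⟩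
    · intro x
      simp only [comp_apply, L.symm_apply_apply]
      generalize L.symm x = z
      rw [radialPow, hqn, min_eq_left z.2.2.1]
      change z.1.2 ^ (m + 1) • S z.1.1 = z.1.2 ^ m • z.1.2 • S z.1.1
      rw [smul_smul, pow_succ]
    · intro x hx
      have hx' := (hq0 _).1 hx
      have : g (L.symm x) = L.symm x := Subtype.ext (Prod.ext rfl (by
        change (L.symm x).1.2 ^ (m + 1) = (L.symm x).1.2
        rw [hx', zero_pow (Nat.succ_ne_zero m)]))
      simp only [comp_apply, this, L.apply_symm_apply]
  · rw [ψ.symm.surjective.range_comp, Subtype.range_coe]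
    ext x
    have h := hL (L.symm x)
    rw [L.apply_symm_apply] at h
    rw [mem_compl_iff, ← h, mem_ofPred_eq, comp_apply, hqn]
    exact (lt_iff_le_and_ne.trans (and_iff_right (L.symm x).2.2.1)).symm
  · have hopen : IsOpen {x | (L.symm x).1.1 ∈ Bᶜ} :=
      hB.isOpen_compl.preimage (by fun_prop)
    filter_upwards [hopen.mem_nhds (by simpa using hx₀)] with x hx
    exact (hq0 _).2 ((L.symm x).2.2.2.resolve_right hx)

end Assembly

section Charts

open scoped NNReal

theorem StrictMono.isOpenEmbedding_of_isOpen_range {α β : Type*} [LinearOrder α]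
    [TopologicalSpace α] [OrderTopology α] [LinearOrder β] [TopologicalSpace β] [OrderTopology β]
    {f : α → β} (hf : StrictMono f) (ho : IsOpen (range f)) (hc : OrdConnected (range f)) :
    IsOpenEmbedding f :=
  ⟨hf.isEmbedding_of_ordConnected hc, ho⟩

/-- Each neighbourhood of a boundary point of a half-space contains a copy of the half-space. -/
theorem exists_isOpenEmbedding_halfSpace {F : Type*} [NormedAddCommGroup F] [InnerProductSpace ℝ F]
    {W : Set (ℝ≥0 × F)} {y : F} (hW : W ∈ 𝓝 (0, y)) :
    ∃ k : ℝ≥0 × F → ℝ≥0 × F, IsOpenEmbedding k ∧ range k ⊆ W ∧ k 0 = (0, y) := by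
  obtain ⟨δ, hδ, hδW⟩ := Metric.mem_nhds_iff.1 hW
  lift δ to ℝ≥0 using hδ.le
  have hδ0 : 0 < δ := hδ
  let a : ℝ≥0 → ℝ≥0 := fun t => δ * t / (1 + t)
  have ha : StrictMono a := by
    intro s t hst
    have hpos : 0 < δ * (t - s : ℝ) := mul_pos hδ (sub_pos.2 hst)
    change δ * s / (1 + s) < δ * t / (1 + t)
    rw [div_lt_div_iff₀ (by positivity) (by positivity), ← NNReal.coe_lt_coe]
    push_cast
    nlinarith
  have harange : range a = Iio δ := by
    ext s
    constructor
    · rintro ⟨t, rfl⟩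
      change δ * t / (1 + t) < δ
      rw [div_lt_iff₀ (by positivity)]
      exact mul_lt_mul_of_pos_left (lt_one_add t) hδ0
    · intro hs
      have hs' : (0 : ℝ) < δ - s := sub_pos.2 hs
      refine ⟨s / (δ - s), ?_⟩
      rw [← NNReal.coe_inj]
      simp only [a, NNReal.coe_div, NNReal.coe_mul, NNReal.coe_add, NNReal.coe_one,
        NNReal.coe_sub (le_of_lt hs)]
      field_simp
      ring
  have haemb : IsOpenEmbedding a := ha.isOpenEmbedding_of_isOpen_range
    (harange ▸ isOpen_Iio) (harange ▸ ordConnected_Iio)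
  let b := OpenPartialHomeomorph.univBall y (δ : ℝ)
  have hb : IsOpenEmbedding b := b.isOpenEmbedding (OpenPartialHomeomorph.univBall_source y _)
  refine ⟨Prod.map a b, haemb.prodMap hb, ?_, ?_⟩
  · rintro _ ⟨⟨t, v⟩, rfl⟩
    refine hδW ?_
    rw [← ball_prod_same]
    refine ⟨?_, ?_⟩
    · have : a t < δ := by
        have := mem_range_self (f := a) t
        rwa [harange] at this
      rw [mem_ball, NNReal.dist_eq]
      simpa using this
    · rw [← OpenPartialHomeomorph.univBall_target y hδ]
      refine b.map_source ?_
      rw [OpenPartialHomeomorph.univBall_source]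
      trivial
  · exact Prod.ext (by simp [a]) (OpenPartialHomeomorph.univBall_apply_zero y _)

variable {d : ℕ} {X : Type*} [TopologicalSpace X]

theorem isBoundaryPoint_iff {p : X} : IsBoundaryPoint d p ↔
    ∃ κ : ℝ≥0 × EuclideanSpace ℝ (Fin d) → X, IsOpenEmbedding κ ∧ κ 0 = p := by
  constructor
  · rintro ⟨U, hU, hp, φ, hφ⟩
    let e : ℝ≥0 × EuclideanSpace ℝ (Fin d) ≃ₜ ℝ≥0 × EuclideanSpace ℝ (Fin d) :=
      (Homeomorph.refl ℝ≥0).prodCongr (Homeomorph.addRight (φ ⟨p, hp⟩).2)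
    refine ⟨Subtype.val ∘ φ.symm ∘ e, hU.isOpenEmbedding_subtypeVal.comp
      (φ.symm.isOpenEmbedding.comp e.isOpenEmbedding), ?_⟩
    have : e 0 = φ ⟨p, hp⟩ := Prod.ext (Subtype.ext hφ.symm) (zero_add _)
    exact congrArg Subtype.val (φ.symm_apply_eq.2 this)
  · rintro ⟨κ, hκ, rfl⟩
    let e := hκ.isEmbedding.toHomeomorph
    refine ⟨range κ, hκ.isOpen_range, mem_range_self _, e.symm, ?_⟩
    have : e.symm ⟨κ 0, mem_range_self _⟩ = 0 := e.symm_apply_eq.2 rfl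
    exact congrArg (fun z : ℝ≥0 × EuclideanSpace ℝ (Fin d) => (z.1 : ℝ)) this

theorem isInteriorPoint_iff {p : X} : IsInteriorPoint d p ↔
    ∃ j : EuclideanSpace ℝ (Fin (d + 1)) → X, IsOpenEmbedding j ∧ j 0 = p := by
  constructor
  · rintro ⟨U, hU, hp, ⟨φ⟩⟩
    let e := Homeomorph.addRight (φ ⟨p, hp⟩)
    refine ⟨Subtype.val ∘ φ.symm ∘ e, hU.isOpenEmbedding_subtypeVal.comp
      (φ.symm.isOpenEmbedding.comp e.isOpenEmbedding), ?_⟩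
    have : e 0 = φ ⟨p, hp⟩ := zero_add _
    simp [this]
  · rintro ⟨j, hj, rfl⟩
    exact ⟨range j, hj.isOpen_range, mem_range_self _, ⟨hj.isEmbedding.toHomeomorph.symm⟩⟩

/-- If one point of `X` is both an interior and a boundary point, then every interior point is a
boundary point. -/
theorem IsInteriorPoint.isBoundaryPoint_of_exists {p p' : X} (hp : IsInteriorPoint d p)
    (hpb : IsBoundaryPoint d p) (hp' : IsInteriorPoint d p') : IsBoundaryPoint d p' := by
  obtain ⟨j, hj, rfl⟩ := isInteriorPoint_iff.1 hp
  obtain ⟨κ, hκ, hκp⟩ := isBoundaryPoint_iff.1 hpb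
  obtain ⟨j', hj', rfl⟩ := isInteriorPoint_iff.1 hp'
  have hW : κ ⁻¹' range j ∈ 𝓝 ((0 : ℝ≥0), (0 : EuclideanSpace ℝ (Fin d))) :=
    hκ.continuous.continuousAt.preimage_mem_nhds
      (hj.isOpen_range.mem_nhds ⟨0, hκp.symm⟩)
  obtain ⟨k, hk, hkW, hk0⟩ := exists_isOpenEmbedding_halfSpace hW
  choose r hr using fun z => hkW (mem_range_self z)
  have hjr : j ∘ r = κ ∘ k := funext hr
  have hremb : IsOpenEmbedding r := by
    refine IsOpenEmbedding.of_comp _ hj ?_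
    rw [hjr]
    exact hκ.comp hk
  refine isBoundaryPoint_iff.2 ⟨j' ∘ r, hj'.comp hremb, congrArg j' (hj.injective ?_)⟩
  rw [hr, hk0]
  exact hκp

/-- Points of positive height in a half-space chart are interior points. -/
theorem isInteriorPoint_of_halfSpaceChart {κ : ℝ≥0 × EuclideanSpace ℝ (Fin d) → X}
    (hκ : IsOpenEmbedding κ) {z : ℝ≥0 × EuclideanSpace ℝ (Fin d)} (hz : z.1 ≠ 0) :
    IsInteriorPoint d (κ z) := by
  let a : ℝ → ℝ≥0 := fun r => ⟨Real.exp r, (Real.exp_pos r).le⟩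
  have ha : StrictMono a := fun r s h => Real.exp_lt_exp.2 h
  have harange : range a = Ioi 0 := by
    ext t
    constructor
    · rintro ⟨r, rfl⟩
      exact Real.exp_pos r
    · intro ht
      exact ⟨Real.log t, Subtype.ext (Real.exp_log ht)⟩
  have haemb : IsOpenEmbedding a := ha.isOpenEmbedding_of_isOpen_range
    (harange ▸ isOpen_Ioi) (harange ▸ ordConnected_Ioi)
  let L : EuclideanSpace ℝ (Fin (d + 1)) ≃L[ℝ] ℝ × EuclideanSpace ℝ (Fin d) :=
    ContinuousLinearEquiv.ofFinrankEq (by simp [add_comm])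
  have hj : IsOpenEmbedding (κ ∘ Prod.map a id ∘ L) :=
    hκ.comp ((haemb.prodMap IsOpenEmbedding.id).comp L.toHomeomorph.isOpenEmbedding)
  refine ⟨_, hj.isOpen_range, ?_, ⟨hj.isEmbedding.toHomeomorph.symm⟩⟩
  obtain ⟨r, hr⟩ : z.1 ∈ range a := harange ▸ pos_iff_ne_zero.2 hz
  exact ⟨L.symm (r, z.2), by simp [hr]⟩

theorem exists_halfSpaceChart_of_isBoundaryPoint
    (hex : ∀ p : X, IsInteriorPoint d p → ¬ IsBoundaryPoint d p) {p : X}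
    (hp : IsBoundaryPoint d p) :
    ∃ κ : ℝ≥0 × EuclideanSpace ℝ (Fin d) → X, IsOpenEmbedding κ ∧ κ 0 = p ∧
      ∀ z, κ z ∈ {p : X | IsBoundaryPoint d p} ↔ z.1 = 0 := by
  obtain ⟨κ, hκ, hκp⟩ := isBoundaryPoint_iff.1 hp
  refine ⟨κ, hκ, hκp, fun z => ⟨fun hz => ?_, fun hz => ?_⟩⟩
  · by_contra h
    exact hex _ (isInteriorPoint_of_halfSpaceChart hκ h) hz
  · let e : ℝ≥0 × EuclideanSpace ℝ (Fin d) ≃ₜ ℝ≥0 × EuclideanSpace ℝ (Fin d) :=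
      (Homeomorph.refl ℝ≥0).prodCongr (Homeomorph.addRight z.2)
    refine isBoundaryPoint_iff.2 ⟨κ ∘ e, hκ.comp e.isOpenEmbedding, congrArg κ ?_⟩
    exact Prod.ext hz.symm (zero_add _)

end Charts

/-- Generalized Poincaré conjecture + Brown's collar theorem: a compact `(d+1)`-dimensional
topological manifold with boundary, whose boundary is homeomorphic to the `d`-sphere and
whose interior is homeomorphic to the open `(d+1)`-ball (equivalently `ℝ^{d+1}`), is
homeomorphic to the closed `(d+1)`-ball. -/
theorem closedBall_of_sphere_boundary_ball_interior (d : ℕ)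
    (X : Type*) [TopologicalSpace X] [T2Space X] [CompactSpace X]
    (hloc : ∀ p : X, IsInteriorPoint d p ∨ IsBoundaryPoint d p)
    (hbd : Nonempty (({p : X | IsBoundaryPoint d p}) ≃ₜ
      (Metric.sphere (0 : EuclideanSpace ℝ (Fin (d + 1))) 1)))
    (hint : Nonempty (({p : X | ¬ IsBoundaryPoint d p}) ≃ₜ
      EuclideanSpace ℝ (Fin (d + 1)))) :
    Nonempty (X ≃ₜ (Metric.closedBall (0 : EuclideanSpace ℝ (Fin (d + 1))) 1)) := by
  obtain ⟨s⟩ := hbd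
  obtain ⟨ψ⟩ := hint
  have hex : ∀ p : X, IsInteriorPoint d p → ¬ IsBoundaryPoint d p := fun p hp hpb =>
    (ψ.symm 0).2 <| (hloc _).elim (fun h => hp.isBoundaryPoint_of_exists hpb h) id
  exact nonempty_homeomorph_closedBall_of_collarChart
    (fun p hp => exists_halfSpaceChart_of_isBoundaryPoint hex hp) s ψ
end

section
/- Let X be a Hausdorff topological space with a finite partition X = ⨆_{α ∈ Q} X_α which is a regular CW complex, i.e.: (1) for each α ∈ Q there is n_α : ℕ and a homeomorphism from the closed unit ball of EuclideanSpace ℝ (Fin n_α) onto the closure of X_α in X (with the subspace topology) carrying the open unit ball onto X_α; (2) for each α ∈ Q the closure of X_α is a union of parts X_β, β ∈ Q. Order Q by β ≤ α iff X_β ⊆ closure(X_α) (the face poset). Let Q̂ be Q with a new minimum 0̂ and a new maximum 1̂ adjoined. Assume Q̂ is graded, thin, and shellable, and let r be the common cardinality of the maximal chains of Q. Then X is homeomorphic to a sphere of dimension r − 1, i.e., to Metric.sphere (0 : EuclideanSpace ℝ (Fin r)) 1 when r ≥ 1. -/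
section PosetCombinatorics

variable {α : Type*} (r : α → α → Prop)

/-- A chain of the subposet `s` with respect to the relation `r`. -/
def ChainIn (s c : Set α) : Prop := c ⊆ s ∧ IsChain r c

/-- A maximal chain of the subposet `s` with respect to the relation `r`. -/
def MaxChainIn (s c : Set α) : Prop :=
  ChainIn r s c ∧ ∀ c' : Set α, ChainIn r s c' → c ⊆ c' → c = c'

/-- The closed interval `[a, b]` inside the subposet `s`. -/
def intervalIn (s : Set α) (a b : α) : Set α := {x ∈ s | r a x ∧ r x b}

/-- The subposet `s` is graded: all its maximal chains have the same cardinality. -/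
def GradedIn (s : Set α) : Prop := ∃ n : ℕ, ∀ c : Set α, MaxChainIn r s c → c.ncard = n

/-- The subposet `s` is thin: every closed interval of rank 2 (i.e. in which all maximal
chains have 3 elements) contains exactly four elements. -/
def ThinIn (s : Set α) : Prop :=
  ∀ a ∈ s, ∀ b ∈ s, r a b →
    (∀ c : Set α, MaxChainIn r (intervalIn r s a b) c → c.ncard = 3) →
      (intervalIn r s a b).ncard = 4

/-- The subposet `s` is shellable: its maximal chains can be enumerated `c_1, …, c_t`
such that for all `i < j` there exists `k < j` with `c_i ∩ c_j ⊆ c_k ∩ c_j` and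
`|c_k ∩ c_j| = |c_j| − 1`. -/
def ShellableIn (s : Set α) : Prop :=
  ∃ (t : ℕ) (c : Fin t → Set α), Function.Injective c ∧
    (∀ i, MaxChainIn r s (c i)) ∧ (∀ d : Set α, MaxChainIn r s d → ∃ i, d = c i) ∧
    ∀ i j : Fin t, i < j → ∃ k : Fin t, k < j ∧
      c i ∩ c j ⊆ c k ∩ c j ∧ (c k ∩ c j).ncard = (c j).ncard - 1

end PosetCombinatorics

section Topology

open Set Metric Filter Topology

variable {E T : Type*} [NormedAddCommGroup E] [NormedSpace ℝ E]

/-- The positively homogeneous extension of a function defined on the unit sphere. -/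
noncomputable def radialExt [NormedAddCommGroup T] [NormedSpace ℝ T] (k : E → T) (z : E) : T :=
  ‖z‖ • k (‖z‖⁻¹ • z)

section

variable [NormedAddCommGroup T] [NormedSpace ℝ T] (k : E → T)

theorem radialExt_zero : radialExt k 0 = 0 := by simp [radialExt]

theorem radialExt_smul {s : ℝ} (hs : 0 ≤ s) {u : E} (hu : ‖u‖ = 1) :
    radialExt k (s • u) = s • k u := by
  rcases hs.eq_or_lt with rfl | hs
  · simp [radialExt]
  · simp [radialExt, norm_smul, hu, abs_of_pos hs, smul_smul, hs.ne']

theorem radialExt_eq {u : E} (hu : ‖u‖ = 1) : radialExt k u = k u := by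
  simpa using radialExt_smul k zero_le_one hu

theorem continuous_radialExt [ProperSpace E] (hk : ContinuousOn k (sphere 0 1)) :
    Continuous (radialExt k) := by
  rw [continuous_iff_continuousAt]
  intro z
  by_cases hz : z = 0
  · subst hz
    obtain ⟨C, hC⟩ := (isCompact_sphere (0 : E) 1).exists_bound_of_continuousOn hk
    rw [ContinuousAt, radialExt_zero]
    apply squeeze_zero_norm (a := fun z : E => ‖z‖ * C)
    · intro z
      by_cases hz : z = 0
      · simp [hz, radialExt]
      · rw [radialExt, norm_smul, norm_norm]
        refine mul_le_mul_of_nonneg_left (hC _ ?_) (norm_nonneg z)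
        simp [norm_smul, hz]
    · have : Continuous fun z : E => ‖z‖ * C := by fun_prop
      simpa using this.tendsto 0
  · have h : ContinuousOn (radialExt k) {0}ᶜ := by
      unfold radialExt
      refine continuous_norm.continuousOn.smul (hk.comp ?_ ?_)
      · refine ContinuousOn.smul (continuous_norm.continuousOn.inv₀ ?_) continuousOn_id
        intro x hx
        simpa using hx
      · intro x hx
        have : x ≠ 0 := hx
        simp [norm_smul, this]
    exact h.continuousAt (isOpen_compl_singleton.mem_nhds hz)

end

theorem exists_polar {z : E} (hz : z ≠ 0) : ∃ s : ℝ, 0 < s ∧ ∃ u : E, ‖u‖ = 1 ∧ z = s • u := by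
  refine ⟨‖z‖, norm_pos_iff.2 hz, ‖z‖⁻¹ • z, ?_, ?_⟩
  · simp [norm_smul, hz]
  · simp [smul_smul, hz]

theorem norm_polar {s : ℝ} (hs : 0 ≤ s) {u : E} (hu : ‖u‖ = 1) : ‖s • u‖ = s := by
  simp [norm_smul, hu, abs_of_nonneg hs]

theorem polar_unique {s s' : ℝ} (hs : 0 < s) (hs' : 0 < s') {u u' : E} (hu : ‖u‖ = 1)
    (hu' : ‖u'‖ = 1) (h : s • u = s' • u') : s = s' ∧ u = u' := by
  have h1 : s = s' := by rw [← norm_polar hs.le hu, h, norm_polar hs'.le hu']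
  subst h1
  exact ⟨rfl, smul_right_injective E hs.ne' h⟩

/-- `g` restricts to a continuous bijection from the closed unit ball onto `B`, which carries the
unit sphere onto the part of `B` lying in `D`. -/
structure IsBallParam [TopologicalSpace T] (g : E → T) (B D : Set T) : Prop where
  continuousOn : ContinuousOn g (closedBall 0 1)
  bijOn : BijOn g (closedBall 0 1) B
  norm_eq_one_iff : ∀ y ∈ closedBall (0 : E) 1, ‖y‖ = 1 ↔ g y ∈ D

theorem ContinuousOn.invFunOn_of_isCompact {S : Type*} [Nonempty S] [TopologicalSpace S]
    [TopologicalSpace T] [T2Space T]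
    {f : S → T} {s : Set S} (hf : ContinuousOn f s) (hs : IsCompact s) (hinj : InjOn f s) :
    ContinuousOn (Function.invFunOn f s) (f '' s) := by
  rw [continuousOn_iff_isClosed]
  intro t ht
  refine ⟨f '' (t ∩ s), ((hs.inter_left ht).image_of_continuousOn
    (hf.mono inter_subset_right)).isClosed, ?_⟩
  ext y
  constructor
  · rintro ⟨hy, x, hx, rfl⟩
    rw [mem_preimage, hinj.leftInvOn_invFunOn hx] at hy
    exact ⟨⟨x, ⟨hy, hx⟩, rfl⟩, x, hx, rfl⟩
  · rintro ⟨⟨x, ⟨hxt, hx⟩, rfl⟩, -⟩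
    refine ⟨?_, x, hx, rfl⟩
    rwa [mem_preimage, hinj.leftInvOn_invFunOn hx]

/-- A parametrization of a ball may be changed so as to agree with a given parametrization of its
boundary sphere. -/
theorem IsBallParam.exists_eq_on_sphere [ProperSpace E] [TopologicalSpace T] [T2Space T]
    {b g : E → T} {B C D D' : Set T} (hg : IsBallParam g B D) (hb : IsBallParam b C D')
    (hBC : B ∩ D = C ∩ D') :
    ∃ b' : E → T, IsBallParam b' C D' ∧ ∀ u : E, ‖u‖ = 1 → b' u = g u := by
  set i := Function.invFunOn b (closedBall 0 1) with hi
  have hic : ContinuousOn i C := by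
    rw [← hb.bijOn.image_eq]
    exact hb.continuousOn.invFunOn_of_isCompact (isCompact_closedBall 0 1) hb.bijOn.injOn
  have hsub : sphere (0 : E) 1 ⊆ closedBall 0 1 := sphere_subset_closedBall
  have hmem : ∀ u : E, ‖u‖ = 1 → g u ∈ C ∩ D' := by
    intro u hu
    have hu' : u ∈ closedBall (0 : E) 1 := by simp [hu]
    rw [← hBC]
    exact ⟨hg.bijOn.mapsTo hu', (hg.norm_eq_one_iff u hu').1 hu⟩
  have hbi : ∀ x ∈ C, i x ∈ closedBall (0 : E) 1 ∧ b (i x) = x := by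
    intro x hx
    rw [← hb.bijOn.image_eq] at hx
    exact ⟨Function.invFunOn_mem hx, Function.invFunOn_eq hx⟩
  have hτ : ∀ u : E, ‖u‖ = 1 → ‖i (g u)‖ = 1 := by
    intro u hu
    obtain ⟨h1, h2⟩ := hbi _ (hmem u hu).1
    rw [hb.norm_eq_one_iff _ h1, h2]
    exact (hmem u hu).2
  set ρ : E → E := radialExt (fun u => i (g u)) with hρ
  have hρs : ∀ {s : ℝ} (_ : 0 ≤ s) {u : E} (_ : ‖u‖ = 1), ρ (s • u) = s • i (g u) :=
    fun hs _ hu => radialExt_smul _ hs hu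
  have hρ0 : ρ 0 = 0 := radialExt_zero _
  have hρn : ∀ z, ‖ρ z‖ = ‖z‖ := by
    intro z
    by_cases hz : z = 0
    · rw [hz, hρ0]
    · obtain ⟨s, hs, u, hu, rfl⟩ := exists_polar hz
      rw [hρs hs.le hu, norm_polar hs.le hu, norm_polar hs.le (hτ u hu)]
  have hρc : Continuous ρ := by
    apply continuous_radialExt
    refine hic.comp (hg.continuousOn.mono hsub) ?_
    intro u hu
    exact (hmem u (by simpa using hu)).1
  have hρm : MapsTo ρ (closedBall 0 1) (closedBall 0 1) := by
    intro z hz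
    simpa [hρn] using hz
  have hρbij : BijOn ρ (closedBall 0 1) (closedBall 0 1) := by
    refine ⟨hρm, ?_, ?_⟩
    · intro z hz z' hz' h
      have hn : ‖z‖ = ‖z'‖ := by rw [← hρn z, h, hρn]
      by_cases h0 : z = 0
      · rw [h0, norm_zero] at hn
        rw [h0, norm_eq_zero.1 hn.symm]
      · have h0' : z' ≠ 0 := by
          intro h1
          rw [h1, norm_zero] at hn
          exact h0 (norm_eq_zero.1 hn)
        obtain ⟨s, hs, u, hu, rfl⟩ := exists_polar h0
        obtain ⟨s', hs', u', hu', rfl⟩ := exists_polar h0'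
        rw [hρs hs.le hu, hρs hs'.le hu'] at h
        obtain ⟨rfl, h2⟩ := polar_unique hs hs' (hτ u hu) (hτ u' hu') h
        have h3 : g u = g u' := by
          rw [← (hbi _ (hmem u hu).1).2, ← (hbi _ (hmem u' hu').1).2, h2]
        rw [hg.bijOn.injOn (by simp [hu]) (by simp [hu']) h3]
    · intro y hy
      by_cases h0 : y = 0
      · exact ⟨0, by simp, by rw [hρ0, h0]⟩
      · obtain ⟨s, hs, u, hu, rfl⟩ := exists_polar h0
        have hu1 : u ∈ closedBall (0 : E) 1 := by simp [hu]
        have hbu : b u ∈ B ∩ D := by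
          rw [hBC]
          exact ⟨hb.bijOn.mapsTo hu1, (hb.norm_eq_one_iff u hu1).1 hu⟩
        obtain ⟨v, hv, hgv⟩ := hg.bijOn.surjOn hbu.1
        have hv1 : ‖v‖ = 1 := by
          rw [hg.norm_eq_one_iff v hv, hgv]
          exact hbu.2
        refine ⟨s • v, ?_, ?_⟩
        · rw [mem_closedBall_zero_iff, norm_polar hs.le hu] at hy
          rwa [mem_closedBall_zero_iff, norm_polar hs.le hv1]
        · rw [hρs hs.le hv1, hgv]
          congr 1
          exact hb.bijOn.injOn.leftInvOn_invFunOn hu1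
  refine ⟨b ∘ ρ, ⟨hb.continuousOn.comp hρc.continuousOn hρm, hb.bijOn.comp hρbij, ?_⟩, ?_⟩
  · intro y hy
    rw [← hρn y]
    exact hb.norm_eq_one_iff _ (hρm hy)
  · intro u hu
    have : ρ u = i (g u) := radialExt_eq _ hu
    rw [Function.comp_apply, this]
    exact (hbi _ (hmem u hu).1).2

/-- Two balls of dimension `n` glued along their boundaries form a sphere of dimension `n`. -/
theorem exists_sphere_param {n : ℕ} [TopologicalSpace T] [T2Space T]
    {b g : EuclideanSpace ℝ (Fin n) → T} {B C D D' : Set T} (hg : IsBallParam g B D)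
    (hb : IsBallParam b C D') (hBC : B ∩ D = C ∩ D') (hBC' : B ∩ C ⊆ D) :
    ∃ h : EuclideanSpace ℝ (Fin (n + 1)) → T,
      ContinuousOn h (sphere 0 1) ∧ BijOn h (sphere 0 1) (B ∪ C) := by
  obtain ⟨b', hb', hbg⟩ := hg.exists_eq_on_sphere hb hBC
  let p : EuclideanSpace ℝ (Fin (n + 1)) → EuclideanSpace ℝ (Fin n) :=
    fun z => WithLp.toLp 2 (fun i => z i.succ)
  have hpc : Continuous p := by
    refine (PiLp.continuous_toLp 2 _).comp ?_
    fun_prop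
  have hpn : ∀ z, ‖z‖ ^ 2 = z 0 ^ 2 + ‖p z‖ ^ 2 := by
    intro z
    simp [EuclideanSpace.norm_sq_eq, Fin.sum_univ_succ, p]
  have hsph : ∀ z ∈ sphere (0 : EuclideanSpace ℝ (Fin (n + 1))) 1, z 0 ^ 2 + ‖p z‖ ^ 2 = 1 := by
    intro z hz
    rw [← hpn, mem_sphere_zero_iff_norm.1 hz, one_pow]
  have hpm : MapsTo p (sphere 0 1) (closedBall 0 1) := by
    intro z hz
    have := hsph z hz
    rw [mem_closedBall_zero_iff]
    nlinarith [norm_nonneg (p z), sq_nonneg (z 0)]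
  have hlift : ∀ y ∈ closedBall (0 : EuclideanSpace ℝ (Fin n)) 1, ∀ s : ℝ, s ^ 2 = 1 - ‖y‖ ^ 2 →
      ∃ z ∈ sphere (0 : EuclideanSpace ℝ (Fin (n + 1))) 1, p z = y ∧ z 0 = s := by
    intro y hy s hs
    let z : EuclideanSpace ℝ (Fin (n + 1)) := WithLp.toLp 2 (Fin.cons s (fun i => y i))
    have hz : p z = y := by
      ext i
      simp [p, z]
    have hz0 : z 0 = s := by simp [z]
    refine ⟨z, ?_, hz, hz0⟩
    rw [mem_sphere_zero_iff_norm]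
    have h1 := hpn z
    rw [hz, hz0, hs] at h1
    have : ‖z‖ ^ 2 = 1 := by linarith
    exact (pow_eq_one_iff_of_nonneg (norm_nonneg z) two_ne_zero).1 this
  have hext : ∀ z z' : EuclideanSpace ℝ (Fin (n + 1)), z 0 = z' 0 → p z = p z' → z = z' := by
    intro z z' h0 h1
    ext i
    refine Fin.cases h0 (fun i => ?_) i
    exact congrArg (fun y : EuclideanSpace ℝ (Fin n) => y i) h1
  have hz0c : Continuous fun z : EuclideanSpace ℝ (Fin (n + 1)) => z 0 := by fun_prop
  classical
  have hbmem : ∀ y ∈ closedBall (0 : EuclideanSpace ℝ (Fin n)) 1, b' y ∈ B → ‖y‖ = 1 := by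
    intro y hy hyB
    rw [hb'.norm_eq_one_iff y hy]
    have h1 := hb'.bijOn.mapsTo hy
    have : b' y ∈ C ∩ D' := by
      rw [← hBC]
      exact ⟨hyB, hBC' ⟨hyB, h1⟩⟩
    exact this.2
  refine ⟨fun z => if 0 ≤ z 0 then g (p z) else b' (p z), ?_, ?_, ?_, ?_⟩
  · refine ContinuousOn.if ?_ ?_ ?_
    · rintro z ⟨hz, hz'⟩
      have h0 : z 0 = 0 := by
        have := frontier_le_subset_eq continuous_const hz0c hz'
        exact this.symm
      have h1 := hsph z hz
      rw [h0] at h1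
      refine (hbg _ ?_).symm
      nlinarith [norm_nonneg (p z)]
    · exact (hg.continuousOn.comp hpc.continuousOn hpm).mono inter_subset_left
    · exact (hb'.continuousOn.comp hpc.continuousOn hpm).mono inter_subset_left
  · intro z hz
    by_cases h : 0 ≤ z 0
    · simp only [h, if_true]
      exact Or.inl (hg.bijOn.mapsTo (hpm hz))
    · simp only [h, if_false]
      exact Or.inr (hb'.bijOn.mapsTo (hpm hz))
  · have key : ∀ z ∈ sphere (0 : EuclideanSpace ℝ (Fin (n + 1))) 1,
        ∀ z' ∈ sphere (0 : EuclideanSpace ℝ (Fin (n + 1))) 1, 0 ≤ z 0 → ¬ 0 ≤ z' 0 →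
        g (p z) ≠ b' (p z') := by
      intro z hz z' hz' h h' heq
      have h1 := hbmem _ (hpm hz') (by rw [← heq]; exact hg.bijOn.mapsTo (hpm hz))
      have h2 := hsph z' hz'
      rw [h1] at h2
      apply h'
      nlinarith
    intro z hz z' hz' heq
    have h1 := hsph z hz
    have h2 := hsph z' hz'
    by_cases h : 0 ≤ z 0 <;> by_cases h' : 0 ≤ z' 0 <;> simp only [h, h', if_true, if_false] at heq
    · have h3 := hg.bijOn.injOn (hpm hz) (hpm hz') heq
      refine hext _ _ ?_ h3
      rw [h3] at h1
      exact (sq_eq_sq₀ h h').1 (by linarith)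
    · exact absurd heq (key z hz z' hz' h h')
    · exact absurd heq.symm (key z' hz' z hz h' h)
    · have h3 := hb'.bijOn.injOn (hpm hz) (hpm hz') heq
      refine hext _ _ ?_ h3
      rw [h3] at h1
      push Not at h h'
      nlinarith
  · rintro x (hx | hx)
    · obtain ⟨y, hy, rfl⟩ := hg.bijOn.surjOn hx
      have hy1 : ‖y‖ ≤ 1 := by simpa using hy
      obtain ⟨z, hz, h1, h2⟩ := hlift y hy (√(1 - ‖y‖ ^ 2))
        (Real.sq_sqrt (by nlinarith [norm_nonneg y]))
      refine ⟨z, hz, ?_⟩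
      have : 0 ≤ z 0 := h2 ▸ Real.sqrt_nonneg _
      simp only [this, if_true, h1]
    · obtain ⟨y, hy, rfl⟩ := hb'.bijOn.surjOn hx
      have hy1 : ‖y‖ ≤ 1 := by simpa using hy
      have hnn : 0 ≤ 1 - ‖y‖ ^ 2 := by nlinarith [norm_nonneg y]
      obtain ⟨z, hz, h1, h2⟩ := hlift y hy (-√(1 - ‖y‖ ^ 2))
        (by rw [neg_sq]; exact Real.sq_sqrt hnn)
      refine ⟨z, hz, ?_⟩
      by_cases h : 0 ≤ z 0
      · simp only [h, if_true, h1]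
        refine (hbg y ?_).symm
        have h3 : √(1 - ‖y‖ ^ 2) = 0 := by
          have := Real.sqrt_nonneg (1 - ‖y‖ ^ 2)
          linarith
        have h4 := (Real.sqrt_eq_zero hnn).1 h3
        nlinarith [norm_nonneg y]
      · simp only [h, if_false, h1]

/-- Gluing a cell `σ`, fibred over a part of its boundary by segments of direction `w`, to a ball
`B` along that part of the boundary yields a ball. -/
theorem IsBallParam.exists_glue [ProperSpace E] [NormedAddCommGroup T] [NormedSpace ℝ T]
    {g : E → T} {B D D' σ N : Set T} {w : T} {a f : T → ℝ} (hg : IsBallParam g B D)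
    (hσ : IsClosed σ) (hN : IsClosed N) (ha : ∀ x s, a (x + s • w) = a x + s)
    (hf : ∀ x s, f (x + s • w) = f x - s) (hfc : Continuous f)
    (ha0 : ∀ x ∈ σ, 0 ≤ a x) (hf0 : ∀ x ∈ σ, 0 ≤ f x)
    (hline : ∀ x ∈ σ, ∀ s, -a x ≤ s → s ≤ f x → x + s • w ∈ σ)
    (hB : ∀ x ∈ σ, x ∈ B ↔ a x = 0) (hBD : ∀ x ∈ B, x ∈ σ → x ∈ D)
    (hDN : ∀ x ∈ B, x ∈ D → x ∈ σ ∨ x ∈ N) (hN0 : ∀ x ∈ B, x ∈ σ → x ∈ N → f x = 0)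
    (hD' : ∀ x ∈ B ∪ σ, x ∈ D' ↔ (x ∈ σ ∧ f x = 0) ∨ (x ∉ σ ∧ x ∈ D)) :
    ∃ g' : E → T, IsBallParam g' (B ∪ σ) D' := by
  classical
  let φ : E → ℝ := fun u => if g u ∈ σ then f (g u) else 0
  have hφ0 : ∀ u, 0 ≤ φ u := by
    intro u
    simp only [φ]
    split_ifs with h
    · exact hf0 _ h
    · exact le_rfl
  have hsub : sphere (0 : E) 1 ⊆ closedBall 0 1 := sphere_subset_closedBall
  have hmem : ∀ u : E, ‖u‖ = 1 → g u ∈ B ∧ g u ∈ D := by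
    intro u hu
    have hu' : u ∈ closedBall (0 : E) 1 := by simp [hu]
    exact ⟨hg.bijOn.mapsTo hu', (hg.norm_eq_one_iff u hu').1 hu⟩
  have hgs : ContinuousOn g (sphere 0 1) := hg.continuousOn.mono hsub
  have hφc : ContinuousOn φ (sphere 0 1) := by
    have h1 : ContinuousOn φ (sphere 0 1 ∩ g ⁻¹' σ) := by
      refine (hfc.comp_continuousOn (hgs.mono inter_subset_left)).congr ?_
      intro u hu
      have : g u ∈ σ := hu.2
      simp [φ, this]
    have h2 : ContinuousOn φ (sphere 0 1 ∩ g ⁻¹' N) := by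
      refine (continuousOn_const (c := (0 : ℝ))).congr ?_
      intro u hu
      simp only [φ]
      split_ifs with h
      · exact hN0 _ (hmem u (by simpa using hu.1)).1 h hu.2
      · rfl
    refine (h1.union_of_isClosed h2 (hgs.preimage_isClosed_of_isClosed isClosed_sphere hσ)
      (hgs.preimage_isClosed_of_isClosed isClosed_sphere hN)).mono ?_
    intro u hu
    obtain ⟨h3, h4⟩ := hmem u (by simpa using hu)
    exact (hDN _ h3 h4).imp (fun h => ⟨hu, h⟩) (fun h => ⟨hu, h⟩)
  set ρ : E → E := radialExt (fun u => (1 + φ u) • u) with hρ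
  have hρs : ∀ {s : ℝ} (_ : 0 ≤ s) {u : E} (_ : ‖u‖ = 1), ρ (s • u) = (s * (1 + φ u)) • u := by
    intro s hs u hu
    rw [hρ, radialExt_smul _ hs hu, smul_smul]
  have hρ0 : ρ 0 = 0 := radialExt_zero _
  have hρc : Continuous ρ :=
    continuous_radialExt _ ((continuousOn_const.add hφc).smul continuousOn_id)
  have hpos : ∀ u, 0 < 1 + φ u := fun u => by linarith [hφ0 u]
  have hρinj : Function.Injective ρ := by
    have h0 : ∀ z, ρ z = 0 → z = 0 := by
      intro z hz
      by_contra hne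
      obtain ⟨s, hs, u, hu, rfl⟩ := exists_polar hne
      rw [hρs hs.le hu] at hz
      have := norm_polar (mul_pos hs (hpos u)).le hu
      rw [hz, norm_zero] at this
      exact (mul_pos hs (hpos u)).ne this
    intro z z' h
    by_cases hz : z = 0
    · rw [hz, hρ0] at h
      rw [hz, h0 z' h.symm]
    · by_cases hz' : z' = 0
      · rw [hz', hρ0] at h
        exact absurd (h0 z h) hz
      · obtain ⟨s, hs, u, hu, rfl⟩ := exists_polar hz
        obtain ⟨s', hs', u', hu', rfl⟩ := exists_polar hz'
        rw [hρs hs.le hu, hρs hs'.le hu'] at h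
        obtain ⟨h1, rfl⟩ := polar_unique (mul_pos hs (hpos u)) (mul_pos hs' (hpos u')) hu hu' h
        rw [mul_right_cancel₀ (hpos u).ne' h1]
  let G : E → T := fun y => g ((max 1 ‖y‖)⁻¹ • y) + (max 1 ‖y‖ - 1) • w
  have hGc : Continuous G := by
    have h1 : ∀ y : E, max 1 ‖y‖ ≠ 0 := fun y => (lt_max_of_lt_left one_pos).ne'
    refine Continuous.add (hg.continuousOn.comp_continuous ?_ ?_) ?_
    · exact ((continuous_const.max continuous_norm).inv₀ h1).smul continuous_id
    · intro y
      rw [mem_closedBall_zero_iff, norm_smul, norm_inv, Real.norm_eq_abs,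
        abs_of_pos (lt_max_of_lt_left one_pos), inv_mul_le_one₀ (lt_max_of_lt_left one_pos)]
      exact le_max_right _ _
    · exact ((continuous_const.max continuous_norm).sub continuous_const).smul continuous_const
  have hG1 : ∀ y : E, ‖y‖ ≤ 1 → G y = g y := by
    intro y hy
    simp [G, max_eq_left hy]
  have hG2 : ∀ u : E, ‖u‖ = 1 → ∀ t : ℝ, 0 ≤ t → G ((1 + t) • u) = g u + t • w := by
    intro u hu t ht
    have h1 : ‖(1 + t) • u‖ = 1 + t := norm_polar (by linarith) hu
    have h2 : max 1 ‖(1 + t) • u‖ = 1 + t := by rw [h1]; exact max_eq_right (by linarith)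
    have h3 : 1 + t ≠ 0 := by linarith
    simp only [G, h2, smul_smul, inv_mul_cancel₀ h3, one_smul, add_sub_cancel_left]
  have hφmem : ∀ u : E, ‖u‖ = 1 → ∀ t, 0 < t → t ≤ φ u →
      g u ∈ σ ∧ φ u = f (g u) ∧ a (g u) = 0 ∧ g u + t • w ∈ σ := by
    intro u hu t ht htφ
    have h1 : g u ∈ σ := by
      by_contra h
      simp only [φ, h, if_false] at htφ
      linarith
    have h2 : φ u = f (g u) := by simp only [φ, h1, if_true]
    have h3 : a (g u) = 0 := (hB _ h1).1 (hmem u hu).1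
    exact ⟨h1, h2, h3, hline _ h1 t (by linarith) (by linarith)⟩
  have hrep : ∀ z ∈ closedBall (0 : E) 1, (‖ρ z‖ ≤ 1) ∨
      ∃ u t, ‖u‖ = 1 ∧ 0 < t ∧ t ≤ φ u ∧ ρ z = (1 + t) • u ∧ z = ((1 + t) / (1 + φ u)) • u := by
    intro z hz
    by_cases h0 : z = 0
    · left
      simp [h0, hρ0]
    · obtain ⟨s, hs, u, hu, rfl⟩ := exists_polar h0
      rw [mem_closedBall_zero_iff, norm_polar hs.le hu] at hz
      by_cases h : s * (1 + φ u) ≤ 1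
      · left
        rwa [hρs hs.le hu, norm_polar (mul_pos hs (hpos u)).le hu]
      · right
        push Not at h
        refine ⟨u, s * (1 + φ u) - 1, hu, by linarith, by nlinarith [hφ0 u], ?_, ?_⟩
        · rw [hρs hs.le hu]
          congr 1
          ring
        · congr 1
          have := (hpos u).ne'
          field_simp
          ring
  have hball : ∀ y : E, ‖y‖ ≤ 1 → y ∈ closedBall (0 : E) 1 := fun y hy => by simpa using hy
  refine ⟨G ∘ ρ, (hGc.comp hρc).continuousOn, ⟨?_, ?_, ?_⟩, ?_⟩
  · intro z hz
    rcases hrep z hz with h | ⟨u, t, hu, ht, htφ, hρz, -⟩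
    · rw [Function.comp_apply, hG1 _ h]
      exact Or.inl (hg.bijOn.mapsTo (hball _ h))
    · rw [Function.comp_apply, hρz, hG2 u hu t ht.le]
      exact Or.inr (hφmem u hu t ht htφ).2.2.2
  · have key : ∀ y : E, ‖y‖ ≤ 1 → ∀ u t, ‖u‖ = 1 → 0 < t → t ≤ φ u → g y ≠ g u + t • w := by
      intro y hy u t hu ht htφ heq
      obtain ⟨h1, -, h3, h4⟩ := hφmem u hu t ht htφ
      have h5 := (hB _ h4).1 (heq ▸ hg.bijOn.mapsTo (hball _ hy))
      rw [ha] at h5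
      linarith
    intro z hz z' hz' heq
    apply hρinj
    simp only [Function.comp_apply] at heq
    rcases hrep z hz with h | ⟨u, t, hu, ht, htφ, hρz, -⟩ <;>
      rcases hrep z' hz' with h' | ⟨u', t', hu', ht', htφ', hρz', -⟩
    · rw [hG1 _ h, hG1 _ h'] at heq
      exact hg.bijOn.injOn (hball _ h) (hball _ h') heq
    · rw [hG1 _ h, hρz', hG2 u' hu' t' ht'.le] at heq
      exact absurd heq (key _ h _ _ hu' ht' htφ')
    · rw [hG1 _ h', hρz, hG2 u hu t ht.le] at heq
      exact absurd heq.symm (key _ h' _ _ hu ht htφ)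
    · rw [hρz, hρz', hG2 u hu t ht.le, hG2 u' hu' t' ht'.le] at heq
      have h1 := congrArg a heq
      rw [ha, ha, (hφmem u hu t ht htφ).2.2.1, (hφmem u' hu' t' ht' htφ').2.2.1] at h1
      have h2 : t = t' := by linarith
      subst h2
      rw [hρz, hρz', hg.bijOn.injOn (hball _ hu.le) (hball _ hu'.le) (add_right_cancel heq)]
  · have hBs : ∀ x ∈ B, ∃ z ∈ closedBall (0 : E) 1, (G ∘ ρ) z = x := by
      intro x hx
      obtain ⟨y, hy, rfl⟩ := hg.bijOn.surjOn hx
      have hy' : ‖y‖ ≤ 1 := by simpa using hy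
      by_cases h0 : y = 0
      · refine ⟨0, by simp, ?_⟩
        rw [Function.comp_apply, hρ0, hG1 _ (by simp), h0]
      · obtain ⟨s, hs, u, hu, rfl⟩ := exists_polar h0
        rw [norm_polar hs.le hu] at hy'
        have h1 : 0 ≤ s / (1 + φ u) := div_nonneg hs.le (hpos u).le
        refine ⟨(s / (1 + φ u)) • u, ?_, ?_⟩
        · rw [mem_closedBall_zero_iff, norm_polar h1 hu, div_le_one (hpos u)]
          linarith [hφ0 u]
        · rw [Function.comp_apply, hρs h1 hu, div_mul_cancel₀ _ (hpos u).ne', hG1]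
          rwa [norm_polar hs.le hu]
    rintro x (hx | hx)
    · exact hBs x hx
    · by_cases hax : a x = 0
      · exact hBs x ((hB x hx).2 hax)
      · have hax0 := ha0 x hx
        have hy : x + (-a x) • w ∈ σ := hline x hx _ le_rfl (by linarith [hf0 x hx])
        have hyB : x + (-a x) • w ∈ B := (hB _ hy).2 (by rw [ha]; ring)
        obtain ⟨u, hub, hgu⟩ := hg.bijOn.surjOn hyB
        have hu : ‖u‖ = 1 := by
          rw [hg.norm_eq_one_iff u hub, hgu]
          exact hBD _ hyB hy
        have hφu : φ u = f x + a x := by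
          simp only [φ, hgu, hy, if_true]
          rw [hf]
          ring
        have h1 : 0 ≤ (1 + a x) / (1 + φ u) := div_nonneg (by linarith) (hpos u).le
        refine ⟨((1 + a x) / (1 + φ u)) • u, ?_, ?_⟩
        · rw [mem_closedBall_zero_iff, norm_polar h1 hu, div_le_one (hpos u)]
          linarith [hf0 x hx]
        · rw [Function.comp_apply, hρs h1 hu, div_mul_cancel₀ _ (hpos u).ne', hG2 u hu _ hax0, hgu]
          simp
  · intro z hz
    rcases hrep z hz with h | ⟨u, t, hu, ht, htφ, hρz, hz'⟩
    · rw [Function.comp_apply, hG1 _ h]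
      have hgB := hg.bijOn.mapsTo (hball _ h)
      rw [hD' _ (Or.inl hgB)]
      have hn := hg.norm_eq_one_iff _ (hball _ h)
      by_cases h0 : z = 0
      · subst h0
        rw [hρ0] at hn hgB ⊢
        simp only [norm_zero, zero_ne_one, false_iff] at hn ⊢
        rintro (h1 | h1)
        · exact hn (hBD _ hgB h1.1)
        · exact hn h1.2
      · obtain ⟨s, hs, u, hu, rfl⟩ := exists_polar h0
        have hsφ := mul_pos hs (hpos u)
        rw [hρs hs.le hu] at hn hgB h ⊢
        rw [norm_polar hsφ.le hu] at hn h
        rw [norm_polar hs.le hu]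
        by_cases hgσ : g ((s * (1 + φ u)) • u) ∈ σ
        · simp only [hgσ, true_and, not_true, false_and, or_false]
          have h1 := hn.2 (hBD _ hgB hgσ)
          rw [h1, one_smul] at hgσ ⊢
          have h2 : φ u = f (g u) := by simp only [φ, hgσ, if_true]
          rw [← h2]
          constructor
          · rintro rfl
            linarith
          · intro h3
            rwa [h3, add_zero, mul_one] at h1
        · simp only [hgσ, false_and, not_false_eq_true, true_and, false_or]
          rw [← hn]
          constructor
          · rintro rfl
            linarith [hφ0 u]
          · intro h1
            rw [h1, one_smul] at hgσ
            have h2 : φ u = 0 := by simp only [φ, hgσ, if_false]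
            rwa [h2, add_zero, mul_one] at h1
    · obtain ⟨h1, h2, h3, h4⟩ := hφmem u hu t ht htφ
      rw [Function.comp_apply, hρz, hG2 u hu t ht.le, hD' _ (Or.inr h4), hz',
        norm_polar (div_nonneg (by linarith) (hpos u).le) hu, div_eq_one_iff_eq (hpos u).ne', hf,
        h2]
      simp only [h4, true_and, not_true, false_and, or_false]
      constructor <;> intro h <;> linarith

/-- A simplex with `n + 1` vertices is a ball of dimension `n`. -/
theorem exists_simplex_param {V : Type*} [Fintype V] {n : ℕ} (σ : Finset V)
    (hσ : σ.card = n + 1) :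
    ∃ b : EuclideanSpace ℝ (Fin n) → V → ℝ,
      IsBallParam b {x | x ∈ stdSimplex ℝ V ∧ ∀ v ∉ σ, x v = 0} {x | ∃ v ∈ σ, x v = 0} := by
  classical
  let e : σ ≃ Fin (n + 1) := σ.equivFinOfCardEq hσ
  let L : EuclideanSpace ℝ (Fin n) → Fin (n + 1) → ℝ := fun y => Fin.cons (-∑ i, y i) (fun i => y i)
  have hL0 : ∀ y, L y 0 = -∑ i, y i := fun y => rfl
  have hLs : ∀ y i, L y (Fin.succ i) = y i := fun y i => rfl
  have hLsum : ∀ y, ∑ i, L y i = 0 := by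
    intro y
    simp [Fin.sum_univ_succ, hL0, hLs]
  have hLsmul : ∀ (c : ℝ) y i, L (c • y) i = c * L y i := by
    intro c y i
    refine Fin.cases ?_ (fun i => ?_) i
    · simp [hL0, Finset.mul_sum]
    · simp [hLs]
  have hLc : ∀ i, Continuous fun y => L y i := by
    intro i
    refine Fin.cases ?_ (fun i => ?_) i
    · simp only [hL0]
      fun_prop
    · simp only [hLs]
      fun_prop
  have hLinj : ∀ y y', (∀ i, L y i = L y' i) → y = y' := by
    intro y y' h
    ext i
    exact h i.succ
  have hne : (Finset.univ : Finset (Fin (n + 1))).Nonempty := Finset.univ_nonempty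
  let m : EuclideanSpace ℝ (Fin n) → ℝ := fun y => (n + 1) * Finset.univ.sup' hne (fun i => -L y i)
  have hn1 : (0 : ℝ) < n + 1 := by positivity
  have hmle : ∀ y (c : ℝ), m y ≤ c ↔ ∀ i, -(c / (n + 1)) ≤ L y i := by
    intro y c
    simp only [m]
    rw [mul_comm, ← le_div_iff₀ hn1, Finset.sup'_le_iff]
    simp only [Finset.mem_univ, true_implies]
    exact forall_congr' fun i => neg_le
  have hmex : ∀ y, ∃ i, L y i = -(m y / (n + 1)) := by
    intro y
    obtain ⟨i, -, hi⟩ := Finset.exists_mem_eq_sup' hne (fun i => -L y i)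
    refine ⟨i, ?_⟩
    simp only [m, hi]
    field_simp
  have hmpos : ∀ y, y ≠ 0 → 0 < m y := by
    intro y hy
    by_contra h
    push Not at h
    apply hy
    have h1 := (hmle y 0).1 h
    simp only [zero_div, neg_zero] at h1
    have h2 := (Finset.sum_eq_zero_iff_of_nonneg (fun i _ => h1 i)).1 (hLsum y)
    apply hLinj
    intro i
    rw [h2 i (Finset.mem_univ i)]
    have := hLsmul 0 0 i
    simpa using this.symm
  have hmc : Continuous m := by
    refine continuous_const.mul ?_
    exact Continuous.finset_sup'_apply hne fun i _ => (hLc i).neg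
  have hmsmul : ∀ (c : ℝ) y, 0 ≤ c → m (c • y) = c * m y := by
    intro c y hc
    apply le_antisymm
    · rw [hmle]
      intro i
      rw [hLsmul, mul_div_assoc, ← mul_neg]
      exact mul_le_mul_of_nonneg_left ((hmle y _).1 le_rfl i) hc
    · obtain ⟨i, hi⟩ := hmex y
      have h := (hmle (c • y) _).1 le_rfl i
      rw [hLsmul, hi, mul_neg, neg_le_neg_iff, ← mul_div_assoc,
        div_le_div_iff_of_pos_right hn1] at h
      exact h
  set ρ : EuclideanSpace ℝ (Fin n) → EuclideanSpace ℝ (Fin n) :=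
    radialExt (fun u => (m u)⁻¹ • u) with hρ
  have hu0 : ∀ u : EuclideanSpace ℝ (Fin n), ‖u‖ = 1 → u ≠ 0 := by
    rintro u hu rfl
    simp at hu
  have hρs : ∀ {s : ℝ} (_ : 0 ≤ s) {u : EuclideanSpace ℝ (Fin n)} (_ : ‖u‖ = 1),
      ρ (s • u) = (s * (m u)⁻¹) • u := by
    intro s hs u hu
    rw [hρ, radialExt_smul _ hs hu, smul_smul]
  have hρ0 : ρ 0 = 0 := radialExt_zero _
  have hρc : Continuous ρ := by
    apply continuous_radialExt
    refine ContinuousOn.smul (hmc.continuousOn.inv₀ ?_) continuousOn_id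
    intro u hu
    exact (hmpos u (hu0 u (by simpa using hu))).ne'
  have hm0 : m 0 = 0 := by simpa using hmsmul 0 0 le_rfl
  have hmρ : ∀ z, m (ρ z) = ‖z‖ := by
    intro z
    by_cases h0 : z = 0
    · rw [h0, hρ0, hm0, norm_zero]
    · obtain ⟨s, hs, u, hu, rfl⟩ := exists_polar h0
      have := hmpos u (hu0 u hu)
      rw [hρs hs.le hu, hmsmul _ _ (by positivity), norm_polar hs.le hu]
      field_simp
  have hρinj : Function.Injective ρ := by
    intro z z' h
    have hn : ‖z‖ = ‖z'‖ := by rw [← hmρ, h, hmρ]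
    by_cases hz : z = 0
    · rw [hz, norm_zero] at hn
      rw [hz, norm_eq_zero.1 hn.symm]
    · have hz' : z' ≠ 0 := by
        rintro rfl
        rw [norm_zero] at hn
        exact hz (norm_eq_zero.1 hn)
      obtain ⟨s, hs, u, hu, rfl⟩ := exists_polar hz
      obtain ⟨s', hs', u', hu', rfl⟩ := exists_polar hz'
      rw [norm_polar hs.le hu, norm_polar hs'.le hu'] at hn
      rw [hρs hs.le hu, hρs hs'.le hu'] at h
      obtain ⟨-, rfl⟩ := polar_unique (mul_pos hs (inv_pos.2 (hmpos u (hu0 u hu))))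
        (mul_pos hs' (inv_pos.2 (hmpos u' (hu0 u' hu')))) hu hu' h
      rw [hn]
  have hρsurj : Function.Surjective ρ := by
    intro y
    by_cases hy : y = 0
    · exact ⟨0, by rw [hρ0, hy]⟩
    · obtain ⟨s, hs, u, hu, rfl⟩ := exists_polar hy
      have := hmpos u (hu0 u hu)
      refine ⟨(s * m u) • u, ?_⟩
      rw [hρs (by positivity) hu, mul_inv_cancel_right₀ this.ne']
  let c : ℝ := 1 / (n + 1)
  let b : EuclideanSpace ℝ (Fin n) → V → ℝ := fun z v =>
    if h : v ∈ σ then c + L (ρ z) (e ⟨v, h⟩) else 0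
  have hb1 : ∀ z (i : Fin (n + 1)), b z (e.symm i) = c + L (ρ z) i := by
    intro z i
    simp [b]
  have hb0 : ∀ z, ∀ v ∉ σ, b z v = 0 := by
    intro z v hv
    simp [b, hv]
  have hsum : ∀ x : V → ℝ, (∀ v ∉ σ, x v = 0) → ∑ v, x v = ∑ i, x (e.symm i) := by
    intro x hx
    rw [← Finset.sum_subset (Finset.subset_univ σ) (fun v _ hv => hx v hv),
      ← Finset.sum_coe_sort σ x]
    exact (Equiv.sum_comp e.symm (fun v : σ => x v)).symm
  have hforall : ∀ P : V → Prop, (∀ v ∈ σ, P v) ↔ ∀ i, P (e.symm i) := by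
    intro P
    constructor
    · exact fun h i => h _ (e.symm i).2
    · intro h v hv
      simpa using h (e ⟨v, hv⟩)
  have hcsum : ∑ _i : Fin (n + 1), c = 1 := by
    simp only [c, Finset.sum_const, Finset.card_univ, Fintype.card_fin, nsmul_eq_mul]
    push_cast
    field_simp
  have hnn : ∀ z, ‖z‖ ≤ 1 ↔ ∀ i, 0 ≤ c + L (ρ z) i := by
    intro z
    rw [← hmρ, hmle]
    exact forall_congr' fun i => by
      simp only [c]
      constructor <;> intro h <;> linarith
  refine ⟨b, ?_, ⟨?_, ?_, ?_⟩, ?_⟩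
  · refine (continuous_pi fun v => ?_).continuousOn
    by_cases h : v ∈ σ
    · simp only [b, h, dif_pos]
      exact continuous_const.add ((hLc _).comp hρc)
    · simp only [b, h, dif_neg, not_false_eq_true]
      exact continuous_const
  · intro z hz
    refine ⟨⟨?_, ?_⟩, hb0 z⟩
    · intro v
      by_cases h : v ∈ σ
      · revert v
        rw [hforall]
        intro i
        rw [hb1]
        exact (hnn z).1 (by simpa using hz) i
      · rw [hb0 z v h]
    · rw [hsum _ (hb0 z)]
      simp only [hb1, Finset.sum_add_distrib, hLsum, add_zero]
      exact hcsum
  · intro z _ z' _ h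
    apply hρinj
    apply hLinj
    intro i
    have := congrFun h (e.symm i)
    rw [hb1, hb1] at this
    linarith
  · rintro x ⟨⟨hx0, hx1⟩, hxσ⟩
    obtain ⟨z, hz⟩ := hρsurj (WithLp.toLp 2 fun i => x (e.symm i.succ) - c)
    rw [hsum x hxσ, Fin.sum_univ_succ] at hx1
    have hcs := hcsum
    rw [Fin.sum_univ_succ] at hcs
    have hbz : ∀ i, c + L (ρ z) i = x (e.symm i) := by
      intro i
      rw [hz]
      refine Fin.cases ?_ (fun i => ?_) i
      · rw [hL0]
        simp only [Finset.sum_sub_distrib]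
        linarith
      · rw [hLs]
        simp
    refine ⟨z, ?_, ?_⟩
    · rw [mem_closedBall_zero_iff, hnn]
      intro i
      rw [hbz]
      exact hx0 _
    · ext v
      by_cases h : v ∈ σ
      · revert v
        rw [hforall]
        intro i
        rw [hb1, hbz]
      · rw [hb0 z v h, hxσ v h]
  · intro z hz
    have hz1 : ‖z‖ ≤ 1 := by simpa using hz
    have h1 : (∃ v ∈ σ, b z v = 0) ↔ ∃ i, c + L (ρ z) i = 0 := by
      constructor
      · rintro ⟨v, hv, h⟩
        refine ⟨e ⟨v, hv⟩, ?_⟩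
        rw [← hb1]
        simpa using h
      · rintro ⟨i, hi⟩
        exact ⟨e.symm i, (e.symm i).2, by rw [hb1, hi]⟩
    change _ ↔ ∃ v ∈ σ, b z v = 0
    rw [h1, ← hmρ]
    constructor
    · intro h
      obtain ⟨i, hi⟩ := hmex (ρ z)
      refine ⟨i, ?_⟩
      rw [hi, h]
      simp only [c]
      ring
    · rintro ⟨i, hi⟩
      apply le_antisymm
      · rwa [hmρ]
      · have h2 := (hmle (ρ z) _).1 le_rfl i
        have h3 : L (ρ z) i = -(1 / (n + 1)) := by
          simp only [c] at hi
          linarith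
        rwa [h3, neg_le_neg_iff, div_le_div_iff_of_pos_right hn1] at h2

end Topology

section Shelling

variable {V : Type*}

/-- `c 0, …, c (t - 1)` is a shelling of a simplicial complex of dimension `n` in which every
ridge lies in exactly two facets. -/
structure IsThinShelling [DecidableEq V] (c : ℕ → Finset V) (t n : ℕ) : Prop where
  card : ∀ i < t, (c i).card = n + 1
  exists_adj : ∀ i < t, ∀ v ∈ c i, ∃ k < t, k ≠ i ∧ (c i).erase v ⊆ c k
  adj_unique : ∀ i < t, ∀ v ∈ c i, ∀ j < t, ∀ k < t, j ≠ i → k ≠ i →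
    (c i).erase v ⊆ c j → (c i).erase v ⊆ c k → j = k
  shell : ∀ j < t, ∀ i < j, ∃ k < j, ∃ v ∈ c j, v ∉ c i ∧ (c j).erase v ⊆ c k

variable [DecidableEq V] {c : ℕ → Finset V} {t n : ℕ}

/-- A set obtained from the simplex `c j` by deleting the vertex `v` lies in an earlier facet. -/
def OldRidge (c : ℕ → Finset V) (j : ℕ) (v : V) : Prop := ∃ k < j, (c j).erase v ⊆ c k

theorem Finset.exists_erase_eq_of_card {s ρ : Finset V} (h : ρ ⊆ s) (hc : s.card = ρ.card + 1) :
    ∃ v ∈ s, v ∉ ρ ∧ ρ = s.erase v := by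
  obtain ⟨v, hv, hvρ⟩ := Finset.exists_mem_notMem_of_card_lt_card (s := ρ) (t := s) (by omega)
  refine ⟨v, hv, hvρ, Finset.eq_of_subset_of_card_le ?_ ?_⟩
  · intro x hx
    refine Finset.mem_erase.2 ⟨?_, h hx⟩
    rintro rfl
    exact hvρ hx
  · rw [Finset.card_erase_of_mem hv]
    omega

namespace IsThinShelling

theorem subset_old_iff (h : IsThinShelling c t n) {j : ℕ} (hj : j < t) {G : Finset V}
    (hG : G ⊆ c j) : (∃ i < j, G ⊆ c i) ↔ ∃ v ∈ c j, OldRidge c j v ∧ v ∉ G := by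
  constructor
  · rintro ⟨i, hi, hGi⟩
    obtain ⟨k, hk, v, hv, hvi, hvk⟩ := h.shell j hj i hi
    exact ⟨v, hv, ⟨k, hk, hvk⟩, fun hvG => hvi (hGi hvG)⟩
  · rintro ⟨v, hv, ⟨k, hk, hvk⟩, hvG⟩
    refine ⟨k, hk, fun x hx => hvk (Finset.mem_erase.2 ⟨?_, hG hx⟩)⟩
    rintro rfl
    exact hvG hx

/-- In the star of a face `F` of a shellable complex, every mod 2 cycle of codimension one is a
boundary. -/
theorem exists_chain_of_cycle [Fintype V] (h : IsThinShelling c t n) (F : Finset V) (j : ℕ)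
    (hj : j ≤ t) (a : Finset V → ZMod 2)
    (hsupp : ∀ ρ, a ρ ≠ 0 → ρ.card = n ∧ F ⊆ ρ ∧ ∃ i < j, ρ ⊆ c i)
    (hcyc : ∀ τ : Finset V, τ.card + 1 = n → F ⊆ τ → ∑ x ∈ τᶜ, a (insert x τ) = 0) :
    ∃ z : ℕ → ZMod 2, ∀ ρ : Finset V, ρ.card = n → F ⊆ ρ →
      a ρ = ∑ i ∈ Finset.range j, if ρ ⊆ c i then z i else 0 := by
  induction j generalizing a with
  | zero =>
    refine ⟨0, fun ρ _ _ => ?_⟩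
    by_contra hne
    obtain ⟨-, -, i, hi, -⟩ := hsupp ρ (by simpa using hne)
    omega
  | succ j ih =>
    have hjt : j < t := by omega
    have hnew : ∀ v ∈ c j, ¬ OldRidge c j v → v ∉ F → ∀ w ∈ c j, ¬ OldRidge c j w → w ∉ F →
        a ((c j).erase v) = a ((c j).erase w) := by
      intro v hv hvo hvF w hw hwo hwF
      by_cases hvw : v = w
      · rw [hvw]
      by_cases hFc : F ⊆ c j
      swap
      · have h0 : ∀ u, a ((c j).erase u) = 0 := by
          intro u
          by_contra hne
          exact hFc ((hsupp _ hne).2.1.trans (Finset.erase_subset _ _))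
        rw [h0, h0]
      have hwv : w ∈ (c j).erase v := Finset.mem_erase.2 ⟨Ne.symm hvw, hw⟩
      set τ := ((c j).erase v).erase w with hτ
      have hiw : insert w τ = (c j).erase v := Finset.insert_erase hwv
      have hiv : insert v τ = (c j).erase w := by
        rw [hτ, Finset.erase_right_comm]
        exact Finset.insert_erase (Finset.mem_erase.2 ⟨hvw, hv⟩)
      have hτc : τ.card + 1 = n := by
        have h1 := h.card j hjt
        have h2 := Finset.card_erase_add_one hwv
        have h3 := Finset.card_erase_add_one hv
        rw [← hτ] at h2
        omega
      have hτF : F ⊆ τ := by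
        intro x hx
        rw [hτ, Finset.mem_erase, Finset.mem_erase]
        exact ⟨fun e => hwF (e ▸ hx), fun e => hvF (e ▸ hx), hFc hx⟩
      have hsum := hcyc τ hτc hτF
      have hpair : ∑ x ∈ ({v, w} : Finset V), a (insert x τ) = ∑ x ∈ τᶜ, a (insert x τ) := by
        apply Finset.sum_subset
        · intro x hx
          rw [Finset.mem_insert, Finset.mem_singleton] at hx
          rw [Finset.mem_compl, hτ, Finset.mem_erase, Finset.mem_erase]
          tauto
        · intro x hx hx'
          rw [Finset.mem_insert, Finset.mem_singleton] at hx'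
          by_contra hne
          obtain ⟨-, -, i, hi, hsub⟩ := hsupp _ hne
          have hxj : x ∉ c j := by
            intro hxj
            rw [Finset.mem_compl, hτ, Finset.mem_erase, Finset.mem_erase] at hx
            tauto
          have hij : i ≠ j := by
            rintro rfl
            exact hxj (hsub (Finset.mem_insert_self _ _))
          have hτj : τ ⊆ c j := (Finset.erase_subset _ _).trans (Finset.erase_subset _ _)
          obtain ⟨u, hu, huo, huτ⟩ := (h.subset_old_iff hjt hτj).1
            ⟨i, by omega, (Finset.subset_insert _ _).trans hsub⟩
          rw [hτ, Finset.mem_erase, Finset.mem_erase] at huτ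
          by_cases huv : u = v
          · exact hvo (huv ▸ huo)
          · by_cases huw : u = w
            · exact hwo (huw ▸ huo)
            · tauto
      rw [← hpair, Finset.sum_pair hvw, hiv, hiw] at hsum
      exact (CharTwo.add_eq_zero.1 hsum).symm
    obtain ⟨ε, hε⟩ : ∃ ε, ∀ v ∈ c j, ¬ OldRidge c j v → v ∉ F → a ((c j).erase v) = ε := by
      by_cases hex : ∃ v ∈ c j, ¬ OldRidge c j v ∧ v ∉ F
      · obtain ⟨w, hw, hwo, hwF⟩ := hex
        exact ⟨_, fun v hv hvo hvF => hnew v hv hvo hvF w hw hwo hwF⟩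
      · exact ⟨0, fun v hv hvo hvF => absurd ⟨v, hv, hvo, hvF⟩ hex⟩
    let a' : Finset V → ZMod 2 := fun ρ =>
      a ρ - if ρ.card = n ∧ F ⊆ ρ ∧ ρ ⊆ c j then ε else 0
    have hsupp' : ∀ ρ, a' ρ ≠ 0 → ρ.card = n ∧ F ⊆ ρ ∧ ∃ i < j, ρ ⊆ c i := by
      intro ρ hρ
      by_cases hP : ρ.card = n ∧ F ⊆ ρ ∧ ρ ⊆ c j
      · refine ⟨hP.1, hP.2.1, ?_⟩
        obtain ⟨v, hv, hvρ, hρv⟩ := Finset.exists_erase_eq_of_card hP.2.2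
          (by rw [h.card j hjt, hP.1])
        by_contra hno
        apply hρ
        simp only [a', hP, and_true, if_true]
        have hvo : ¬ OldRidge c j v := by
          rintro ⟨k, hk, hvk⟩
          exact hno ⟨k, hk, hρv ▸ hvk⟩
        have := hε v hv hvo (fun hvF => hvρ (hP.2.1 hvF))
        rw [← hρv] at this
        rw [this]
        simp
      · simp only [a', hP, if_false, sub_zero] at hρ
        obtain ⟨h1, h2, i, hi, h3⟩ := hsupp ρ hρ
        refine ⟨h1, h2, i, ?_, h3⟩
        have : i ≠ j := by
          rintro rfl
          exact hP ⟨h1, h2, h3⟩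
        omega
    have hcyc' : ∀ τ : Finset V, τ.card + 1 = n → F ⊆ τ → ∑ x ∈ τᶜ, a' (insert x τ) = 0 := by
      intro τ hτ hF
      simp only [a']
      rw [Finset.sum_sub_distrib, hcyc τ hτ hF, zero_sub, neg_eq_zero]
      have h1 : ∀ x ∈ τᶜ, ((insert x τ).card = n ∧ F ⊆ insert x τ ∧ insert x τ ⊆ c j) ↔
          (τ ⊆ c j ∧ x ∈ c j) := by
        intro x hx
        rw [Finset.card_insert_of_notMem (Finset.mem_compl.1 hx), Finset.insert_subset_iff]
        have := hF.trans (Finset.subset_insert x τ)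
        tauto
      by_cases hτj : τ ⊆ c j
      · have h2 : ∑ x ∈ τᶜ, (if (insert x τ).card = n ∧ F ⊆ insert x τ ∧ insert x τ ⊆ c j
            then ε else 0) = ∑ x ∈ c j \ τ, ε := by
          rw [← Finset.sum_filter]
          refine Finset.sum_congr ?_ fun _ _ => rfl
          ext x
          rw [Finset.mem_filter, Finset.mem_sdiff]
          constructor
          · rintro ⟨hx, hx'⟩
            exact ⟨((h1 x hx).1 hx').2, Finset.mem_compl.1 hx⟩
          · rintro ⟨hx, hx'⟩
            exact ⟨Finset.mem_compl.2 hx', (h1 x (Finset.mem_compl.2 hx')).2 ⟨hτj, hx⟩⟩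
        have h3 : (c j \ τ).card = 2 := by
          rw [Finset.card_sdiff_of_subset hτj, h.card j hjt]
          omega
        rw [h2, Finset.sum_const, h3, two_nsmul, CharTwo.add_self_eq_zero]
      · refine Finset.sum_eq_zero fun x hx => ?_
        rw [if_neg]
        rw [h1 x hx]
        exact fun h' => hτj h'.1
    obtain ⟨z, hz⟩ := ih (by omega) a' hsupp' hcyc'
    refine ⟨Function.update z j ε, fun ρ hρ hF => ?_⟩
    have h1 := hz ρ hρ hF
    rw [Finset.sum_range_succ, Function.update_self]
    have h2 : ∑ i ∈ Finset.range j, (if ρ ⊆ c i then Function.update z j ε i else 0) =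
        ∑ i ∈ Finset.range j, if ρ ⊆ c i then z i else 0 := by
      refine Finset.sum_congr rfl fun i hi => ?_
      rw [Function.update_of_ne (Finset.mem_range.1 hi).ne]
    rw [h2, ← h1]
    simp only [a', hρ, hF, true_and, sub_add_cancel]

/-- If all the ridges of `c j` containing `F` lie in earlier facets, then `c j` is the last facet
containing `F`. -/
theorem not_subset_of_forall_old [Fintype V] (h : IsThinShelling c t n) {F : Finset V} {j : ℕ}
    (hj : j < t) (hF : F ⊆ c j) (hold : ∀ v ∈ c j, v ∉ F → OldRidge c j v) {k : ℕ} (hjk : j < k)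
    (hk : k < t) : ¬ F ⊆ c k := by
  intro hFk
  let a : Finset V → ZMod 2 := fun ρ => if ρ.card = n ∧ F ⊆ ρ ∧ ρ ⊆ c j then 1 else 0
  have hsupp : ∀ ρ, a ρ ≠ 0 → ρ.card = n ∧ F ⊆ ρ ∧ ∃ i < j, ρ ⊆ c i := by
    intro ρ hρ
    have hP : ρ.card = n ∧ F ⊆ ρ ∧ ρ ⊆ c j := by
      by_contra hP
      exact hρ (by simp only [a, hP, if_false])
    obtain ⟨v, hv, hvρ, hρv⟩ := Finset.exists_erase_eq_of_card hP.2.2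
      (by rw [h.card j hj, hP.1])
    obtain ⟨i, hi, hvi⟩ := hold v hv (fun hvF => hvρ (hP.2.1 hvF))
    exact ⟨hP.1, hP.2.1, i, hi, hρv ▸ hvi⟩
  have hcyc : ∀ τ : Finset V, τ.card + 1 = n → F ⊆ τ → ∑ x ∈ τᶜ, a (insert x τ) = 0 := by
    intro τ hτ hFτ
    have h1 : ∀ x ∈ τᶜ, ((insert x τ).card = n ∧ F ⊆ insert x τ ∧ insert x τ ⊆ c j) ↔
        (τ ⊆ c j ∧ x ∈ c j) := by
      intro x hx
      rw [Finset.card_insert_of_notMem (Finset.mem_compl.1 hx), Finset.insert_subset_iff]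
      have := hFτ.trans (Finset.subset_insert x τ)
      tauto
    by_cases hτj : τ ⊆ c j
    · have h2 : ∑ x ∈ τᶜ, a (insert x τ) = ∑ x ∈ c j \ τ, 1 := by
        simp only [a]
        rw [← Finset.sum_filter]
        refine Finset.sum_congr ?_ fun _ _ => rfl
        ext x
        rw [Finset.mem_filter, Finset.mem_sdiff]
        constructor
        · rintro ⟨hx, hx'⟩
          exact ⟨((h1 x hx).1 hx').2, Finset.mem_compl.1 hx⟩
        · rintro ⟨hx, hx'⟩
          exact ⟨Finset.mem_compl.2 hx', (h1 x (Finset.mem_compl.2 hx')).2 ⟨hτj, hx⟩⟩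
      have h3 : (c j \ τ).card = 2 := by
        rw [Finset.card_sdiff_of_subset hτj, h.card j hj]
        omega
      rw [h2, Finset.sum_const, h3, two_nsmul, CharTwo.add_self_eq_zero]
    · refine Finset.sum_eq_zero fun x hx => ?_
      simp only [a]
      rw [if_neg]
      rw [h1 x hx]
      exact fun h' => hτj h'.1
  obtain ⟨z, hz⟩ := h.exists_chain_of_cycle F j hj.le a hsupp hcyc
  let y : ℕ → ZMod 2 := fun i => if i < j then z i else if i = j then 1 else 0
  have hyj : y j = 1 := by simp [y]
  have hyk : y k = 0 := by
    simp only [y]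
    rw [if_neg (by omega), if_neg (by omega)]
  have hadj : ∀ i < t, ∀ k < t, i ≠ k → ∀ v ∈ c i, F ⊆ (c i).erase v → (c i).erase v ⊆ c k →
      y i = y k := by
    intro i hi k hk hik v hv hFv hvk
    have hcard : ((c i).erase v).card = n := by
      have h1 := h.card i hi
      have h2 := Finset.card_erase_add_one hv
      omega
    have h1 := hz _ hcard hFv
    have h2 : ∑ l ∈ Finset.range t, (if (c i).erase v ⊆ c l then y l else 0) = 0 := by
      rw [← Finset.sum_subset (Finset.range_subset_range.2 (Nat.succ_le_of_lt hj)),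
        Finset.sum_range_succ, hyj]
      · have h3 : ∑ l ∈ Finset.range j, (if (c i).erase v ⊆ c l then y l else 0) =
            ∑ l ∈ Finset.range j, if (c i).erase v ⊆ c l then z l else 0 := by
          refine Finset.sum_congr rfl fun l hl => ?_
          simp only [y, if_pos (Finset.mem_range.1 hl)]
        rw [h3, ← h1]
        simp only [a, hcard, hFv, true_and]
        exact CharTwo.add_self_eq_zero _
      · intro l _ hl
        rw [Finset.mem_range] at hl
        have hyl : y l = 0 := by
          simp only [y]
          rw [if_neg (by omega), if_neg (by omega)]
        rw [hyl, ite_self]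
    have h3 : ∑ l ∈ ({i, k} : Finset ℕ), (if (c i).erase v ⊆ c l then y l else 0) = 0 := by
      refine Eq.trans ?_ h2
      apply Finset.sum_subset
      · intro x hx
        rw [Finset.mem_insert, Finset.mem_singleton] at hx
        rw [Finset.mem_range]
        rcases hx with rfl | rfl <;> assumption
      · intro l hl hl'
        rw [Finset.mem_insert, Finset.mem_singleton] at hl'
        push Not at hl'
        rw [if_neg]
        intro hsub
        exact hl'.2 (h.adj_unique i hi v hv l (Finset.mem_range.1 hl) k hk hl'.1 (Ne.symm hik)
          hsub hvk)
    rw [Finset.sum_pair hik, if_pos (Finset.erase_subset _ _), if_pos hvk] at h3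
    exact CharTwo.add_eq_zero.1 h3
  have hex : ∃ i, i < t ∧ F ⊆ c i := ⟨j, hj, hF⟩
  classical
  have hconst : ∀ k, k < t → F ⊆ c k → y k = y (Nat.find hex) := by
    intro k
    induction k using Nat.strong_induction_on with
    | _ k ih =>
      intro hk hFk
      rcases (Nat.find_min' hex ⟨hk, hFk⟩).eq_or_lt with heq | hlt
      · rw [heq]
      · obtain ⟨l, hl, v, hv, hvi, hvl⟩ := h.shell k hk _ hlt
        have hFv : F ⊆ (c k).erase v := by
          intro x hx
          refine Finset.mem_erase.2 ⟨?_, hFk hx⟩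
          rintro rfl
          exact hvi ((Nat.find_spec hex).2 hx)
        rw [hadj k hk l (by omega) (by omega) v hv hFv hvl]
        exact ih l hl (by omega) (hFv.trans hvl)
  have := (hconst j hj hF).trans (hconst k hk hFk).symm
  rw [hyj, hyk] at this
  exact one_ne_zero this

end IsThinShelling

/-- The cardinality of `s` times the least value of `x` on `s`. -/
noncomputable def scaledMin (s : Finset V) (hs : s.Nonempty) (x : V → ℝ) : ℝ :=
  s.card * s.inf' hs x

omit [DecidableEq V] in
theorem le_scaledMin_iff {s : Finset V} (hs : s.Nonempty) {x : V → ℝ} {r : ℝ} :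
    r ≤ scaledMin s hs x ↔ ∀ v ∈ s, r / s.card ≤ x v := by
  have : (0 : ℝ) < s.card := by exact_mod_cast hs.card_pos
  rw [scaledMin, mul_comm, ← div_le_iff₀ this, Finset.le_inf'_iff]

omit [DecidableEq V] in
theorem scaledMin_add {s : Finset V} (hs : s.Nonempty) {x y : V → ℝ} {r : ℝ}
    (h : ∀ v ∈ s, y v = x v + r / s.card) : scaledMin s hs y = scaledMin s hs x + r := by
  refine eq_of_forall_le_iff fun d => ?_
  rw [← sub_le_iff_le_add, le_scaledMin_iff, le_scaledMin_iff]
  refine forall₂_congr fun v hv => ?_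
  rw [h v hv, sub_div, sub_le_iff_le_add]

omit [DecidableEq V] in
theorem scaledMin_eq_zero_iff {s : Finset V} (hs : s.Nonempty) {x : V → ℝ} (hx : ∀ v, 0 ≤ x v) :
    scaledMin s hs x = 0 ↔ ∃ v ∈ s, x v = 0 := by
  have hc : (s.card : ℝ) ≠ 0 := by exact_mod_cast hs.card_pos.ne'
  constructor
  · intro h
    obtain ⟨v, hv, h'⟩ := Finset.exists_mem_eq_inf' hs x
    rw [scaledMin, h'] at h
    exact ⟨v, hv, (mul_eq_zero.1 h).resolve_left hc⟩
  · rintro ⟨v, hv, h⟩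
    apply le_antisymm
    · have := (le_scaledMin_iff hs (x := x) (r := scaledMin s hs x)).1 le_rfl v hv
      rw [h] at this
      by_contra hlt
      push Not at hlt
      have : 0 < scaledMin s hs x / s.card := div_pos hlt (by exact_mod_cast hs.card_pos)
      linarith
    · rw [le_scaledMin_iff]
      intro v _
      rw [zero_div]
      exact hx v

omit [DecidableEq V] in
theorem continuous_scaledMin {s : Finset V} (hs : s.Nonempty) : Continuous (scaledMin s hs) :=
  continuous_const.mul (Continuous.finset_inf'_apply hs fun i _ => continuous_apply i)

variable [Fintype V]

/-- The geometric realization of the simplex with vertex set `s`. -/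
def realizedSimplex (s : Finset V) : Set (V → ℝ) := {x | x ∈ stdSimplex ℝ V ∧ ∀ v ∉ s, x v = 0}

/-- The geometric realization of the complex generated by the first `j` facets. -/
def initialComplex (c : ℕ → Finset V) (j : ℕ) : Set (V → ℝ) :=
  {x | ∃ i < j, x ∈ realizedSimplex (c i)}

/-- The union of the ridges lying in exactly one of the first `j` facets. -/
def initialBoundary (c : ℕ → Finset V) (j : ℕ) : Set (V → ℝ) :=
  {x | ∃ i < j, ∃ v ∈ c i, x ∈ realizedSimplex ((c i).erase v) ∧
    ∀ k < j, k ≠ i → ¬ (c i).erase v ⊆ c k}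

omit [DecidableEq V] in
theorem isClosed_realizedSimplex (s : Finset V) : IsClosed (realizedSimplex s) := by
  have : realizedSimplex s = stdSimplex ℝ V ∩ ⋂ v ∈ (s : Set V)ᶜ, {x | x v = 0} := by
    ext x
    simp [realizedSimplex]
  rw [this]
  refine (isClosed_stdSimplex ℝ V).inter (isClosed_biInter fun v _ => ?_)
  exact isClosed_eq (continuous_apply v) continuous_const

omit [DecidableEq V] in
theorem realizedSimplex_mono {s s' : Finset V} (h : s ⊆ s') :
    realizedSimplex s ⊆ realizedSimplex s' :=
  fun _ hx => ⟨hx.1, fun v hv => hx.2 v fun hv' => hv (h hv')⟩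

theorem mem_realizedSimplex_erase {s : Finset V} {v : V} {x : V → ℝ} :
    x ∈ realizedSimplex (s.erase v) ↔ x ∈ realizedSimplex s ∧ x v = 0 := by
  constructor
  · intro h
    exact ⟨realizedSimplex_mono (Finset.erase_subset _ _) h, h.2 v (Finset.notMem_erase v s)⟩
  · rintro ⟨h, hv⟩
    refine ⟨h.1, fun u hu => ?_⟩
    by_cases huv : u = v
    · rw [huv, hv]
    · exact h.2 u fun hus => hu (Finset.mem_erase.2 ⟨huv, hus⟩)

omit [DecidableEq V] in
theorem mem_realizedSimplex_iff {s : Finset V} {x : V → ℝ} :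
    x ∈ realizedSimplex s ↔ x ∈ stdSimplex ℝ V ∧ Finset.univ.filter (fun v => x v ≠ 0) ⊆ s := by
  refine and_congr_right fun _ => ?_
  simp only [Finset.subset_iff, Finset.mem_filter, Finset.mem_univ, true_and]
  exact forall_congr' fun v => ⟨fun h h' => by_contra fun h'' => h' (h h''),
    fun h h' => by_contra fun h'' => h' (h h'')⟩

theorem isClosed_initialBoundary (c : ℕ → Finset V) (j : ℕ) : IsClosed (initialBoundary c j) := by
  have : initialBoundary c j = ⋃ i ∈ Finset.range j, ⋃ v ∈ (c i).filter
      (fun v => ∀ k < j, k ≠ i → ¬ (c i).erase v ⊆ c k), realizedSimplex ((c i).erase v) := by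
    ext x
    simp only [initialBoundary, Set.mem_ofPred_eq, Set.mem_iUnion, Finset.mem_range,
      Finset.mem_filter, exists_prop]
    refine exists_congr fun i => and_congr_right fun _ => exists_congr fun v => ?_
    tauto
  rw [this]
  exact isClosed_biUnion_finset fun i _ => isClosed_biUnion_finset fun v _ =>
    isClosed_realizedSimplex _

omit [Fintype V] [DecidableEq V] in
theorem IsBallParam.congr {E T : Type*} [NormedAddCommGroup E] [NormedSpace ℝ E]
    [TopologicalSpace T] {g : E → T} {B B' D D' : Set T} (h : IsBallParam g B D) (hB : B = B')
    (hD : ∀ x ∈ B, x ∈ D ↔ x ∈ D') : IsBallParam g B' D' := by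
  subst hB
  exact ⟨h.continuousOn, h.bijOn, fun y hy => by
    rw [h.norm_eq_one_iff y hy, hD _ (h.bijOn.mapsTo hy)]⟩

namespace IsThinShelling

theorem mem_initialBoundary_of_old (h : IsThinShelling c t n) {j : ℕ} (hj : j < t) {v : V}
    (hv : v ∈ c j) (hvo : OldRidge c j v) {x : V → ℝ}
    (hx : x ∈ realizedSimplex ((c j).erase v)) : x ∈ initialBoundary c j := by
  obtain ⟨k, hk, hvk⟩ := hvo
  obtain ⟨u, hu, -, huv⟩ := Finset.exists_erase_eq_of_card hvk (by
    rw [h.card k (by omega), ← h.card j hj, Finset.card_erase_add_one hv])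
  refine ⟨k, hk, u, hu, huv ▸ hx, fun l hl hlk hsub => hlk ?_⟩
  rw [← huv] at hsub
  exact h.adj_unique j hj v hv l (by omega) k (by omega) (by omega) (by omega) hsub hvk

theorem mem_initialComplex_iff (h : IsThinShelling c t n) {j : ℕ} (hj : j < t) {x : V → ℝ}
    (hx : x ∈ realizedSimplex (c j)) :
    x ∈ initialComplex c j ↔ ∃ v ∈ c j, OldRidge c j v ∧ x v = 0 := by
  have h1 := mem_realizedSimplex_iff.1 hx
  have h2 := h.subset_old_iff hj h1.2
  simp only [Finset.mem_filter, Finset.mem_univ, true_and, not_not] at h2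
  rw [← h2]
  refine exists_congr fun i => and_congr_right fun _ => ?_
  rw [mem_realizedSimplex_iff]
  exact and_iff_right h1.1

theorem mem_initialBoundary_of_mem (h : IsThinShelling c t n) {j : ℕ} (hj : j < t) {x : V → ℝ}
    (hx : x ∈ realizedSimplex (c j)) (hx' : x ∈ initialComplex c j) : x ∈ initialBoundary c j := by
  obtain ⟨v, hv, hvo, hxv⟩ := (h.mem_initialComplex_iff hj hx).1 hx'
  exact h.mem_initialBoundary_of_old hj hv hvo (mem_realizedSimplex_erase.2 ⟨hx, hxv⟩)

theorem mem_initialBoundary_succ_iff (h : IsThinShelling c t n) {j : ℕ} (hj : j < t) (x : V → ℝ) :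
    x ∈ initialBoundary c (j + 1) ↔
      (x ∈ realizedSimplex (c j) ∧ ∃ v ∈ c j, ¬ OldRidge c j v ∧ x v = 0) ∨
      (x ∉ realizedSimplex (c j) ∧ x ∈ initialBoundary c j) := by
  constructor
  · rintro ⟨i, hi, v, hv, hx, hfree⟩
    rcases (Nat.lt_succ_iff.1 hi).eq_or_lt with rfl | hij
    · left
      rw [mem_realizedSimplex_erase] at hx
      refine ⟨hx.1, v, hv, ?_, hx.2⟩
      rintro ⟨k, hk, hvk⟩
      exact hfree k (by omega) (by omega) hvk
    · by_cases hxj : x ∈ realizedSimplex (c j)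
      · left
        refine ⟨hxj, ?_⟩
        by_contra hno
        obtain ⟨k, hk, hki, hvk⟩ := h.exists_adj i (by omega) v hv
        have hjk : j < k := by
          by_contra hle
          exact hfree k (by omega) hki hvk
        have h1 := mem_realizedSimplex_iff.1 hx
        refine h.not_subset_of_forall_old hj (mem_realizedSimplex_iff.1 hxj).2 ?_ hjk hk
          (h1.2.trans hvk)
        intro u hu huF
        by_contra hold
        exact hno ⟨u, hu, hold, by simpa using huF⟩
      · exact Or.inr ⟨hxj, i, hij, v, hv, hx, fun k hk => hfree k (by omega)⟩
  · rintro (⟨hx, v, hv, hnew, hxv⟩ | ⟨hx, i, hi, v, hv, hxi, hfree⟩)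
    · refine ⟨j, by omega, v, hv, mem_realizedSimplex_erase.2 ⟨hx, hxv⟩, ?_⟩
      intro k hk hkj hvk
      exact hnew ⟨k, by omega, hvk⟩
    · refine ⟨i, by omega, v, hv, hxi, fun k hk hki hvk => ?_⟩
      rcases (Nat.lt_succ_iff.1 hk).eq_or_lt with rfl | hkj
      · exact hx (realizedSimplex_mono hvk hxi)
      · exact hfree k hkj hki hvk

omit [DecidableEq V] in
theorem initialComplex_succ (c : ℕ → Finset V) (j : ℕ) :
    initialComplex c (j + 1) = initialComplex c j ∪ realizedSimplex (c j) := by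
  ext x
  simp only [initialComplex, Set.mem_union, Set.mem_ofPred_eq, Nat.lt_succ_iff_lt_or_eq]
  constructor
  · rintro ⟨i, hi | rfl, hx⟩
    · exact Or.inl ⟨i, hi, hx⟩
    · exact Or.inr hx
  · rintro (⟨i, hi, hx⟩ | hx)
    · exact ⟨i, Or.inl hi, hx⟩
    · exact ⟨j, Or.inr rfl, hx⟩

/-- Every proper initial part of a shelling is a ball. -/
theorem exists_ball_param (h : IsThinShelling c t n) (j : ℕ) (hj : j + 1 < t) :
    ∃ g : EuclideanSpace ℝ (Fin n) → V → ℝ,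
      IsBallParam g (initialComplex c (j + 1)) (initialBoundary c (j + 1)) := by
  classical
  induction j with
  | zero =>
    obtain ⟨b, hb⟩ := exists_simplex_param (c 0) (h.card 0 (by omega))
    refine ⟨b, hb.congr ?_ ?_⟩
    · ext x
      simp [initialComplex, realizedSimplex]
    · intro x hx
      constructor
      · rintro ⟨v, hv, hxv⟩
        exact ⟨0, by omega, v, hv, mem_realizedSimplex_erase.2 ⟨hx, hxv⟩,
          fun k hk hk0 => absurd hk (by omega)⟩
      · rintro ⟨i, hi, v, hv, hxv, -⟩
        obtain rfl : i = 0 := by omega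
        exact ⟨v, hv, (mem_realizedSimplex_erase.1 hxv).2⟩
  | succ j ih =>
    obtain ⟨g, hg⟩ := ih (by omega)
    generalize hl : j + 1 = l at *
    have hlt : l < t := by omega
    let R := (c l).filter (OldRidge c l)
    let R' := (c l).filter (fun v => ¬ OldRidge c l v)
    have hR : R.Nonempty := by
      obtain ⟨k, hk, v, hv, -, hvk⟩ := h.shell l hlt 0 (by omega)
      exact ⟨v, Finset.mem_filter.2 ⟨hv, k, hk, hvk⟩⟩
    have hR' : R'.Nonempty := by
      by_contra hne
      refine h.not_subset_of_forall_old hlt (Finset.empty_subset _) ?_ (Nat.lt_succ_self l) hj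
        (Finset.empty_subset _)
      intro v hv _
      by_contra hvo
      exact hne ⟨v, Finset.mem_filter.2 ⟨hv, hvo⟩⟩
    have hRc : (0 : ℝ) < R.card := by exact_mod_cast hR.card_pos
    have hRc' : (0 : ℝ) < R'.card := by exact_mod_cast hR'.card_pos
    let w : V → ℝ := fun v =>
      (if v ∈ R then 1 / (R.card : ℝ) else 0) - if v ∈ R' then 1 / (R'.card : ℝ) else 0
    have hdisj : ∀ v ∈ R, v ∉ R' := by
      intro v hv hv'
      exact (Finset.mem_filter.1 hv').2 (Finset.mem_filter.1 hv).2
    have hwR : ∀ v ∈ R, w v = 1 / (R.card : ℝ) := by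
      intro v hv
      simp only [w, hv, hdisj v hv, if_true, if_false, sub_zero]
    have hwR' : ∀ v ∈ R', w v = -(1 / (R'.card : ℝ)) := by
      intro v hv
      have : v ∉ R := fun hv' => hdisj v hv' hv
      simp only [w, hv, this, if_true, if_false, zero_sub]
    have hw0 : ∀ v, v ∉ R → v ∉ R' → w v = 0 := by
      intro v hv hv'
      simp only [w, hv, hv', if_false, sub_zero]
    have hwsum : ∑ v, w v = 0 := by
      simp only [w]
      rw [Finset.sum_sub_distrib, ← Finset.sum_filter, ← Finset.sum_filter]
      simp only [Finset.filter_mem_eq_inter, Finset.univ_inter, Finset.sum_const, nsmul_eq_mul]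
      field_simp
      ring
    have hnn : ∀ x ∈ realizedSimplex (c l), ∀ v, 0 ≤ x v := fun x hx => hx.1.1
    have hinter : ∀ x ∈ realizedSimplex (c l), x ∈ initialComplex c l ↔ scaledMin R hR x = 0 := by
      intro x hx
      rw [h.mem_initialComplex_iff hlt hx, scaledMin_eq_zero_iff hR (hnn x hx)]
      simp only [R, Finset.mem_filter, and_assoc]
    have hnew : ∀ x ∈ realizedSimplex (c l),
        scaledMin R' hR' x = 0 ↔ ∃ v ∈ c l, ¬ OldRidge c l v ∧ x v = 0 := by
      intro x hx
      rw [scaledMin_eq_zero_iff hR' (hnn x hx)]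
      simp only [R', Finset.mem_filter, and_assoc]
    rw [initialComplex_succ]
    refine hg.exists_glue (w := w) (a := scaledMin R hR) (f := scaledMin R' hR')
      (N := initialBoundary c (l + 1)) (isClosed_realizedSimplex _)
      (isClosed_initialBoundary _ _) ?_ ?_ (continuous_scaledMin hR') ?_ ?_ ?_ hinter ?_ ?_ ?_ ?_
    · intro x s
      refine scaledMin_add hR fun v hv => ?_
      rw [Pi.add_apply, Pi.smul_apply, hwR v hv, smul_eq_mul, mul_one_div]
    · intro x s
      rw [sub_eq_add_neg]
      refine scaledMin_add hR' fun v hv => ?_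
      rw [Pi.add_apply, Pi.smul_apply, hwR' v hv, smul_eq_mul, mul_neg, mul_one_div, neg_div]
    · intro x hx
      rw [le_scaledMin_iff]
      intro v _
      rw [zero_div]
      exact hnn x hx v
    · intro x hx
      rw [le_scaledMin_iff]
      intro v _
      rw [zero_div]
      exact hnn x hx v
    · intro x hx s hs hs'
      refine ⟨⟨fun v => ?_, ?_⟩, fun v hv => ?_⟩
      · rw [Pi.add_apply, Pi.smul_apply, smul_eq_mul]
        by_cases hv : v ∈ R
        · rw [hwR v hv, mul_one_div]
          have := (le_scaledMin_iff hR).1 (show -s ≤ scaledMin R hR x by linarith) v hv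
          rw [neg_div] at this
          linarith
        · by_cases hv' : v ∈ R'
          · rw [hwR' v hv', mul_neg, mul_one_div]
            have := (le_scaledMin_iff hR').1 hs' v hv'
            linarith
          · rw [hw0 v hv hv', mul_zero, add_zero]
            exact hnn x hx v
      · simp only [Pi.add_apply, Pi.smul_apply, smul_eq_mul]
        rw [Finset.sum_add_distrib, ← Finset.mul_sum, hwsum, mul_zero, add_zero]
        exact hx.1.2
      · rw [Pi.add_apply, Pi.smul_apply, hx.2 v hv, hw0, smul_zero, zero_add]
        · exact fun hv' => hv (Finset.mem_filter.1 hv').1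
        · exact fun hv' => hv (Finset.mem_filter.1 hv').1
    · exact fun x hx hxl => h.mem_initialBoundary_of_mem hlt hxl hx
    · intro x _ hxD
      by_cases hxl : x ∈ realizedSimplex (c l)
      · exact Or.inl hxl
      · exact Or.inr ((h.mem_initialBoundary_succ_iff hlt x).2 (Or.inr ⟨hxl, hxD⟩))
    · intro x _ hxl hxN
      rw [hnew x hxl]
      rcases (h.mem_initialBoundary_succ_iff hlt x).1 hxN with h1 | h1
      · exact h1.2
      · exact absurd hxl h1.1
    · intro x _
      rw [h.mem_initialBoundary_succ_iff hlt x]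
      refine or_congr_left (and_congr_right fun hxl => ?_)
      rw [hnew x hxl]

/-- A shellable complex of dimension `n` in which every ridge lies in exactly two facets is
a sphere. -/
theorem exists_sphere_param (h : IsThinShelling c t n) (ht : 0 < t) :
    ∃ g : EuclideanSpace ℝ (Fin (n + 1)) → V → ℝ,
      ContinuousOn g (Metric.sphere 0 1) ∧
      Set.BijOn g (Metric.sphere 0 1) (initialComplex c t) := by
  have ht2 : 2 ≤ t := by
    have h1 : (c 0).Nonempty := by
      rw [← Finset.card_pos, h.card 0 ht]
      omega
    obtain ⟨v, hv⟩ := h1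
    obtain ⟨k, hk, hk0, -⟩ := h.exists_adj 0 ht v hv
    omega
  obtain ⟨j, rfl⟩ : ∃ j, t = j + 1 + 1 := ⟨t - 2, by omega⟩
  obtain ⟨g, hg⟩ := h.exists_ball_param j (by omega)
  generalize j + 1 = l at *
  have hl : l < l + 1 := by omega
  obtain ⟨b, hb⟩ := exists_simplex_param (c l) (h.card l hl)
  rw [initialComplex_succ]
  have hold : ∀ v ∈ c l, OldRidge c l v := by
    intro v hv
    obtain ⟨k, hk, hkl, hvk⟩ := h.exists_adj l hl v hv
    exact ⟨k, by omega, hvk⟩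
  refine _root_.exists_sphere_param hg hb ?_ ?_
  · ext x
    constructor
    · rintro ⟨-, i, hi, v, hv, hx, hfree⟩
      obtain ⟨k, hk, hki, hvk⟩ := h.exists_adj i (by omega) v hv
      have hkl : k = l := by
        by_contra hne
        exact hfree k (by omega) hki hvk
      subst hkl
      obtain ⟨u, hu, huv, -⟩ := Finset.exists_erase_eq_of_card hvk (by
        rw [h.card k hl, ← h.card i (by omega), Finset.card_erase_add_one hv])
      exact ⟨realizedSimplex_mono hvk hx, u, hu, hx.2 u huv⟩
    · rintro ⟨hx, v, hv, hxv⟩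
      exact ⟨(h.mem_initialComplex_iff hl hx).2 ⟨v, hv, hold v hv, hxv⟩,
        h.mem_initialBoundary_of_old hl hv (hold v hv) (mem_realizedSimplex_erase.2 ⟨hx, hxv⟩)⟩
  · rintro x ⟨hx, hx'⟩
    exact h.mem_initialBoundary_of_mem hl hx' hx

end IsThinShelling

end Shelling

section OrderComplex

variable {Q : Type*} [Fintype Q] [PartialOrder Q]

/-- The geometric realization of the order complex of the subposet `S`. -/
def orderComplexOn (S : Set Q) : Set (Q → ℝ) :=
  {x | x ∈ stdSimplex ℝ Q ∧ (∀ a b, x a ≠ 0 → x b ≠ 0 → a ≤ b ∨ b ≤ a) ∧ ∀ a, x a ≠ 0 → a ∈ S}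

/-- The points of the order complex whose support has greatest element `b`. -/
def orderCell (b : Q) : Set (Q → ℝ) :=
  {x | x ∈ orderComplexOn (Set.Iic b) ∧ x b ≠ 0}

theorem orderComplexOn_mono {S S' : Set Q} (h : S ⊆ S') : orderComplexOn S ⊆ orderComplexOn S' :=
  fun _ hx => ⟨hx.1, hx.2.1, fun a ha => h (hx.2.2 a ha)⟩

theorem isClosed_orderComplexOn (S : Set Q) : IsClosed (orderComplexOn S) := by
  have : orderComplexOn S = stdSimplex ℝ Q ∩
      ((⋂ a, ⋂ b, {x | x a ≠ 0 → x b ≠ 0 → a ≤ b ∨ b ≤ a}) ∩ ⋂ a, {x | x a ≠ 0 → a ∈ S}) := by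
    ext x
    simp only [orderComplexOn, Set.mem_ofPred_eq, Set.mem_inter_iff, Set.mem_iInter]
  rw [this]
  have hz : ∀ a : Q, IsClosed {x : Q → ℝ | x a = 0} := fun a =>
    isClosed_eq (continuous_apply a) continuous_const
  refine (isClosed_stdSimplex ℝ Q).inter (IsClosed.inter ?_ ?_)
  · refine isClosed_iInter fun a => isClosed_iInter fun b => ?_
    by_cases hab : a ≤ b ∨ b ≤ a
    · simp [hab]
    · convert (hz a).union (hz b) using 1
      ext x
      simp only [Set.mem_ofPred_eq, Set.mem_union]
      tauto
  · refine isClosed_iInter fun a => ?_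
    by_cases ha : a ∈ S
    · simp [ha]
    · convert hz a using 1
      ext x
      simp only [Set.mem_ofPred_eq]
      tauto

theorem exists_mem_orderCell {S : Set Q} {x : Q → ℝ} (hx : x ∈ orderComplexOn S) :
    ∃ b ∈ S, x ∈ orderCell b := by
  classical
  have hne : (Finset.univ.filter fun a => x a ≠ 0).Nonempty := by
    by_contra h
    rw [Finset.not_nonempty_iff_eq_empty, Finset.filter_eq_empty_iff] at h
    have := hx.1.2
    rw [Finset.sum_eq_zero fun a ha => not_not.1 (h ha)] at this
    exact zero_ne_one this
  obtain ⟨b, hb⟩ := Finset.exists_maximal hne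
  have hb0 : x b ≠ 0 := by simpa using hb.1
  refine ⟨b, hx.2.2 b hb0, ⟨hx.1, hx.2.1, fun a ha => ?_⟩, hb0⟩
  rcases hx.2.1 a b ha hb0 with h | h
  · exact h
  · exact hb.2 (by simpa using ha) h

theorem mem_orderComplexOn_of_mem_orderCell {S : Set Q} {b : Q} {x : Q → ℝ} (hx : x ∈ orderCell b)
    (hS : ∀ a ≤ b, a ∈ S) : x ∈ orderComplexOn S := orderComplexOn_mono hS hx.1

open Classical in
/-- The projection of a point of the simplex to the face opposite to the vertex `a`. -/
noncomputable def oppositeFaceProj (a : Q) (x : Q → ℝ) : Q → ℝ :=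
  (1 - x a)⁻¹ • Function.update x a 0

omit [Fintype Q] [PartialOrder Q] in
theorem oppositeFaceProj_self (a : Q) (x : Q → ℝ) : oppositeFaceProj a x a = 0 := by
  simp [oppositeFaceProj]

omit [Fintype Q] [PartialOrder Q] in
theorem oppositeFaceProj_of_ne {a b : Q} (hb : b ≠ a) (x : Q → ℝ) :
    oppositeFaceProj a x b = (1 - x a)⁻¹ * x b := by
  simp [oppositeFaceProj, hb]

omit [Fintype Q] [PartialOrder Q] in
theorem oppositeFaceProj_of_eq_zero {a : Q} {x : Q → ℝ} (h : x a = 0) :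
    oppositeFaceProj a x = x := by
  ext b
  by_cases hb : b = a
  · rw [hb, oppositeFaceProj_self, h]
  · simp [oppositeFaceProj_of_ne hb, h]

omit [PartialOrder Q] in
theorem stdSimplex_apply_le_one {x : Q → ℝ} (hx : x ∈ stdSimplex ℝ Q) (a : Q) : x a ≤ 1 := by
  rw [← hx.2]
  exact Finset.single_le_sum (fun b _ => hx.1 b) (Finset.mem_univ a)

omit [PartialOrder Q] in
theorem eq_zero_of_apply_eq_one {x : Q → ℝ} (hx : x ∈ stdSimplex ℝ Q) {a b : Q} (ha : x a = 1)
    (hb : b ≠ a) : x b = 0 := by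
  classical
  have h := hx.2
  rw [← Finset.add_sum_erase _ _ (Finset.mem_univ a), ha] at h
  have h0 : ∑ c ∈ Finset.univ.erase a, x c = 0 := by linarith
  rw [Finset.sum_eq_zero_iff_of_nonneg fun c _ => hx.1 c] at h0
  exact h0 b (by simp [hb])

theorem oppositeFaceProj_mem {a : Q} {x : Q → ℝ} (hx : x ∈ orderComplexOn (Set.Iic a))
    (h1 : x a ≠ 1) : oppositeFaceProj a x ∈ orderComplexOn (Set.Iio a) := by
  classical
  have hlt : 0 < 1 - x a := sub_pos.2 (lt_of_le_of_ne (stdSimplex_apply_le_one hx.1 a) h1)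
  have hsupp : ∀ b, oppositeFaceProj a x b ≠ 0 → b ≠ a ∧ x b ≠ 0 := by
    intro b hb
    have hba : b ≠ a := fun h => hb (by rw [h, oppositeFaceProj_self])
    rw [oppositeFaceProj_of_ne hba] at hb
    exact ⟨hba, right_ne_zero_of_mul hb⟩
  refine ⟨⟨fun b => ?_, ?_⟩, fun b c hb hc => hx.2.1 b c (hsupp b hb).2 (hsupp c hc).2,
    fun b hb => lt_of_le_of_ne (hx.2.2 b (hsupp b hb).2) (hsupp b hb).1⟩
  · by_cases hb : b = a
    · rw [hb, oppositeFaceProj_self]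
    · rw [oppositeFaceProj_of_ne hb]
      exact mul_nonneg (inv_nonneg.2 hlt.le) (hx.1.1 b)
  · have h := hx.1.2
    rw [← Finset.add_sum_erase _ _ (Finset.mem_univ a)] at h ⊢
    rw [oppositeFaceProj_self, zero_add,
      Finset.sum_congr rfl fun b hb => oppositeFaceProj_of_ne (Finset.ne_of_mem_erase hb) x,
      ← Finset.mul_sum, eq_sub_of_add_eq' h, inv_mul_cancel₀ hlt.ne']

omit [Fintype Q] [PartialOrder Q] in
theorem continuousAt_oppositeFaceProj {a : Q} {x : Q → ℝ} (h1 : x a ≠ 1) :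
    ContinuousAt (oppositeFaceProj a) x := by
  classical
  have hinv : ContinuousAt (fun y : Q → ℝ => (1 - y a)⁻¹) x :=
    ContinuousAt.inv₀ (continuous_const.sub (continuous_apply a)).continuousAt
      (sub_ne_zero.2 (Ne.symm h1))
  have hupd : ContinuousAt (fun y : Q → ℝ => Function.update y a 0) x :=
    (continuous_id.update a continuous_const).continuousAt
  have heq : oppositeFaceProj a =
      (fun y : Q → ℝ => (1 - y a)⁻¹) • fun y : Q → ℝ => Function.update y a 0 := by
    ext y b
    simp only [oppositeFaceProj, Pi.smul_apply, Pi.smul_apply']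
  rw [heq]
  exact hinv.smul hupd

omit [Fintype Q] [PartialOrder Q] in
theorem eq_of_oppositeFaceProj_eq {a : Q} {x y : Q → ℝ} (h1 : x a ≠ 1) (hxy : x a = y a)
    (h : oppositeFaceProj a x = oppositeFaceProj a y) : x = y := by
  ext b
  by_cases hb : b = a
  · rw [hb, hxy]
  · have := congrFun h b
    rw [oppositeFaceProj_of_ne hb, oppositeFaceProj_of_ne hb, ← hxy] at this
    exact mul_left_cancel₀ (inv_ne_zero (sub_ne_zero.2 (Ne.symm h1))) this

theorem single_mem_orderCell [DecidableEq Q] (a : Q) : Pi.single a (1 : ℝ) ∈ orderCell a := by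
  have hs : ∀ b, (Pi.single a (1 : ℝ) : Q → ℝ) b ≠ 0 → b = a := by
    intro b hb
    by_contra h
    exact hb (by simp [h])
  refine ⟨⟨single_mem_stdSimplex ℝ a, fun b c hb hc => ?_, fun b hb => (hs b hb).le⟩, by simp⟩
  rw [hs b hb, hs c hc]
  exact Or.inl le_rfl

/-- Every point of the face opposite to `a` can be joined to the vertex `a`. -/
theorem exists_oppositeFaceProj_eq {a : Q} {z : Q → ℝ} (hz : z ∈ orderComplexOn (Set.Iio a))
    {t : ℝ} (h0 : 0 < t) (h1 : t < 1) :
    ∃ x ∈ orderCell a, x a = 1 - t ∧ oppositeFaceProj a x = z := by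
  classical
  have hza : z a = 0 := by
    by_contra h
    exact lt_irrefl a (hz.2.2 a h)
  have hval : ∀ b, b ≠ a → (t • z + (1 - t) • (Pi.single a 1 : Q → ℝ)) b = t * z b := by
    intro b hb
    simp [hb]
  have hvala : (t • z + (1 - t) • (Pi.single a 1 : Q → ℝ)) a = 1 - t := by simp [hza]
  have hsupp : ∀ b, (t • z + (1 - t) • (Pi.single a 1 : Q → ℝ)) b ≠ 0 → b ≠ a → z b ≠ 0 := by
    intro b hb hba
    rw [hval b hba] at hb
    exact right_ne_zero_of_mul hb
  have hle : ∀ b, (t • z + (1 - t) • (Pi.single a 1 : Q → ℝ)) b ≠ 0 → b ≤ a := by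
    intro b hb
    by_cases hba : b = a
    · exact hba.le
    · exact (hz.2.2 b (hsupp b hb hba)).le
  refine ⟨t • z + (1 - t) • Pi.single a 1, ⟨⟨?_, fun b c hb hc => ?_, hle⟩, ?_⟩, hvala, ?_⟩
  · exact convex_stdSimplex ℝ Q hz.1 (single_mem_stdSimplex ℝ a) h0.le (by linarith) (by ring)
  · by_cases hba : b = a
    · exact Or.inr (hba ▸ hle c hc)
    · by_cases hca : c = a
      · exact Or.inl (hca ▸ hle b hb)
      · exact hz.2.1 b c (hsupp b hb hba) (hsupp c hc hca)
  · rw [hvala]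
    linarith
  · ext b
    by_cases hba : b = a
    · rw [hba, oppositeFaceProj_self, hza]
    · rw [oppositeFaceProj_of_ne hba, hval b hba, hvala, sub_sub_cancel,
        inv_mul_cancel_left₀ h0.ne']

end OrderComplex

section CellComplex

open Set Metric Filter Topology

variable {X : Type*} [TopologicalSpace X] {Q : Type*} [Fintype Q] [PartialOrder Q]

/-- The coordinate in the cell with chart `ψ` of the point `x` of the cone with apex `a`, when the
base of the cone is mapped to the boundary of the cell by `h`. -/
noncomputable def coneCoord {E : Type*} [SMul ℝ E] (ψ : X → E) (h : (Q → ℝ) → X) (a : Q)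
    (x : Q → ℝ) : E := (1 - x a) • ψ (h (oppositeFaceProj a x))

/-- `h` carries the order complex of `S` onto the union of the cells indexed by `S`, compatibly
with the cell structures. -/
structure IsOrderComplexParam (piece : Q → Set X) (S : Set Q) (h : (Q → ℝ) → X) : Prop where
  continuousOn : ContinuousOn h (orderComplexOn S)
  bijOn : ∀ b ∈ S, BijOn h (orderCell b) (piece b)

theorem IsOrderComplexParam.injOn {piece : Q → Set X} {S : Set Q} {h : (Q → ℝ) → X}
    (hh : IsOrderComplexParam piece S h)
    (hdisj : ∀ a b p, p ∈ piece a → p ∈ piece b → a = b) : InjOn h (orderComplexOn S) := by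
  intro x hx y hy hxy
  obtain ⟨a, ha, hxa⟩ := exists_mem_orderCell hx
  obtain ⟨b, hb, hyb⟩ := exists_mem_orderCell hy
  have hab : a = b := hdisj a b (h x) ((hh.bijOn a ha).mapsTo hxa)
    (hxy ▸ (hh.bijOn b hb).mapsTo hyb)
  subst hab
  exact (hh.bijOn a ha).injOn hxa hyb hxy

theorem IsOrderComplexParam.exists_insert {E : Type*} [NormedAddCommGroup E] [NormedSpace ℝ E]
    {piece : Q → Set X} {S : Set Q} {h : (Q → ℝ) → X}
    (hh : IsOrderComplexParam piece S h)
    (hdisj : ∀ a b p, p ∈ piece a → p ∈ piece b → a = b)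
    {a : Q} (haS : ∀ b ∈ S, ¬ a ≤ b) (hlow : ∀ b < a, b ∈ S)
    {φ : E → X} {ψ : X → E} (hφ : ContinuousOn φ (closedBall 0 1))
    (hψ : ContinuousOn ψ (⋃ b ∈ Iic a, piece b))
    (hφm : MapsTo φ (closedBall 0 1) (⋃ b ∈ Iic a, piece b))
    (hψm : MapsTo ψ (⋃ b ∈ Iic a, piece b) (closedBall 0 1))
    (hψφ : ∀ y ∈ closedBall (0 : E) 1, ψ (φ y) = y) (hφψ : ∀ p ∈ ⋃ b ∈ Iic a, piece b, φ (ψ p) = p)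
    (hpiece : φ '' ball 0 1 = piece a) :
    ∃ h', IsOrderComplexParam piece (insert a S) h' := by
  classical
  have hIioS : Iio a ⊆ S := fun b hb => hlow b hb
  have hmem : ∀ z ∈ orderComplexOn (Iio a), h z ∈ ⋃ b ∈ Iio a, piece b := by
    intro z hz
    obtain ⟨b, hb, hzb⟩ := exists_mem_orderCell hz
    exact mem_biUnion hb ((hh.bijOn b (hlow b hb)).mapsTo hzb)
  have hsub : (⋃ b ∈ Iio a, piece b) ⊆ ⋃ b ∈ Iic a, piece b :=
    biUnion_subset_biUnion_left Iio_subset_Iic_self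
  have hnorm1 : ∀ p ∈ ⋃ b ∈ Iio a, piece b, ‖ψ p‖ = 1 := by
    intro p hp
    have hle : ‖ψ p‖ ≤ 1 := by simpa using hψm (hsub hp)
    refine le_antisymm hle (not_lt.1 fun hlt => ?_)
    have hpa : p ∈ piece a := by
      rw [← hpiece, ← hφψ p (hsub hp)]
      exact mem_image_of_mem _ (by simpa using hlt)
    obtain ⟨b, hb, hpb⟩ := mem_iUnion₂.1 hp
    exact (ne_of_lt hb) (hdisj b a p hpb hpa)
  have hnorm : ∀ x ∈ orderComplexOn (Iic a), ‖coneCoord ψ h a x‖ = 1 - x a := by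
    intro x hx
    have hle := sub_nonneg.2 (stdSimplex_apply_le_one hx.1 a)
    rw [coneCoord, norm_smul, Real.norm_of_nonneg hle]
    by_cases h1 : x a = 1
    · simp [h1]
    · rw [hnorm1 _ (hmem _ (oppositeFaceProj_mem hx h1)), mul_one]
  have hball : MapsTo (coneCoord ψ h a) (orderComplexOn (Iic a)) (closedBall 0 1) := by
    intro x hx
    rw [mem_closedBall_zero_iff, hnorm x hx]
    linarith [hx.1.1 a]
  have hcone : ContinuousOn (coneCoord ψ h a) (orderComplexOn (Iic a)) := by
    intro x hx
    by_cases h1 : x a = 1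
    · have h0 : coneCoord ψ h a x = 0 := by simp [coneCoord, h1]
      rw [ContinuousWithinAt, h0]
      refine squeeze_zero_norm' (a := fun y : Q → ℝ => 1 - y a)
        (eventually_mem_nhdsWithin.mono fun y hy => (hnorm y hy).le) ?_
      have : ContinuousAt (fun y : Q → ℝ => 1 - y a) x :=
        (continuous_const.sub (continuous_apply a)).continuousAt
      have ht := this.tendsto
      simp only [h1, sub_self] at ht
      exact ht.mono_left nhdsWithin_le_nhds
    · have hev : {y : Q → ℝ | y a ≠ 1} ∈ 𝓝 x :=
        (isOpen_ne_fun (continuous_apply a) continuous_const).mem_nhds h1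
      rw [← continuousWithinAt_inter hev]
      have hproj : ContinuousWithinAt (oppositeFaceProj a)
          (orderComplexOn (Iic a) ∩ {y : Q → ℝ | y a ≠ 1}) x :=
        (continuousAt_oppositeFaceProj h1).continuousWithinAt
      have hmaps : MapsTo (oppositeFaceProj a)
          (orderComplexOn (Iic a) ∩ {y : Q → ℝ | y a ≠ 1}) (orderComplexOn (Iio a)) :=
        fun y hy => oppositeFaceProj_mem hy.1 hy.2
      have hxI := oppositeFaceProj_mem hx h1
      have hcomp : ContinuousOn (ψ ∘ h) (orderComplexOn (Iio a)) :=
        hψ.comp (hh.continuousOn.mono (orderComplexOn_mono hIioS)) fun z hz => hsub (hmem z hz)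
      have hc : ContinuousWithinAt (fun y : Q → ℝ => 1 - y a)
          (orderComplexOn (Iic a) ∩ {y : Q → ℝ | y a ≠ 1}) x :=
        (continuous_const.sub (continuous_apply a)).continuousWithinAt
      exact hc.smul ((hcomp _ hxI).comp hproj hmaps)
  have hzero : ∀ x ∈ orderComplexOn (Iio a), φ (coneCoord ψ h a x) = h x := by
    intro x hx
    have hxa : x a = 0 := by
      by_contra hne
      exact lt_irrefl a (hx.2.2 a hne)
    rw [coneCoord, oppositeFaceProj_of_eq_zero hxa, hxa, sub_zero, one_smul,
      hφψ _ (hsub (hmem x hx))]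
  have hIic : ∀ x ∈ orderComplexOn (insert a S), x a ≠ 0 → x ∈ orderComplexOn (Iic a) := by
    intro x hx hxa
    refine ⟨hx.1, hx.2.1, fun b hb => ?_⟩
    rcases hx.2.1 a b hxa hb with hle | hle
    · rcases hx.2.2 b hb with rfl | hbS
      · exact le_rfl
      · exact absurd hle (haS b hbS)
    · exact hle
  have hIio : ∀ x ∈ orderComplexOn (Iic a), x a = 0 → x ∈ orderComplexOn (Iio a) := by
    intro x hx hxa
    refine ⟨hx.1, hx.2.1, fun b hb => lt_of_le_of_ne (hx.2.2 b hb) ?_⟩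
    rintro rfl
    exact hb hxa
  have haS' : a ∉ S := fun ha => haS a ha le_rfl
  have hSa : ∀ x ∈ orderComplexOn S, x a = 0 := by
    intro x hx
    by_contra hne
    exact haS' (hx.2.2 a hne)
  set h' : (Q → ℝ) → X := fun x => if x a = 0 then h x else φ (coneCoord ψ h a x) with hh'
  have hS : EqOn h' h (orderComplexOn S) := fun x hx => if_pos (hSa x hx)
  have hC : EqOn h' (φ ∘ coneCoord ψ h a) (orderComplexOn (Iic a)) := by
    intro x hx
    by_cases hxa : x a = 0
    · simp only [hh', if_pos hxa, Function.comp_apply]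
      exact (hzero x (hIio x hx hxa)).symm
    · simp [hh', if_neg hxa]
  refine ⟨h', ⟨?_, ?_⟩⟩
  · have hU : orderComplexOn (insert a S) ⊆ orderComplexOn S ∪ orderComplexOn (Iic a) := by
      intro x hx
      by_cases hxa : x a = 0
      · refine Or.inl ⟨hx.1, hx.2.1, fun b hb => (hx.2.2 b hb).resolve_left ?_⟩
        rintro rfl
        exact hb hxa
      · exact Or.inr (hIic x hx hxa)
    refine ContinuousOn.mono ?_ hU
    refine ContinuousOn.union_of_isClosed (hh.continuousOn.congr hS) ?_
      (isClosed_orderComplexOn _) (isClosed_orderComplexOn _)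
    exact (hφ.comp hcone hball).congr hC
  · intro b hb
    by_cases hba : b = a
    swap
    · have hbS := hb.resolve_left hba
      refine (hh.bijOn b hbS).congr fun x hx => (if_pos ?_).symm
      by_contra hne
      exact haS b hbS (hx.1.2.2 a hne)
    subst hba
    have hcell : EqOn h' (φ ∘ coneCoord ψ h b) (orderCell b) := fun x hx => hC hx.1
    refine BijOn.congr ?_ hcell.symm
    refine ⟨fun x hx => ?_, fun x hx y hy hxy => ?_, fun p hp => ?_⟩
    · rw [← hpiece]
      refine mem_image_of_mem _ ?_
      rw [mem_ball_zero_iff, hnorm x hx.1]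
      have := lt_of_le_of_ne (hx.1.1.1 b) (Ne.symm hx.2)
      linarith
    · have hg : coneCoord ψ h b x = coneCoord ψ h b y := by
        rw [← hψφ _ (hball hx.1), ← hψφ _ (hball hy.1)]
        exact congrArg ψ hxy
      have hxyb : x b = y b := by
        have := congrArg norm hg
        rw [hnorm x hx.1, hnorm y hy.1] at this
        linarith
      by_cases h1 : x b = 1
      · ext c
        by_cases hcb : c = b
        · rw [hcb, hxyb]
        · rw [eq_zero_of_apply_eq_one hx.1.1 h1 hcb,
            eq_zero_of_apply_eq_one hy.1.1 (hxyb ▸ h1) hcb]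
      · have hpx := oppositeFaceProj_mem hx.1 h1
        have hpy := oppositeFaceProj_mem hy.1 (hxyb ▸ h1)
        refine eq_of_oppositeFaceProj_eq h1 hxyb
          (hh.injOn hdisj (orderComplexOn_mono hIioS hpx) (orderComplexOn_mono hIioS hpy) ?_)
        rw [coneCoord, coneCoord, ← hxyb] at hg
        have hψe := smul_right_injective E (sub_ne_zero.2 (Ne.symm h1)) hg
        rw [← hφψ _ (hsub (hmem _ hpx)), ← hφψ _ (hsub (hmem _ hpy))]
        exact congrArg φ hψe
    · rw [← hpiece] at hp
      obtain ⟨y, hy, rfl⟩ := hp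
      rw [mem_ball_zero_iff] at hy
      by_cases hy0 : y = 0
      · refine ⟨Pi.single b 1, single_mem_orderCell b, ?_⟩
        simp [coneCoord, hy0]
      have hypos : 0 < ‖y‖ := norm_pos_iff.2 hy0
      set u : E := ‖y‖⁻¹ • y with hu
      have hu1 : ‖u‖ = 1 := by
        rw [hu, norm_smul, norm_inv, norm_norm, inv_mul_cancel₀ hypos.ne']
      have huc : u ∈ closedBall (0 : E) 1 := by simp [hu1]
      obtain ⟨c, hc, huc'⟩ := mem_iUnion₂.1 (hφm huc)
      have hcb : c ≠ b := by
        rintro rfl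
        rw [← hpiece] at huc'
        obtain ⟨w, hw, hwu⟩ := huc'
        have : w = u := by rw [← hψφ w (ball_subset_closedBall hw), ← hψφ u huc, hwu]
        rw [mem_ball_zero_iff, this, hu1] at hw
        exact lt_irrefl _ hw
      have hclt : c < b := lt_of_le_of_ne hc hcb
      obtain ⟨z, hz, hzu⟩ := (hh.bijOn c (hlow c hclt)).surjOn huc'
      have hzI : z ∈ orderComplexOn (Iio b) :=
        mem_orderComplexOn_of_mem_orderCell hz fun d hd => hd.trans_lt hclt
      obtain ⟨x, hx, hxb, hxz⟩ := exists_oppositeFaceProj_eq hzI hypos hy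
      refine ⟨x, hx, ?_⟩
      rw [Function.comp_apply, coneCoord, hxz, hzu, hψφ u huc, hxb, sub_sub_cancel, hu,
        smul_inv_smul₀ hypos.ne']

omit [Fintype Q] in
theorem closure_piece_eq {piece : Q → Set X}
    (hclosure : ∀ α : Q, ∃ s : Set Q, closure (piece α) = ⋃ β ∈ s, piece β)
    (horder : ∀ α β : Q, β ≤ α ↔ piece β ⊆ closure (piece α)) (a : Q) :
    closure (piece a) = ⋃ b ∈ Iic a, piece b := by
  apply Subset.antisymm
  · obtain ⟨s, hs⟩ := hclosure a
    intro p hp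
    rw [hs] at hp
    obtain ⟨b, hb, hpb⟩ := mem_iUnion₂.1 hp
    refine mem_biUnion ((horder a b).2 ?_) hpb
    rw [hs]
    exact subset_biUnion_of_mem (u := piece) hb
  · exact iUnion₂_subset fun b hb => (horder a b).1 hb

theorem exists_isOrderComplexParam [Nonempty X] (piece : Q → Set X)
    (hpart : ∀ p : X, ∃! α : Q, p ∈ piece α)
    (hcell : ∀ α : Q, ∃ n : ℕ,
      ∃ φ : (closedBall (0 : EuclideanSpace ℝ (Fin n)) 1) ≃ₜ (closure (piece α)),
        (fun x : closedBall (0 : EuclideanSpace ℝ (Fin n)) 1 => ((φ x : X))) ''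
          {x : closedBall (0 : EuclideanSpace ℝ (Fin n)) 1 |
            ‖(x : EuclideanSpace ℝ (Fin n))‖ < 1} = piece α)
    (hclosure : ∀ α : Q, ∃ s : Set Q, closure (piece α) = ⋃ β ∈ s, piece β)
    (horder : ∀ α β : Q, β ≤ α ↔ piece β ⊆ closure (piece α)) :
    ∃ h, IsOrderComplexParam piece univ h := by
  classical
  have hdisj : ∀ a b p, p ∈ piece a → p ∈ piece b → a = b :=
    fun a b p ha hb => (hpart p).unique ha hb
  have hcl := closure_piece_eq hclosure horder
  suffices H : ∀ k, ∀ S : Finset Q, S.card = k → IsLowerSet (S : Set Q) →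
      ∃ h, IsOrderComplexParam piece (S : Set Q) h by
    obtain ⟨h, hh⟩ := H _ Finset.univ rfl (by simpa using isLowerSet_univ)
    exact ⟨h, by simpa using hh⟩
  intro k
  induction k with
  | zero =>
    intro S hS _
    obtain rfl := Finset.card_eq_zero.1 hS
    refine ⟨fun _ => Classical.arbitrary X, continuousOn_const, fun b hb => ?_⟩
    simp at hb
  | succ k ih =>
    intro S hS hlow
    obtain ⟨a, ha⟩ := Finset.exists_maximal (Finset.card_pos.1 (by omega : 0 < S.card))
    have hlow' : IsLowerSet ((S.erase a : Finset Q) : Set Q) := by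
      intro b c hcb hb
      have hb' : b ≠ a ∧ b ∈ S := Finset.mem_erase.1 hb
      refine Finset.mem_coe.2 (Finset.mem_erase.2 ⟨?_, hlow hcb hb'.2⟩)
      rintro rfl
      exact hb'.1 (le_antisymm (ha.2 hb'.2 hcb) hcb)
    obtain ⟨h, hh⟩ := ih (S.erase a) (by rw [Finset.card_erase_of_mem ha.1]; omega) hlow'
    have hins : insert a ((S.erase a : Finset Q) : Set Q) = S := by
      rw [← Finset.coe_insert, Finset.insert_erase ha.1]
    rw [← hins]
    obtain ⟨n, e, he⟩ := hcell a
    set φ : EuclideanSpace ℝ (Fin n) → X := fun y => if hy : y ∈ closedBall 0 1 then e ⟨y, hy⟩ else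
      Classical.arbitrary X
    set ψ : X → EuclideanSpace ℝ (Fin n) := fun p => if hp : p ∈ closure (piece a) then
      e.symm ⟨p, hp⟩ else 0
    have hφe : ∀ y : closedBall (0 : EuclideanSpace ℝ (Fin n)) 1, φ y = e y := fun y => dif_pos y.2
    have hψe : ∀ p : closure (piece a), ψ p = e.symm p := fun p => dif_pos p.2
    refine hh.exists_insert hdisj (φ := φ) (ψ := ψ) ?_ ?_ ?_ ?_ ?_ ?_ ?_ ?_ ?_
    · intro b hb hab
      have hb' : b ≠ a ∧ b ∈ S := Finset.mem_erase.1 hb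
      exact hb'.1 (le_antisymm (ha.2 hb'.2 hab) hab)
    · intro b hb
      exact Finset.mem_erase.2 ⟨hb.ne, hlow hb.le ha.1⟩
    · rw [continuousOn_iff_continuous_domRestrict]
      exact (continuous_subtype_val.comp e.continuous).congr fun y => (hφe y).symm
    · rw [← hcl, continuousOn_iff_continuous_domRestrict]
      exact (continuous_subtype_val.comp e.symm.continuous).congr fun p => (hψe p).symm
    · rw [← hcl]
      intro y hy
      rw [hφe ⟨y, hy⟩]
      exact (e ⟨y, hy⟩).2
    · rw [← hcl]
      intro p hp
      rw [hψe ⟨p, hp⟩]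
      exact (e.symm ⟨p, hp⟩).2
    · intro y hy
      rw [hφe ⟨y, hy⟩, hψe, e.symm_apply_apply]
    · rw [← hcl]
      intro p hp
      rw [hψe ⟨p, hp⟩, hφe, e.apply_symm_apply]
    · rw [← he]
      ext p
      constructor
      · rintro ⟨y, hy, rfl⟩
        have hyB : y ∈ closedBall 0 1 := ball_subset_closedBall hy
        exact ⟨⟨y, hyB⟩, by simpa using hy, (hφe ⟨y, hyB⟩).symm⟩
      · rintro ⟨y, hy, rfl⟩
        exact ⟨y, by simpa using hy, hφe y⟩

theorem IsOrderComplexParam.bijOn_univ {piece : Q → Set X} {h : (Q → ℝ) → X}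
    (hh : IsOrderComplexParam piece univ h) (hpart : ∀ p : X, ∃! α : Q, p ∈ piece α) :
    BijOn h (orderComplexOn univ) univ := by
  refine ⟨mapsTo_univ _ _, hh.injOn fun a b p ha hb => (hpart p).unique ha hb, fun p _ => ?_⟩
  obtain ⟨a, ha, -⟩ := hpart p
  obtain ⟨x, hx, hxp⟩ := (hh.bijOn a (mem_univ a)).surjOn ha
  exact ⟨x, orderComplexOn_mono (subset_univ _) hx.1, hxp⟩

end CellComplex

section ThinPoset

theorem IsChain.insert_of_le_or_le {P : Type*} [PartialOrder P] {d : Set P}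
    (hd : IsChain (· ≤ ·) d) {w : P} (hw : ∀ x ∈ d, x ≤ w ∨ w ≤ x) :
    IsChain (· ≤ ·) (insert w d) :=
  hd.insert fun x hx _ => (hw x hx).symm

theorem IsMaxChain.mem_of_le_or_le {P : Type*} [PartialOrder P] {d : Set P}
    (hd : IsMaxChain (· ≤ ·) d) {w : P} (hw : ∀ x ∈ d, x ≤ w ∨ w ≤ x) : w ∈ d := by
  rw [hd.2 (hd.1.insert_of_le_or_le hw) (Set.subset_insert _ _)]
  exact Set.mem_insert _ _

theorem IsChain.le_or_le {P : Type*} [PartialOrder P] {d : Set P} (hd : IsChain (· ≤ ·) d)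
    {x y : P} (hx : x ∈ d) (hy : y ∈ d) : x ≤ y ∨ y ≤ x := by
  by_cases h : x = y
  · exact Or.inl h.le
  · exact hd hx hy h

variable {P : Type*} [PartialOrder P] [BoundedOrder P] [Finite P]

omit [BoundedOrder P] in
theorem IsChain.isMaxChain_of_ncard {N : ℕ}
    (hN : ∀ d : Set P, IsMaxChain (· ≤ ·) d → d.ncard = N) {d : Set P}
    (hd : IsChain (· ≤ ·) d) (hdN : N ≤ d.ncard) : IsMaxChain (· ≤ ·) d := by
  obtain ⟨m, hm, hdm⟩ := hd.exists_maxChain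
  rwa [Set.eq_of_subset_of_ncard_le hdm (by rw [hN m hm]; exact hdN) (Set.toFinite m)]

/-- In a graded thin bounded poset, every proper element of a maximal chain can be exchanged in
exactly one way. -/
theorem IsMaxChain.exists_exchange {N : ℕ}
    (hN : ∀ d : Set P, IsMaxChain (· ≤ ·) d → d.ncard = N)
    (hthin : ThinIn (α := P) (· ≤ ·) Set.univ) {d : Set P} (hd : IsMaxChain (· ≤ ·) d) {v : P}
    (hv : v ∈ d) (hbot : v ≠ ⊥) (htop : v ≠ ⊤) :
    ∃ d', IsMaxChain (· ≤ ·) d' ∧ d' ≠ d ∧ d \ {v} ⊆ d' ∧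
      ∀ d'', IsMaxChain (· ≤ ·) d'' → d \ {v} ⊆ d'' → d'' = d ∨ d'' = d' := by
  have hbd : ⊥ ∈ d := hd.mem_of_le_or_le fun x _ => Or.inr bot_le
  have htd : ⊤ ∈ d := hd.mem_of_le_or_le fun x _ => Or.inl le_top
  obtain ⟨a, ha⟩ := (Set.toFinite {x ∈ d | x < v}).exists_maximal ⟨⊥, hbd, hbot.bot_lt⟩
  obtain ⟨b, hb⟩ := (Set.toFinite {x ∈ d | v < x}).exists_minimal ⟨⊤, htd, htop.lt_top⟩
  have had : a ∈ d := ha.1.1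
  have hbd' : b ∈ d := hb.1.1
  have hav : a < v := ha.1.2
  have hvb : v < b := hb.1.2
  have hle : ∀ x ∈ d, x ≠ v → x ≤ a ∨ b ≤ x := by
    intro x hx hxv
    rcases hd.1.le_or_le hx hv with h | h
    · left
      have hxs : x ∈ {x ∈ d | x < v} := ⟨hx, lt_of_le_of_ne h hxv⟩
      exact (hd.1.le_or_le hx had).elim id fun h' => ha.2 hxs h'
    · right
      have hxs : x ∈ {x ∈ d | v < x} := ⟨hx, lt_of_le_of_ne h (Ne.symm hxv)⟩
      exact (hd.1.le_or_le hbd' hx).elim id fun h' => hb.2 hxs h'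
  have had' : a ∈ d \ {v} := ⟨had, hav.ne⟩
  have hbd'' : b ∈ d \ {v} := ⟨hbd', hvb.ne'⟩
  have hcard : (d \ {v}).ncard + 1 = N := by
    rw [Set.ncard_sdiff_singleton_add_one hv, hN d hd]
  have hout : ∀ u, (∀ x ∈ d \ {v}, x ≤ u ∨ u ≤ x) → u ∈ d \ {v} ∨ (a < u ∧ u < b) := by
    intro u hu
    have hmem : (u ≤ v ∨ v ≤ u) → u ∈ d := fun h => hd.mem_of_le_or_le fun x hx => by
      by_cases hxv : x = v
      · rw [hxv]
        exact h.symm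
      · exact hu x ⟨hx, hxv⟩
    rcases hu a had' with h1 | h1
    · rcases hu b hbd'' with h2 | h2
      · exact Or.inl ⟨hmem (Or.inr (hvb.le.trans h2)), (hvb.trans_le h2).ne'⟩
      · by_cases hau : a = u
        · exact Or.inl (hau ▸ had')
        by_cases hub : u = b
        · exact Or.inl (hub ▸ hbd'')
        exact Or.inr ⟨lt_of_le_of_ne h1 hau, lt_of_le_of_ne h2 hub⟩
    · exact Or.inl ⟨hmem (Or.inl (h1.trans hav.le)), (h1.trans_lt hav).ne⟩
  have hinter : ∀ u, a < u → u < b → u ∉ d \ {v} := by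
    intro u h1 h2 hu
    rcases hle u hu.1 hu.2 with h | h
    · exact absurd h1 h.not_gt
    · exact absurd h2 h.not_gt
  have hcomp : ∀ u, a ≤ u → u ≤ b → ∀ x ∈ d \ {v}, x ≤ u ∨ u ≤ x := fun u h1 h2 x hx =>
    (hle x hx.1 hx.2).imp (fun h => h.trans h1) fun h => h2.trans h
  have hrank : ∀ e : Set P, MaxChainIn (· ≤ ·) (intervalIn (· ≤ ·) Set.univ a b) e →
      e.ncard = 3 := by
    intro e he
    have hin : ∀ x ∈ e, a ≤ x ∧ x ≤ b := fun x hx => (he.1.1 hx).2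
    have hadd : ∀ u, a ≤ u → u ≤ b → (∀ x ∈ e, x ≤ u ∨ u ≤ x) → u ∈ e := by
      intro u h1 h2 hu
      rw [he.2 (insert u e) ⟨Set.insert_subset ⟨Set.mem_univ _, h1, h2⟩ he.1.1,
        IsChain.insert_of_le_or_le he.1.2 hu⟩ (Set.subset_insert _ _)]
      exact Set.mem_insert _ _
    have hae : a ∈ e := hadd a le_rfl (hav.trans hvb).le fun x hx => Or.inr (hin x hx).1
    have hbe : b ∈ e := hadd b (hav.trans hvb).le le_rfl fun x hx => Or.inl (hin x hx).2
    have hchain : IsChain (· ≤ ·) ((d \ {v}) ∪ e) := by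
      intro x hx y hy _
      rcases hx with hx | hx <;> rcases hy with hy | hy
      · exact hd.1.le_or_le hx.1 hy.1
      · exact hcomp y (hin y hy).1 (hin y hy).2 x hx
      · exact (hcomp x (hin x hx).1 (hin x hx).2 y hy).symm
      · exact IsChain.le_or_le he.1.2 hx hy
    obtain ⟨m, hm, hsub⟩ := hchain.exists_maxChain
    have hmeq : m = (d \ {v}) ∪ e := by
      refine Set.Subset.antisymm (fun u hu => ?_) hsub
      rcases hout u fun x hx => hm.1.le_or_le (hsub (Or.inl hx)) hu with h | h
      · exact Or.inl h
      · exact Or.inr (hadd u h.1.le h.2.le fun x hx => hm.1.le_or_le (hsub (Or.inr hx)) hu)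
    have hab : ({a, b} : Set P).ncard = 2 := Set.ncard_pair (hav.trans hvb).ne
    have hsubab : ({a, b} : Set P) ⊆ e := Set.insert_subset hae (Set.singleton_subset_iff.2 hbe)
    have hdecomp : (d \ {v}) ∪ e = (d \ {v}) ∪ (e \ {a, b}) := by
      ext u
      simp only [Set.mem_union, Set.mem_sdiff, Set.mem_insert_iff]
      constructor
      · rintro (h | h)
        · exact Or.inl h
        · by_cases hua : u = a
          · exact Or.inl (hua ▸ had')
          by_cases hub : u = b
          · exact Or.inl (hub ▸ hbd'')
          exact Or.inr ⟨h, by simp [hua, hub]⟩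
      · rintro (h | h)
        · exact Or.inl h
        · exact Or.inr h.1
    have hdisj : Disjoint (d \ {v}) (e \ {a, b}) := by
      rw [Set.disjoint_right]
      rintro u ⟨hu, hu'⟩
      have hu2 : u ≠ a ∧ u ≠ b := by simpa using hu'
      exact hinter u (lt_of_le_of_ne (hin u hu).1 (Ne.symm hu2.1))
        (lt_of_le_of_ne (hin u hu).2 hu2.2)
    have h1 := hN m hm
    rw [hmeq, hdecomp, Set.ncard_union_eq hdisj] at h1
    have h2 := Set.ncard_sdiff_add_ncard_of_subset hsubab
    omega
  have h4 := hthin a (Set.mem_univ _) b (Set.mem_univ _) (hav.trans hvb).le hrank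
  have h3 : ({a, v, b} : Set P).ncard = 3 :=
    Set.ncard_eq_three.2 ⟨a, v, b, hav.ne, (hav.trans hvb).ne, hvb.ne, rfl⟩
  have hsub3 : ({a, v, b} : Set P) ⊆ intervalIn (· ≤ ·) Set.univ a b := by
    rintro x (rfl | rfl | rfl)
    · exact ⟨Set.mem_univ _, le_rfl, (hav.trans hvb).le⟩
    · exact ⟨Set.mem_univ _, hav.le, hvb.le⟩
    · exact ⟨Set.mem_univ _, (hav.trans hvb).le, le_rfl⟩
  have h1 : (intervalIn (· ≤ ·) Set.univ a b \ {a, v, b}).ncard = 1 := by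
    have := Set.ncard_sdiff_add_ncard_of_subset hsub3
    omega
  obtain ⟨w, hw⟩ := Set.ncard_eq_one.1 h1
  have hw' : w ∈ intervalIn (· ≤ ·) Set.univ a b \ {a, v, b} := hw ▸ Set.mem_singleton w
  obtain ⟨⟨-, haw, hwb⟩, hwne⟩ := hw'
  have hwne' : w ≠ a ∧ w ≠ v ∧ w ≠ b := by simpa using hwne
  have hwd : w ∉ d \ {v} :=
    hinter w (lt_of_le_of_ne haw (Ne.symm hwne'.1)) (lt_of_le_of_ne hwb hwne'.2.2)
  refine ⟨insert w (d \ {v}), ?_, ?_, Set.subset_insert _ _, fun d'' hd'' hsub => ?_⟩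
  · refine IsChain.isMaxChain_of_ncard hN
      ((hd.1.mono Set.sdiff_subset).insert_of_le_or_le (hcomp w haw hwb)) ?_
    rw [Set.ncard_insert_of_notMem hwd, hcard]
  · intro h
    exact hwd ⟨h ▸ Set.mem_insert _ _, hwne'.2.1⟩
  · have hdiff : (d'' \ (d \ {v})).ncard = 1 := by
      have := Set.ncard_sdiff_add_ncard_of_subset hsub
      rw [hN d'' hd''] at this
      omega
    obtain ⟨u, hu⟩ := Set.ncard_eq_one.1 hdiff
    have hu' : u ∈ d'' \ (d \ {v}) := hu ▸ Set.mem_singleton u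
    have hd''eq : d'' = insert u (d \ {v}) := by
      rw [← Set.sdiff_union_of_subset hsub, hu, Set.singleton_union]
    have huI := (hout u fun x hx => hd''.1.le_or_le (hsub hx) hu'.1).resolve_left hu'.2
    by_cases huv : u = v
    · left
      rw [hd''eq, huv, Set.insert_sdiff_singleton, Set.insert_eq_of_mem hv]
    · right
      have : u ∈ intervalIn (· ≤ ·) Set.univ a b \ {a, v, b} :=
        ⟨⟨Set.mem_univ _, huI.1.le, huI.2.le⟩, by simp [huI.1.ne', huv, huI.2.ne]⟩
      rw [hw] at this
      rw [hd''eq, Set.mem_singleton_iff.1 this]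

end ThinPoset

section FacePoset

theorem maxChainIn_univ_iff {P : Type*} [PartialOrder P] {d : Set P} :
    MaxChainIn (· ≤ ·) Set.univ d ↔ IsMaxChain (· ≤ ·) d :=
  ⟨fun h => ⟨h.1.2, fun _ ht hdt => h.2 _ ⟨Set.subset_univ _, ht⟩ hdt⟩,
    fun h => ⟨⟨Set.subset_univ _, h.1⟩, fun _ ht hdt => h.2 ht.2 hdt⟩⟩

variable {Q : Type*} [PartialOrder Q]

/-- The embedding of a poset into the poset with a minimum and a maximum adjoined. -/
def toBounded (q : Q) : WithBot (WithTop Q) := ((q : WithTop Q) : WithBot (WithTop Q))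

theorem toBounded_le_iff {a b : Q} : toBounded a ≤ toBounded b ↔ a ≤ b := by
  simp [toBounded]

theorem toBounded_injective : Function.Injective (toBounded : Q → WithBot (WithTop Q)) :=
  fun _ _ h => le_antisymm (toBounded_le_iff.1 h.le) (toBounded_le_iff.1 h.ge)

omit [PartialOrder Q] in
theorem toBounded_ne_bot (q : Q) : toBounded q ≠ ⊥ := WithBot.coe_ne_bot

omit [PartialOrder Q] in
theorem toBounded_ne_top (q : Q) : toBounded q ≠ ⊤ := by
  intro h
  exact WithTop.coe_ne_top (WithBot.coe_injective (h.trans WithBot.coe_top.symm))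

omit [PartialOrder Q] in
theorem exists_toBounded_eq {p : WithBot (WithTop Q)} (hbot : p ≠ ⊥) (htop : p ≠ ⊤) :
    ∃ q : Q, toBounded q = p := by
  induction p with
  | bot => exact absurd rfl hbot
  | coe p =>
    induction p with
    | top => exact absurd rfl htop
    | coe q => exact ⟨q, rfl⟩

theorem IsMaxChain.bot_mem' {P : Type*} [PartialOrder P] [OrderBot P] {d : Set P}
    (hd : IsMaxChain (· ≤ ·) d) : ⊥ ∈ d := hd.mem_of_le_or_le fun _ _ => Or.inr bot_le

theorem IsMaxChain.top_mem' {P : Type*} [PartialOrder P] [OrderTop P] {d : Set P}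
    (hd : IsMaxChain (· ≤ ·) d) : ⊤ ∈ d := hd.mem_of_le_or_le fun _ _ => Or.inl le_top

theorem IsChain.image_toBounded {s : Set Q} (hs : IsChain (· ≤ ·) s) :
    IsChain (· ≤ ·) (toBounded '' s) := by
  rintro _ ⟨x, hx, rfl⟩ _ ⟨y, hy, rfl⟩ _
  exact (hs.le_or_le hx hy).imp toBounded_le_iff.2 toBounded_le_iff.2

theorem IsMaxChain.preimage_toBounded {d : Set (WithBot (WithTop Q))}
    (hd : IsMaxChain (· ≤ ·) d) : IsMaxChain (· ≤ ·) (toBounded ⁻¹' d) := by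
  refine ⟨fun x hx y hy _ => ?_, fun s hs hds => Set.Subset.antisymm hds fun q hq => ?_⟩
  · exact (hd.1.le_or_le (x := toBounded x) hx hy).imp toBounded_le_iff.1 toBounded_le_iff.1
  · refine hd.mem_of_le_or_le fun x hx => ?_
    by_cases hbot : x = ⊥
    · exact Or.inl (hbot ▸ bot_le)
    by_cases htop : x = ⊤
    · exact Or.inr (htop ▸ le_top)
    obtain ⟨a, rfl⟩ := exists_toBounded_eq hbot htop
    rw [toBounded_le_iff, toBounded_le_iff]
    exact hs.le_or_le (hds hx) hq

theorem exists_isThinShelling [Fintype Q] [DecidableEq Q] {n : ℕ}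
    (hr : ∀ c : Set Q, IsMaxChain (· ≤ ·) c → c.ncard = n + 1)
    (hgraded : GradedIn (α := WithBot (WithTop Q)) (· ≤ ·) Set.univ)
    (hthin : ThinIn (α := WithBot (WithTop Q)) (· ≤ ·) Set.univ)
    (hshell : ShellableIn (α := WithBot (WithTop Q)) (· ≤ ·) Set.univ) :
    ∃ (t : ℕ) (c : ℕ → Finset Q), 0 < t ∧ IsThinShelling c t n ∧
      (∀ i < t, IsChain (· ≤ ·) (c i : Set Q)) ∧
      ∀ s : Set Q, IsChain (· ≤ ·) s → ∃ i < t, s ⊆ c i := by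
  classical
  obtain ⟨N, hN⟩ := hgraded
  simp only [maxChainIn_univ_iff] at hN
  obtain ⟨t, C, hinj, hmax, hall, hsh⟩ := hshell
  simp only [maxChainIn_univ_iff] at hmax hall
  have : Finite (WithBot (WithTop Q)) := inferInstanceAs (Finite (Option (Option Q)))
  set c : ℕ → Finset Q := fun i => if hi : i < t then
    Finset.univ.filter fun q => toBounded q ∈ C ⟨i, hi⟩ else ∅ with hc
  have hmem : ∀ (i : Fin t) q, q ∈ c i ↔ toBounded q ∈ C i := by
    intro i q
    simp [hc]
  have hcoe : ∀ i : Fin t, (c i : Set Q) = toBounded ⁻¹' C i := by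
    intro i
    ext q
    exact hmem i q
  have hsubset : ∀ s : Set Q, IsChain (· ≤ ·) s → ∃ i < t, s ⊆ c i := by
    intro s hs
    obtain ⟨m, hm, hsm⟩ := hs.image_toBounded.exists_maxChain
    obtain ⟨i, rfl⟩ := hall m hm
    exact ⟨i, i.2, fun q hq => (hmem i q).2 (hsm (Set.mem_image_of_mem _ hq))⟩
  have herase : ∀ (i j : Fin t) (v : Q), (c i).erase v ⊆ c j ↔ C i \ {toBounded v} ⊆ C j := by
    intro i j v
    constructor
    · rintro h p ⟨hp, hpv⟩
      by_cases hbot : p = ⊥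
      · exact hbot ▸ (hmax j).bot_mem'
      by_cases htop : p = ⊤
      · exact htop ▸ (hmax j).top_mem'
      obtain ⟨q, rfl⟩ := exists_toBounded_eq hbot htop
      exact (hmem j q).1 (h (Finset.mem_erase.2 ⟨fun hqv => hpv (hqv ▸ rfl), (hmem i q).2 hp⟩))
    · intro h q hq
      rw [Finset.mem_erase] at hq
      exact (hmem j q).2 (h ⟨(hmem i q).1 hq.2, fun hqv => hq.1 (toBounded_injective hqv)⟩)
  have hexch : ∀ (i : Fin t) (v : Q), v ∈ c i → ∃ d', IsMaxChain (· ≤ ·) d' ∧ d' ≠ C i ∧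
      C i \ {toBounded v} ⊆ d' ∧ ∀ d'', IsMaxChain (· ≤ ·) d'' → C i \ {toBounded v} ⊆ d'' →
        d'' = C i ∨ d'' = d' := fun i v hv =>
    (hmax i).exists_exchange hN hthin ((hmem i v).1 hv) (toBounded_ne_bot v) (toBounded_ne_top v)
  refine ⟨t, c, ?_, ⟨?_, ?_, ?_, ?_⟩, ?_, hsubset⟩
  · obtain ⟨i, hi, -⟩ := hsubset ∅ (by simp)
    omega
  · intro i hi
    rw [← hr _ (hmax ⟨i, hi⟩).preimage_toBounded, ← hcoe ⟨i, hi⟩, Set.ncard_coe_finset]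
  · intro i hi v hv
    obtain ⟨d', hd', hne, hsub, -⟩ := hexch ⟨i, hi⟩ v hv
    obtain ⟨k, rfl⟩ := hall d' hd'
    refine ⟨k, k.2, fun hki => hne ?_, (herase ⟨i, hi⟩ k v).2 hsub⟩
    exact congrArg C (Fin.ext hki)
  · intro i hi v hv j hj k hk hji hki hsj hsk
    obtain ⟨d', -, -, -, huniq⟩ := hexch ⟨i, hi⟩ v hv
    have heq : ∀ l (hl : l < t), l ≠ i → (c i).erase v ⊆ c l → C ⟨l, hl⟩ = d' := by
      intro l hl hli hsl
      refine (huniq _ (hmax _) ((herase ⟨i, hi⟩ ⟨l, hl⟩ v).1 hsl)).resolve_left fun h => hli ?_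
      exact congrArg Fin.val (hinj h)
    exact congrArg Fin.val (hinj ((heq j hj hji hsj).trans (heq k hk hki hsk).symm))
  · intro j hj i hij
    obtain ⟨k, hkj, hsub, hcard⟩ := hsh ⟨i, hij.trans hj⟩ ⟨j, hj⟩ hij
    have hpos : 0 < (C ⟨j, hj⟩).ncard := (Set.ncard_pos).2 ⟨_, (hmax _).bot_mem'⟩
    have hdiff : (C ⟨j, hj⟩ \ C k).ncard = 1 := by
      have := Set.ncard_inter_add_ncard_sdiff_eq_ncard (C ⟨j, hj⟩) (C k)
      rw [Set.inter_comm] at this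
      omega
    obtain ⟨p, hp⟩ := Set.ncard_eq_one.1 hdiff
    have hp' : p ∈ C ⟨j, hj⟩ \ C k := hp ▸ Set.mem_singleton p
    obtain ⟨v, rfl⟩ := exists_toBounded_eq (p := p)
      (fun h => hp'.2 (h ▸ (hmax k).bot_mem')) (fun h => hp'.2 (h ▸ (hmax k).top_mem'))
    refine ⟨k, hkj, v, (hmem ⟨j, hj⟩ v).2 hp'.1, fun hvi => hp'.2 ?_, ?_⟩
    · exact (hsub ⟨(hmem ⟨i, hij.trans hj⟩ v).1 hvi, hp'.1⟩).1
    · refine (herase ⟨j, hj⟩ k v).2 fun q hq => ?_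
      by_contra hqk
      have : q ∈ C ⟨j, hj⟩ \ C k := ⟨hq.1, hqk⟩
      rw [hp] at this
      exact hq.2 this
  · intro i hi
    rw [hcoe ⟨i, hi⟩]
    exact (hmax ⟨i, hi⟩).preimage_toBounded.1

theorem initialComplex_eq_orderComplexOn [Fintype Q] {c : ℕ → Finset Q} {t : ℕ}
    (hchain : ∀ i < t, IsChain (· ≤ ·) (c i : Set Q))
    (hcover : ∀ s : Set Q, IsChain (· ≤ ·) s → ∃ i < t, s ⊆ c i) :
    initialComplex c t = orderComplexOn (Set.univ : Set Q) := by
  ext x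
  constructor
  · rintro ⟨i, hi, hx, hx0⟩
    have hsupp : ∀ a, x a ≠ 0 → a ∈ c i := fun a ha => by_contra fun h => ha (hx0 a h)
    exact ⟨hx, fun a b ha hb => (hchain i hi).le_or_le (hsupp a ha) (hsupp b hb),
      fun a _ => Set.mem_univ a⟩
  · rintro ⟨hx, hxc, -⟩
    obtain ⟨i, hi, hsub⟩ := hcover {a | x a ≠ 0} fun a ha b hb _ => hxc a b ha hb
    exact ⟨i, hi, hx, fun v hv => by_contra fun h => hv (hsub h)⟩

end FacePoset

/-- (Björner) Let `X = ⨆_{α ∈ Q} X_α` be a regular CW complex, with face poset `Q`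
(ordered by `β ≤ α` iff `X_β ⊆ closure (X_α)`). If the poset `Q̂`, obtained from `Q` by
adjoining a minimum `0̂` and a maximum `1̂`, is graded, thin and shellable, and `r` is the
common cardinality of the maximal chains of `Q`, then `X` is homeomorphic to a sphere of
dimension `r − 1`. Here `Q̂` is realized as `WithBot (WithTop Q)`. -/
theorem regularCW_shellable_homeomorph_sphere
    (X : Type*) [TopologicalSpace X] [T2Space X]
    (Q : Type*) [Fintype Q] [PartialOrder Q]
    (piece : Q → Set X)
    (hpart : ∀ p : X, ∃! α : Q, p ∈ piece α)
    (hcell : ∀ α : Q, ∃ n : ℕ,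
      ∃ φ : (Metric.closedBall (0 : EuclideanSpace ℝ (Fin n)) 1) ≃ₜ (closure (piece α)),
        (fun x : Metric.closedBall (0 : EuclideanSpace ℝ (Fin n)) 1 => ((φ x : X))) ''
          {x : Metric.closedBall (0 : EuclideanSpace ℝ (Fin n)) 1 |
            ‖(x : EuclideanSpace ℝ (Fin n))‖ < 1} = piece α)
    (hclosure : ∀ α : Q, ∃ s : Set Q, closure (piece α) = ⋃ β ∈ s, piece β)
    (horder : ∀ α β : Q, β ≤ α ↔ piece β ⊆ closure (piece α))
    (r : ℕ) (hr1 : 1 ≤ r)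
    (hr : ∀ c : Set Q, IsMaxChain (· ≤ ·) c → c.ncard = r)
    (hgraded : GradedIn (α := WithBot (WithTop Q)) (· ≤ ·) Set.univ)
    (hthin : ThinIn (α := WithBot (WithTop Q)) (· ≤ ·) Set.univ)
    (hshell : ShellableIn (α := WithBot (WithTop Q)) (· ≤ ·) Set.univ) :
    Nonempty (X ≃ₜ Metric.sphere (0 : EuclideanSpace ℝ (Fin r)) 1) := by
  classical
  obtain ⟨n, rfl⟩ : ∃ n, r = n + 1 := ⟨r - 1, by omega⟩
  obtain ⟨t, c, ht, hc, hchain, hcover⟩ := exists_isThinShelling hr hgraded hthin hshell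
  obtain ⟨g, hg, hgbij⟩ := hc.exists_sphere_param ht
  rw [initialComplex_eq_orderComplexOn hchain hcover] at hgbij
  have : Nonempty X := by
    obtain ⟨q, -⟩ : (c 0).Nonempty := Finset.card_pos.1 (by rw [hc.card 0 ht]; omega)
    obtain ⟨m, φ, -⟩ := hcell q
    exact ⟨φ ⟨0, by simp⟩⟩
  obtain ⟨h, hh⟩ := exists_isOrderComplexParam piece hpart hcell hclosure horder
  have hbij := (hh.bijOn_univ hpart).comp hgbij
  have hcont : ContinuousOn (h ∘ g) (Metric.sphere 0 1) :=
    hh.continuousOn.comp hg hgbij.mapsTo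
  rw [continuousOn_iff_continuous_domRestrict] at hcont
  have hbij' : Function.Bijective
      ((Metric.sphere (0 : EuclideanSpace ℝ (Fin (n + 1))) 1).domRestrict (h ∘ g)) := by
    refine ⟨fun x y hxy => Subtype.ext (hbij.injOn x.2 y.2 hxy), fun p => ?_⟩
    obtain ⟨x, hx, hxp⟩ := hbij.surjOn (Set.mem_univ p)
    exact ⟨⟨x, hx⟩, hxp⟩
  exact ⟨(Continuous.homeoOfEquivCompactToT2 (f := Equiv.ofBijective _ hbij') hcont).symm⟩
end
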